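/- Let f be a primitive positive definite integral binary quadratic form of discriminant D < 0. Then there exist a real constant C > 0 and a real δ > 0 such that B_f(x) = C·x/√(log x) + O(x/(log x)^{1/2+δ}) as x → ∞; moreover, the constant C depends only on D, i.e., if g is another primitive positive definite integral binary quadratic form of the same discriminant D, then B_g(x) = C·x/√(log x) + O(x/(log x)^{1/2+δ}) with the same constant C. -/

import Mathlib

open Filter Real Asymptotics

/-- The number of positive integers `n ≤ x` represented by the integral binary quadratic
form `a X² + b X Y + c Y²`. -/
noncomputable def Bcount (a b c : ℤ) (x : ℝ) : ℕ :=
  Set.ncard {n : ℕ | 0 < n ∧ (n : ℝ) ≤ x ∧ ∃ u v : ℤ, (n : ℤ) = a * u ^ 2 + b * u * v + c * v ^ 2}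

set_option linter.unusedSectionVars false

namespace Bernays
open QuadraticAlgebra

/-- The quadratic order `ℤ[ω]` with `ω² = t ω - n`. -/
abbrev Ord (t n : ℤ) := QuadraticAlgebra ℤ (-n) t

section Order
variable {t n : ℤ}

theorem four_mul_norm (z : Ord t n) :
    4 * norm z = (2 * z.re + t * z.im) ^ 2 - (t ^ 2 - 4 * n) * z.im ^ 2 := by
  rw [norm_def]; ring

variable [hD : Fact (t ^ 2 - 4 * n < 0)]

theorem norm_nonneg (z : Ord t n) : 0 ≤ norm z := by
  have := four_mul_norm z
  nlinarith [hD.out, sq_nonneg (2 * z.re + t * z.im), sq_nonneg z.im]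

theorem norm_eq_zero {z : Ord t n} : norm z = 0 ↔ z = 0 := by
  refine ⟨fun h => ?_, fun h => by simp [h]⟩
  have h4 := four_mul_norm z
  rw [h] at h4
  have h2 : z.im = 0 := by
    by_contra hne
    have : 0 < z.im ^ 2 := by positivity
    nlinarith [hD.out, sq_nonneg (2 * z.re + t * z.im)]
  have h3 : z.re = 0 := by
    rw [h2] at h4
    have : z.re ^ 2 = 0 := by linarith
    simpa using this
  ext <;> simp [h2, h3]

theorem norm_pos {z : Ord t n} (hz : z ≠ 0) : 0 < norm z :=
  lt_of_le_of_ne (norm_nonneg z) (fun h => hz (norm_eq_zero.1 h.symm))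

instance : NoZeroDivisors (Ord t n) where
  eq_zero_or_eq_zero_of_mul_eq_zero {a b} h := by
    have : norm a * norm b = 0 := by rw [← map_mul, h, QuadraticAlgebra.norm_zero]
    simpa [norm_eq_zero] using this

instance : IsDomain (Ord t n) := NoZeroDivisors.to_isDomain _

/-- The conjugate of an ideal. -/
noncomputable def conj (B : Ideal (Ord t n)) : Ideal (Ord t n) := B.map (starRingEnd (Ord t n))

theorem star_mem_conj {B : Ideal (Ord t n)} {x : Ord t n} (h : x ∈ B) : star x ∈ conj B :=
  Ideal.mem_map_of_mem (starRingEnd (Ord t n)) h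

@[simp] theorem conj_conj (B : Ideal (Ord t n)) : conj (conj B) = B := by
  unfold conj
  rw [Ideal.map_map]
  have : (starRingEnd (Ord t n)).comp (starRingEnd (Ord t n)) = RingHom.id _ := by
    ext x <;> simp
  rw [this, Ideal.map_id]

@[simp] theorem conj_mul (B C : Ideal (Ord t n)) : conj (B * C) = conj B * conj C :=
  Ideal.map_mul _ _ _

theorem conj_span (s : Set (Ord t n)) : conj (Ideal.span s) = Ideal.span (star '' s) :=
  Ideal.map_span _ _

theorem conj_span_singleton (x : Ord t n) : conj (Ideal.span {x}) = Ideal.span {star x} := by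
  rw [conj_span, Set.image_singleton]

theorem star_natCast' (k : ℕ) : star ((k : ℕ) : Ord t n) = (k : Ord t n) := by
  ext <;> simp

theorem norm_cast_eq (z : Ord t n) : ((norm z : ℤ) : Ord t n) = z * star z :=
  algebraMap_norm_eq_mul_star z

theorem intCast_dvd_iff {k : ℤ} {z : Ord t n} : (k : Ord t n) ∣ z ↔ k ∣ z.re ∧ k ∣ z.im :=
  algebraMap_dvd_iff

theorem natCast_dvd_iff {k : ℕ} {z : Ord t n} :
    (k : Ord t n) ∣ z ↔ (k : ℤ) ∣ z.re ∧ (k : ℤ) ∣ z.im := by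
  rw [← intCast_dvd_iff, Int.cast_natCast]

/-- The ideals `B` with `B * conj B = (k)`. -/
def IsN (k : ℕ) (B : Ideal (Ord t n)) : Prop := B * conj B = Ideal.span {(k : Ord t n)}

theorem IsN.mul {k l : ℕ} {B C : Ideal (Ord t n)} (hB : IsN k B) (hC : IsN l C) :
    IsN (k * l) (B * C) := by
  unfold IsN at *
  rw [conj_mul, mul_mul_mul_comm, hB, hC, Ideal.span_singleton_mul_span_singleton, Nat.cast_mul]

theorem IsN.conj {k : ℕ} {B : Ideal (Ord t n)} (hB : IsN k B) : IsN k (conj B) := by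
  unfold IsN at *
  rw [conj_conj, mul_comm, hB]

theorem isN_span_natCast (k : ℕ) : IsN (k ^ 2) (Ideal.span {(k : Ord t n)}) := by
  unfold IsN
  rw [conj_span_singleton, star_natCast', Ideal.span_singleton_mul_span_singleton, sq,
    Nat.cast_mul]

theorem isN_one : IsN 1 (⊤ : Ideal (Ord t n)) := by
  have := isN_span_natCast (t := t) (n := n) 1
  simpa using this

theorem natCast_ne_zero {k : ℕ} (hk : k ≠ 0) : (k : Ord t n) ≠ 0 := by
  exact_mod_cast hk

theorem span_natCast_inj {k l : ℕ} (h : Ideal.span {(k : Ord t n)} = Ideal.span {(l : Ord t n)}) :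
    k = l := by
  have h1 : (k : Ord t n) ∣ l := by
    rw [← Ideal.span_singleton_le_span_singleton, h]
  have h2 : (l : Ord t n) ∣ k := by
    rw [← Ideal.span_singleton_le_span_singleton, h]
  rw [natCast_dvd_iff] at h1 h2
  apply Nat.dvd_antisymm
  · simpa [Int.natCast_dvd_natCast] using h1.1
  · simpa [Int.natCast_dvd_natCast] using h2.1

theorem IsN.unique {k l : ℕ} {B : Ideal (Ord t n)} (h : IsN k B) (h' : IsN l B) : k = l :=
  span_natCast_inj (h.symm.trans h')

theorem isN_span {x : Ord t n} {k : ℕ} (h : norm x = k) : IsN k (Ideal.span {x}) := by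
  unfold IsN
  rw [conj_span_singleton, Ideal.span_singleton_mul_span_singleton, ← norm_cast_eq, h,
    Int.cast_natCast]

theorem IsN.norm_eq {x : Ord t n} {k : ℕ} (h : IsN k (Ideal.span {x})) : norm x = k := by
  have h1 : IsN (norm x).toNat (Ideal.span {x}) :=
    isN_span (by rw [Int.toNat_of_nonneg (norm_nonneg x)])
  have := h.unique h1
  rw [this, Int.toNat_of_nonneg (norm_nonneg x)]

theorem exists_span_mul_eq {x : Ord t n} {I : Ideal (Ord t n)} (h : I ≤ Ideal.span {x}) :
    ∃ C : Ideal (Ord t n), I = Ideal.span {x} * C := by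
  refine ⟨Submodule.comap (LinearMap.mulLeft (Ord t n) x) I, le_antisymm ?_ ?_⟩
  · intro y hy
    obtain ⟨z, rfl⟩ := Ideal.mem_span_singleton'.1 (h hy)
    rw [Ideal.mem_span_singleton_mul]
    exact ⟨z, by simpa [mul_comm] using hy, mul_comm _ _⟩
  · rw [Ideal.span_singleton_mul_le_iff]
    intro z hz
    simpa using hz

theorem IsN.dvd {k : ℕ} {B A : Ideal (Ord t n)} (hk : k ≠ 0) (h : IsN k B) (hA : A ≤ B) :
    ∃ C, A = B * C := by
  have h1 : A * Bernays.conj B ≤ Ideal.span {(k : Ord t n)} := by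
    rw [← h]; exact Ideal.mul_mono_left hA
  obtain ⟨C, hC⟩ := exists_span_mul_eq h1
  refine ⟨C, ?_⟩
  rw [← Ideal.span_singleton_mul_right_inj (natCast_ne_zero (t := t) (n := n) hk), ← mul_assoc,
    mul_comm _ B, mul_assoc, ← hC, ← h, mul_assoc, mul_comm A]

theorem IsN.of_mul {k l : ℕ} {B C : Ideal (Ord t n)} (hl : l ≠ 0) (hB : IsN l B)
    (h : IsN (l * k) (B * C)) : IsN k C := by
  have hl' := natCast_ne_zero (t := t) (n := n) hl
  unfold IsN at *
  rw [conj_mul, mul_mul_mul_comm, hB, Nat.cast_mul, ← Ideal.span_singleton_mul_span_singleton,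
    Ideal.span_singleton_mul_right_inj hl'] at h
  exact h

theorem IsN.mul_left_cancel {k : ℕ} {B C C' : Ideal (Ord t n)} (hk : k ≠ 0) (hB : IsN k B)
    (h : B * C = B * C') : C = C' := by
  have hk' := natCast_ne_zero (t := t) (n := n) hk
  rw [← Ideal.span_singleton_mul_right_inj hk', ← hB, mul_comm B, mul_assoc, h, ← mul_assoc]

open FractionalIdeal nonZeroDivisors in
/-- The class of an invertible ideal. -/
noncomputable def cls (B : Ideal (Ord t n)) : ClassGroup (Ord t n) :=
  open Classical in
  if h : IsUnit (B : FractionalIdeal (Ord t n)⁰ (FractionRing (Ord t n))) then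
    ClassGroup.mk (FractionRing (Ord t n)) h.unit else 1

open FractionalIdeal nonZeroDivisors in
theorem isUnit_span {x : Ord t n} (hx : x ≠ 0) : IsUnit
    ((Ideal.span {x} : Ideal (Ord t n)) : FractionalIdeal (Ord t n)⁰ (FractionRing (Ord t n))) := by
  rw [FractionalIdeal.coeIdeal_span_singleton]
  refine IsUnit.of_mul_eq_one (FractionalIdeal.spanSingleton _ (algebraMap _ _ x)⁻¹) ?_
  rw [FractionalIdeal.spanSingleton_mul_spanSingleton, mul_inv_cancel₀,
    FractionalIdeal.spanSingleton_one]
  simpa using hx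

open FractionalIdeal nonZeroDivisors in
theorem IsN.isUnit {k : ℕ} {B : Ideal (Ord t n)} (hk : k ≠ 0) (hB : IsN k B) :
    IsUnit (B : FractionalIdeal (Ord t n)⁰ (FractionRing (Ord t n))) := by
  have h := isUnit_span (natCast_ne_zero (t := t) (n := n) hk)
  rw [← hB, FractionalIdeal.coeIdeal_mul] at h
  exact isUnit_of_mul_isUnit_left h

theorem cls_mul {k l : ℕ} {B C : Ideal (Ord t n)} (hk : k ≠ 0) (hB : IsN k B)
    (hl : l ≠ 0) (hC : IsN l C) : cls (B * C) = cls B * cls C := by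
  have h1 := hB.isUnit hk
  have h2 := hC.isUnit hl
  have h3 := (hB.mul hC).isUnit (mul_ne_zero hk hl)
  rw [cls, cls, cls, dif_pos h1, dif_pos h2, dif_pos h3, ← map_mul]
  congr 1
  ext1
  simp

theorem cls_eq_one_iff {k : ℕ} {B : Ideal (Ord t n)} (hk : k ≠ 0) (hB : IsN k B) :
    cls B = 1 ↔ ∃ x : Ord t n, x ≠ 0 ∧ B = Ideal.span {x} := by
  rw [cls, dif_pos (hB.isUnit hk), ClassGroup.mk_eq_one_of_coe_ideal (I' := B) (by simp)]

theorem cls_span (x : Ord t n) (hx : x ≠ 0) : cls (Ideal.span {x}) = 1 := by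
  have h : IsN (norm x).toNat (Ideal.span {x}) :=
    isN_span (by rw [Int.toNat_of_nonneg (norm_nonneg x)])
  have := norm_pos hx
  rw [cls_eq_one_iff (by omega) h]
  exact ⟨x, hx, rfl⟩

theorem cls_top : cls (⊤ : Ideal (Ord t n)) = 1 := by
  rw [← Ideal.span_singleton_one]; exact cls_span _ one_ne_zero

theorem cls_conj {k : ℕ} {B : Ideal (Ord t n)} (hk : k ≠ 0) (hB : IsN k B) :
    cls (Bernays.conj B) = (cls B)⁻¹ := by
  rw [eq_inv_iff_mul_eq_one, mul_comm, ← cls_mul hk hB hk hB.conj, hB]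
  exact cls_span _ (natCast_ne_zero hk)

end Order
end Bernays

namespace Bernays
open QuadraticAlgebra

section PrimeExt
variable {M N : Type*} [CommMonoid M] [CommMonoid N]

/-- The completely multiplicative extension of a function on the primes. -/
def pext (g : ℕ → M) (s : ℕ) : M := (s.primeFactorsList.map g).prod

@[simp] theorem pext_one (g : ℕ → M) : pext g 1 = 1 := by simp [pext]

theorem pext_mul (g : ℕ → M) {a b : ℕ} (ha : a ≠ 0) (hb : b ≠ 0) :
    pext g (a * b) = pext g a * pext g b := by
  unfold pext
  rw [((Nat.perm_primeFactorsList_mul ha hb).map g).prod_eq, List.map_append, List.prod_append]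

theorem pext_prime (g : ℕ → M) {p : ℕ} (hp : p.Prime) : pext g p = g p := by
  simp [pext, Nat.primeFactorsList_prime hp]

theorem map_pext (φ : M →* N) (g : ℕ → M) (s : ℕ) : φ (pext g s) = pext (fun p => φ (g p)) s := by
  simp [pext, map_list_prod, Function.comp_def]

theorem pext_congr {g g' : ℕ → M} {s : ℕ} (h : ∀ p, p.Prime → p ∣ s → g p = g' p) :
    pext g s = pext g' s := by
  unfold pext
  congr 1
  apply List.map_congr_left
  intro p hp
  exact h p (Nat.prime_of_mem_primeFactorsList hp) (Nat.dvd_of_mem_primeFactorsList hp)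

/-- `s` is nonzero and all its prime factors satisfy `S`. -/
def AllP (S : ℕ → Prop) (s : ℕ) : Prop := s ≠ 0 ∧ ∀ p, p.Prime → p ∣ s → S p

theorem allP_one (S : ℕ → Prop) : AllP S 1 :=
  ⟨one_ne_zero, fun _ hp h => absurd (Nat.dvd_one.1 h) hp.one_lt.ne'⟩

theorem allP_mul {S : ℕ → Prop} {a b : ℕ} : AllP S (a * b) ↔ AllP S a ∧ AllP S b := by
  constructor
  · rintro ⟨h0, h⟩
    exact ⟨⟨left_ne_zero_of_mul h0, fun p hp hd => h p hp (hd.mul_right b)⟩,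
      ⟨right_ne_zero_of_mul h0, fun p hp hd => h p hp (hd.mul_left a)⟩⟩
  · rintro ⟨ha, hb⟩
    refine ⟨mul_ne_zero ha.1 hb.1, fun p hp hd => ?_⟩
    rcases hp.dvd_mul.1 hd with h | h
    · exact ha.2 p hp h
    · exact hb.2 p hp h

theorem allP_prime {S : ℕ → Prop} {p : ℕ} (hp : p.Prime) : AllP S p ↔ S p := by
  refine ⟨fun h => h.2 p hp dvd_rfl, fun h => ⟨hp.ne_zero, fun q hq hd => ?_⟩⟩
  rwa [(Nat.prime_dvd_prime_iff_eq hq hp).1 hd]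

@[elab_as_elim]
theorem AllP.induction {S : ℕ → Prop} {P : ∀ s, AllP S s → Prop} (one : P 1 (allP_one S))
    (mul : ∀ p a (hp : p.Prime) (hS : S p) (ha : AllP S a), P a ha →
      P (p * a) (allP_mul.2 ⟨(allP_prime hp).2 hS, ha⟩)) {s : ℕ} (hs : AllP S s) : P s hs := by
  induction s using induction_on_primes with
  | zero => exact absurd rfl hs.1
  | one => exact one
  | prime_mul p a hp ih =>
    have := allP_mul.1 hs
    exact mul p a hp ((allP_prime hp).1 this.1) this.2 (ih this.2)

end PrimeExt

section Order
variable {t n : ℤ} [hD : Fact (t ^ 2 - 4 * n < 0)]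

/-- The ideal `(s, ω - r)`. -/
noncomputable def Kid (s : ℕ) (r : ℤ) : Ideal (Ord t n) := Ideal.span {(s : Ord t n), ⟨-r, 1⟩}

theorem natCast_mem_Kid (s : ℕ) (r : ℤ) : (s : Ord t n) ∈ Kid (t := t) (n := n) s r :=
  Ideal.subset_span (by simp)

theorem omega_mem_Kid (s : ℕ) (r : ℤ) : (⟨-r, 1⟩ : Ord t n) ∈ Kid (t := t) (n := n) s r :=
  Ideal.subset_span (by simp)

theorem mem_Kid {s : ℕ} {r : ℤ} (hr : (s : ℤ) ∣ r ^ 2 - t * r + n) {x : Ord t n} :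
    x ∈ Kid (t := t) (n := n) s r ↔ (s : ℤ) ∣ x.re + x.im * r := by
  unfold Kid
  rw [Ideal.mem_span_pair]
  constructor
  · rintro ⟨a, b, rfl⟩
    obtain ⟨k, hk⟩ := hr
    refine ⟨a.re + a.im * r - b.im * k, ?_⟩
    simp
    linear_combination (-b.im) * hk
  · rintro ⟨k, hk⟩
    refine ⟨(k : Ord t n), (x.im : Ord t n), ?_⟩
    ext
    · simp; linear_combination -hk
    · simp

theorem conj_Kid (s : ℕ) (r : ℤ) : conj (Kid (t := t) (n := n) s r) = Kid s (t - r) := by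
  unfold Kid
  rw [conj_span, Set.image_pair, star_natCast']
  have : star (⟨-r, 1⟩ : Ord t n) = -⟨-(t - r), 1⟩ := by ext <;> simp; ring
  rw [this, Ideal.span_insert, Ideal.span_singleton_neg, ← Ideal.span_insert]

theorem root_conj {s : ℕ} {r : ℤ} (hr : (s : ℤ) ∣ r ^ 2 - t * r + n) :
    (s : ℤ) ∣ (t - r) ^ 2 - t * (t - r) + n := by
  convert hr using 1; ring

theorem coprime_root {s : ℕ} {r : ℤ} (hr : (s : ℤ) ∣ r ^ 2 - t * r + n)
    (hs : IsCoprime (s : ℤ) (t ^ 2 - 4 * n)) : IsCoprime (s : ℤ) (t - 2 * r) := by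
  obtain ⟨k, hk⟩ := hr
  have : t ^ 2 - 4 * n = (t - 2 * r) ^ 2 + s * (-4 * k) := by linear_combination (-4) * hk
  rw [this, IsCoprime.add_mul_left_right_iff] at hs
  exact IsCoprime.of_isCoprime_of_dvd_right hs (dvd_pow_self _ two_ne_zero)

theorem Kid_mul_le {s s' : ℕ} {r r' : ℤ} {I : Ideal (Ord t n)} (h1 : (s : Ord t n) * s' ∈ I)
    (h2 : (s : Ord t n) * ⟨-r', 1⟩ ∈ I) (h3 : (⟨-r, 1⟩ : Ord t n) * s' ∈ I)
    (h4 : (⟨-r, 1⟩ : Ord t n) * ⟨-r', 1⟩ ∈ I) : Kid s r * Kid s' r' ≤ I := by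
  unfold Kid
  rw [Ideal.span_pair_mul_span_pair, Ideal.span_le]
  intro x hx
  simp only [Set.mem_insert_iff, Set.mem_singleton_iff] at hx
  rcases hx with rfl | rfl | rfl | rfl <;> assumption

theorem isN_Kid {s : ℕ} {r : ℤ} (hr : (s : ℤ) ∣ r ^ 2 - t * r + n)
    (hs : IsCoprime (s : ℤ) (t ^ 2 - 4 * n)) : IsN s (Kid (t := t) (n := n) s r) := by
  unfold IsN
  rw [conj_Kid]
  obtain ⟨a, b, hab⟩ := coprime_root hr hs
  obtain ⟨k, hk⟩ := hr
  have hs0 : (s : Ord t n) ∈ Ideal.span {(s : Ord t n)} := Ideal.mem_span_singleton_self _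
  apply le_antisymm
  · refine Kid_mul_le (Ideal.mul_mem_left _ _ hs0) (Ideal.mul_mem_right _ _ hs0)
      (Ideal.mul_mem_left _ _ hs0) ?_
    rw [Ideal.mem_span_singleton]
    refine ⟨((-k : ℤ) : Ord t n), ?_⟩
    ext
    · simp; linear_combination -hk
    · simp; ring
  · rw [Ideal.span_singleton_le_iff_mem]
    have := Ideal.add_mem _ (Ideal.mul_mem_left _ (a : Ord t n)
        (Ideal.mul_mem_mul (natCast_mem_Kid s r) (natCast_mem_Kid s (t - r))))
      (Ideal.mul_mem_left _ (b : Ord t n) (Ideal.sub_mem _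
        (Ideal.mul_mem_mul (omega_mem_Kid s r) (natCast_mem_Kid s (t - r)))
        (Ideal.mul_mem_mul (natCast_mem_Kid s r) (omega_mem_Kid s (t - r)))))
    convert this using 1
    ext
    · simp; linear_combination (-s : ℤ) * hab
    · simp

theorem Kid_mul {s s' : ℕ} {r : ℤ} (hr : ((s * s' : ℕ) : ℤ) ∣ r ^ 2 - t * r + n)
    (hs : IsCoprime (s : ℤ) (t ^ 2 - 4 * n)) :
    Kid (t := t) (n := n) s r * Kid s' r = Kid (s * s') r := by
  obtain ⟨a, b, hab⟩ := coprime_root (dvd_trans (by simp) hr) hs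
  obtain ⟨k, hk⟩ := hr
  have h1 := natCast_mem_Kid (t := t) (n := n) (s * s') r
  rw [Nat.cast_mul] at h1
  have h2 := omega_mem_Kid (t := t) (n := n) (s * s') r
  apply le_antisymm
  · exact Kid_mul_le h1 (Ideal.mul_mem_left _ _ h2) (Ideal.mul_mem_right _ _ h2)
      (Ideal.mul_mem_right _ _ h2)
  · have h1 := Ideal.mul_mem_mul (natCast_mem_Kid (t := t) (n := n) s r) (natCast_mem_Kid s' r)
    rw [Kid, Ideal.span_le]
    intro x hx
    simp only [Set.mem_insert_iff, Set.mem_singleton_iff] at hx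
    rw [SetLike.mem_coe]
    rcases hx with rfl | rfl
    · simpa using h1
    · have := Ideal.add_mem _ (Ideal.mul_mem_left _ (a : Ord t n)
          (Ideal.mul_mem_mul (natCast_mem_Kid s r) (omega_mem_Kid s' r)))
        (Ideal.mul_mem_left _ (b : Ord t n) (Ideal.add_mem _
          (Ideal.mul_mem_mul (omega_mem_Kid s r) (omega_mem_Kid s' r))
          (Ideal.mul_mem_left _ (k : Ord t n) h1)))
      convert this using 1
      push_cast at hk
      ext
      · simp; linear_combination r * hab + b * hk
      · simp; linear_combination - hab

theorem Kid_isPrime {p : ℕ} {r : ℤ} (hr : (p : ℤ) ∣ r ^ 2 - t * r + n) (hp : p.Prime) :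
    (Kid (t := t) (n := n) p r).IsPrime := by
  rw [Ideal.isPrime_iff]
  constructor
  · rw [Ne, Ideal.eq_top_iff_one, mem_Kid hr]
    simp only [QuadraticAlgebra.re_one, QuadraticAlgebra.im_one]
    intro h
    have := Int.natCast_dvd_natCast.1 (by simpa using h : (p : ℤ) ∣ ((1 : ℕ) : ℤ))
    exact hp.one_lt.ne' (Nat.dvd_one.1 this)
  · intro x y
    rw [mem_Kid hr, mem_Kid hr, mem_Kid hr]
    intro h
    apply (Nat.prime_iff_prime_int.1 hp).dvd_or_dvd
    have : (x.re + x.im * r) * (y.re + y.im * r) =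
      ((x * y).re + (x * y).im * r) + (r ^ 2 - t * r + n) * (x.im * y.im) := by
      simp; ring
    rw [this]
    exact dvd_add h (hr.mul_right _)

/-- The primes splitting in the order and not dividing the discriminant. -/
def IsS (t n : ℤ) (p : ℕ) : Prop :=
  p.Prime ∧ ¬ (p : ℤ) ∣ t ^ 2 - 4 * n ∧ ∃ r : ℤ, (p : ℤ) ∣ r ^ 2 - t * r + n

/-- The primes remaining inert in the order and not dividing the discriminant. -/
def IsI (t n : ℤ) (p : ℕ) : Prop :=
  p.Prime ∧ ¬ (p : ℤ) ∣ t ^ 2 - 4 * n ∧ ¬ ∃ r : ℤ, (p : ℤ) ∣ r ^ 2 - t * r + n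

theorem IsS.coprime {p : ℕ} (h : IsS t n p) : IsCoprime (p : ℤ) (t ^ 2 - 4 * n) := by
  exact (Nat.prime_iff_prime_int.1 h.1).irreducible.coprime_iff_not_dvd.2 h.2.1

open Classical in
/-- A chosen prime ideal above a splitting prime. -/
noncomputable def Pid (t n : ℤ) (p : ℕ) : Ideal (Ord t n) :=
  if h : IsS t n p then Kid p h.2.2.choose else ⊤

theorem IsS.Pid_eq {p : ℕ} (h : IsS t n p) :
    ∃ r : ℤ, (p : ℤ) ∣ r ^ 2 - t * r + n ∧ Pid t n p = Kid p r :=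
  ⟨_, h.2.2.choose_spec, by rw [Pid, dif_pos h]⟩

theorem IsS.isN_Pid {p : ℕ} (h : IsS t n p) : IsN p (Pid t n p) := by
  obtain ⟨r, hr, he⟩ := h.Pid_eq
  rw [he]
  exact isN_Kid hr h.coprime

theorem IsS.isPrime_Pid {p : ℕ} (h : IsS t n p) : (Pid t n p).IsPrime := by
  obtain ⟨r, hr, he⟩ := h.Pid_eq
  rw [he]
  exact Kid_isPrime hr h.1

theorem IsS.natCast_mem {p k : ℕ} (h : IsS t n p) : (k : Ord t n) ∈ Pid t n p ↔ p ∣ k := by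
  obtain ⟨r, hr, he⟩ := h.Pid_eq
  rw [he, mem_Kid hr]
  simp [Int.natCast_dvd_natCast]

theorem IsS.natCast_mem_conj {p k : ℕ} (h : IsS t n p) :
    (k : Ord t n) ∈ conj (Pid t n p) ↔ p ∣ k := by
  obtain ⟨r, hr, he⟩ := h.Pid_eq
  rw [he, conj_Kid, mem_Kid (root_conj hr)]
  simp [Int.natCast_dvd_natCast]

theorem IsS.not_conj_le {p : ℕ} (h : IsS t n p) : ¬ conj (Pid t n p) ≤ Pid t n p := by
  obtain ⟨r, hr, he⟩ := h.Pid_eq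
  rw [he, conj_Kid]
  intro hle
  have h1 : (⟨-(t - r), 1⟩ : Ord t n) ∈ Kid (t := t) (n := n) p r :=
    hle (Ideal.subset_span (by simp))
  rw [mem_Kid hr] at h1
  have h2 : (p : ℤ) ∣ t - 2 * r := by
    rw [← dvd_neg, show -(t - 2 * r) = -(t - r) + 1 * r by ring]; exact h1
  have h3 := coprime_root hr h.coprime
  have h4 := h3.isUnit_of_dvd' dvd_rfl h2
  exact (Nat.prime_iff_prime_int.1 h.1).not_isUnit h4

theorem AllP.coprime {s : ℕ} (h : AllP (IsS t n) s) : IsCoprime (s : ℤ) (t ^ 2 - 4 * n) := by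
  induction h using AllP.induction with
  | one => simpa using isCoprime_one_left
  | mul p a hp hS ha ih => rw [Nat.cast_mul]; exact IsCoprime.mul_left hS.coprime ih

/-- The ideal with all prime factors among the chosen primes and norm `s`. -/
noncomputable def PS (t n : ℤ) (s : ℕ) : Ideal (Ord t n) := pext (Pid t n) s

theorem PS_one : PS t n 1 = ⊤ := by simp [PS]

theorem PS_mul {a b : ℕ} (ha : a ≠ 0) (hb : b ≠ 0) : PS t n (a * b) = PS t n a * PS t n b :=
  pext_mul _ ha hb

theorem PS_prime {p : ℕ} (hp : p.Prime) : PS t n p = Pid t n p := pext_prime _ hp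

theorem AllP.isN_PS {s : ℕ} (h : AllP (IsS t n) s) : IsN s (PS t n s) := by
  induction h using AllP.induction with
  | one => rw [PS_one]; exact isN_one
  | mul p a hp hS ha ih =>
    rw [PS_mul hp.ne_zero ha.1, PS_prime hp]
    exact hS.isN_Pid.mul ih

theorem AllP.cls_PS {s : ℕ} (h : AllP (IsS t n) s) :
    cls (PS t n s) = pext (fun p => cls (Pid t n p)) s := by
  induction h using AllP.induction with
  | one => rw [PS_one, cls_top, pext_one]
  | mul p a hp hS ha ih =>
    rw [PS_mul hp.ne_zero ha.1, PS_prime hp, cls_mul hp.ne_zero hS.isN_Pid ha.1 ha.isN_PS, ih,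
      pext_mul _ hp.ne_zero ha.1, pext_prime _ hp]

theorem Kid_congr {s : ℕ} {r r' : ℤ} (h : (s : ℤ) ∣ r' - r) :
    Kid (t := t) (n := n) s r = Kid s r' := by
  obtain ⟨k, hk⟩ := h
  have : (⟨-r, 1⟩ : Ord t n) = ⟨-r', 1⟩ + (k : Ord t n) * s := by
    ext
    · simp; linear_combination hk
    · simp
  unfold Kid
  rw [this, Ideal.span_pair_comm, Ideal.span_pair_add_mul_right, Ideal.span_pair_comm]

theorem AllP.exists_Kid {s : ℕ} (h : AllP (IsS t n) s) :
    ∃ r : ℤ, (s : ℤ) ∣ r ^ 2 - t * r + n ∧ PS t n s = Kid s r ∧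
      ∀ p : ℕ, p.Prime → p ∣ s → Pid t n p = Kid p r := by
  induction h using AllP.induction with
  | one =>
    exact ⟨0, by simp, by rw [PS_one, Kid]; simp [Ideal.span_insert],
      fun p hp h => absurd (Nat.dvd_one.1 h) hp.one_lt.ne'⟩
  | mul p a hp hS ha ih =>
    obtain ⟨r, ⟨m, hm⟩, he, hpr⟩ := ih
    obtain ⟨r₀, ⟨m₀, hm₀⟩, he₀⟩ := hS.Pid_eq
    have hp' := Nat.prime_iff_prime_int.1 hp
    obtain ⟨r', h1, h2, h3⟩ : ∃ r' : ℤ, ((p * a : ℕ) : ℤ) ∣ r' ^ 2 - t * r' + n ∧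
        (a : ℤ) ∣ r' - r ∧ Pid t n p = Kid p r' := by
      by_cases hpa : p ∣ a
      · obtain ⟨x, y, hxy⟩ := coprime_root (s := p) (r := r) (n := n) (t := t)
          ((Int.natCast_dvd_natCast.2 hpa).trans ⟨m, hm⟩) hS.coprime
        obtain ⟨b, rfl⟩ := hpa
        refine ⟨r + (p * b : ℕ) * (m * y), ⟨m * x + b * (m * y) ^ 2, ?_⟩, ⟨m * y, by ring⟩, ?_⟩
        · push_cast at hm ⊢
          linear_combination hm - (p * b * m : ℤ) * hxy
        · rw [hpr p hp (dvd_mul_right _ _)]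
          exact Kid_congr ⟨b * (m * y), by push_cast; ring⟩
      · obtain ⟨x, y, hxy⟩ : IsCoprime (p : ℤ) (a : ℤ) :=
          hp'.irreducible.coprime_iff_not_dvd.2 (by rwa [Int.natCast_dvd_natCast])
        refine ⟨r + a * (y * (r₀ - r)), ?_, ⟨y * (r₀ - r), by ring⟩, ?_⟩
        · rw [Nat.cast_mul]
          refine IsCoprime.mul_dvd ⟨x, y, hxy⟩ ?_ ?_
          · have : r + a * (y * (r₀ - r)) = r₀ - p * (x * (r₀ - r)) := by
              linear_combination (r₀ - r) * hxy
            rw [this]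
            refine ⟨m₀ + p * (x * (r₀ - r)) ^ 2 - (2 * r₀ - t) * (x * (r₀ - r)), ?_⟩
            linear_combination hm₀
          · refine ⟨m + a * (y * (r₀ - r)) ^ 2 + (2 * r - t) * (y * (r₀ - r)), ?_⟩
            linear_combination hm
        · rw [he₀]
          refine Kid_congr ⟨- x * (r₀ - r), ?_⟩
          linear_combination (r₀ - r) * hxy
    have h4 : Kid (t := t) (n := n) a r = Kid a r' := Kid_congr h2
    refine ⟨r', h1, ?_, ?_⟩
    · rw [PS_mul hp.ne_zero ha.1, PS_prime hp, he, h3, h4, Kid_mul h1 hS.coprime]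
    · intro q hq hqd
      by_cases hqp : q = p
      · rw [hqp, h3]
      · have hqa : q ∣ a :=
          (hq.dvd_mul.1 hqd).resolve_left fun h => hqp ((Nat.prime_dvd_prime_iff_eq hq hp).1 h)
        rw [hpr q hq hqa]
        exact Kid_congr ((Int.natCast_dvd_natCast.2 hqa).trans h2)

end Order
end Bernays

namespace Bernays
open QuadraticAlgebra

section PrimeExt

theorem exists_allP_mul (S : ℕ → Prop) {k : ℕ} (hk : k ≠ 0) :
    ∃ s m, k = s * m ∧ AllP S s ∧ AllP (fun p => ¬ S p) m := by
  induction k using induction_on_primes with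
  | zero => exact absurd rfl hk
  | one => exact ⟨1, 1, rfl, allP_one _, allP_one _⟩
  | prime_mul p a hp ih =>
    obtain ⟨s, m, rfl, hs, hm⟩ := ih (right_ne_zero_of_mul hk)
    by_cases h : S p
    · exact ⟨p * s, m, by ring, allP_mul.2 ⟨(allP_prime hp).2 h, hs⟩, hm⟩
    · exact ⟨s, p * m, by ring, hs, allP_mul.2 ⟨(allP_prime hp).2 h, hm⟩⟩

theorem AllP.coprime_of_disjoint {S T : ℕ → Prop} (hST : ∀ p, S p → ¬ T p) {s m : ℕ}
    (hs : AllP S s) (hm : AllP T m) : Nat.Coprime s m :=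
  Nat.coprime_of_dvd fun p hp h1 h2 => hST p (hs.2 p hp h1) (hm.2 p hp h2)

theorem AllP.mul_inj {S T : ℕ → Prop} (hST : ∀ p, S p → ¬ T p) {s m s' m' : ℕ} (hs : AllP S s)
    (hm : AllP T m) (hs' : AllP S s') (hm' : AllP T m') (h : s * m = s' * m') :
    s = s' ∧ m = m' := by
  have h1 : s = s' := by
    apply Nat.dvd_antisymm
    · exact (hs.coprime_of_disjoint hST hm').dvd_of_dvd_mul_right (h ▸ dvd_mul_right s m)
    · exact (hs'.coprime_of_disjoint hST hm).dvd_of_dvd_mul_right (h ▸ dvd_mul_right s' m')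
  subst h1
  exact ⟨rfl, Nat.eq_of_mul_eq_mul_left (Nat.pos_of_ne_zero hs.1) h⟩

end PrimeExt

section Order
variable {t n : ℤ} [hD : Fact (t ^ 2 - 4 * n < 0)]

theorem lt_sq_mul {p k : ℕ} (hp : 2 ≤ p) (hk : 0 < k) : k < p ^ 2 * k := by
  have : 4 ≤ p ^ 2 := by nlinarith
  nlinarith

theorem conj_mono {B C : Ideal (Ord t n)} (h : B ≤ C) : conj B ≤ conj C := Ideal.map_mono h

theorem IsS.peel {p k : ℕ} {B : Ideal (Ord t n)} (hp : IsS t n p) (hB : IsN (p * k) B) :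
    ∃ B', IsN k B' ∧ (B = Pid t n p * B' ∨ B = conj (Pid t n p) * B') := by
  have hP := hp.isN_Pid
  have h0 := hp.1.ne_zero
  have hle : B * conj B ≤ Pid t n p := by
    rw [hB, Ideal.span_singleton_le_iff_mem, hp.natCast_mem]
    exact dvd_mul_right _ _
  rcases (Ideal.IsPrime.mul_le hp.isPrime_Pid).1 hle with h | h
  · obtain ⟨C, rfl⟩ := hP.dvd h0 h
    exact ⟨C, hP.of_mul h0 hB, Or.inl rfl⟩
  · have h' := conj_mono h
    rw [conj_conj] at h'
    obtain ⟨C, rfl⟩ := hP.conj.dvd h0 h'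
    exact ⟨C, hP.conj.of_mul h0 hB, Or.inr rfl⟩

theorem AllP.peel {s k : ℕ} (hs : AllP (IsS t n) s) {B : Ideal (Ord t n)} (hB : IsN (s * k) B) :
    ∃ s₁ s₂ B', s = s₁ * s₂ ∧ IsN k B' ∧ B = PS t n s₁ * conj (PS t n s₂) * B' := by
  have htop : conj (⊤ : Ideal (Ord t n)) = ⊤ := by
    rw [← Ideal.span_singleton_one, conj_span_singleton, star_one]
  induction hs using AllP.induction generalizing B with
  | one => exact ⟨1, 1, B, rfl, by simpa using hB, by simp [PS_one, htop]⟩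
  | mul p a hp hS ha ih =>
    rw [mul_assoc] at hB
    obtain ⟨B', hB', h⟩ := hS.peel hB
    obtain ⟨s₁, s₂, C, rfl, hC, rfl⟩ := ih hB'
    have h1 := left_ne_zero_of_mul ha.1
    have h2 := right_ne_zero_of_mul ha.1
    rcases h with rfl | rfl
    · refine ⟨p * s₁, s₂, C, by ring, hC, ?_⟩
      rw [PS_mul hp.ne_zero h1, PS_prime hp]; ring
    · refine ⟨s₁, p * s₂, C, by ring, hC, ?_⟩
      rw [PS_mul hp.ne_zero h2, PS_prime hp, conj_mul]; ring

theorem IsI.dvd_of_dvd_norm {p : ℕ} (hp : IsI t n p) {x : Ord t n} (h : (p : ℤ) ∣ norm x) :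
    (p : Ord t n) ∣ x := by
  have hp' := Nat.prime_iff_prime_int.1 hp.1
  rw [norm_def] at h
  have him : (p : ℤ) ∣ x.im := by
    by_contra hne
    obtain ⟨a, b, hab⟩ := hp'.irreducible.coprime_iff_not_dvd.2 hne
    apply hp.2.2
    obtain ⟨k, hk⟩ := h
    refine ⟨- (x.re * b), b ^ 2 * k + (1 + b * x.im) * n * a + t * x.re * b * a, ?_⟩
    linear_combination b ^ 2 * hk - n * (1 + b * x.im) * hab - t * x.re * b * hab
  rw [natCast_dvd_iff]
  refine ⟨?_, him⟩
  obtain ⟨m, hm⟩ := him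
  rw [hm] at h
  have h2 : (p : ℤ) ∣ x.re * x.re := by
    obtain ⟨k, hk⟩ := h
    exact ⟨k - t * x.re * m - n * m * (p * m), by linear_combination hk⟩
  rcases hp'.dvd_or_dvd h2 with h3 | h3 <;> exact h3

theorem IsI.peel {p k : ℕ} {B : Ideal (Ord t n)} (hp : IsI t n p) (hk : k ≠ 0) (hpk : p ∣ k)
    (hB : IsN k B) : ∃ k' B', k = p ^ 2 * k' ∧ IsN k' B' ∧ B = Ideal.span {(p : Ord t n)} * B' := by
  have hle : B ≤ Ideal.span {(p : Ord t n)} := by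
    intro x hx
    rw [Ideal.mem_span_singleton]
    apply hp.dvd_of_dvd_norm
    have h1 : ((norm x : ℤ) : Ord t n) ∈ B * conj B := by
      rw [norm_cast_eq]
      exact Ideal.mul_mem_mul hx (star_mem_conj hx)
    rw [hB, Ideal.mem_span_singleton, natCast_dvd_iff] at h1
    exact (Int.natCast_dvd_natCast.2 hpk).trans (by simpa using h1.1)
  have hp2 := isN_span_natCast (t := t) (n := n) p
  have hp0 : p ^ 2 ≠ 0 := pow_ne_zero 2 hp.1.ne_zero
  obtain ⟨C, rfl⟩ := hp2.dvd hp0 hle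
  have h2 : p ^ 2 ∣ k := by
    have h3 : ((p ^ 2 : ℕ) : Ord t n) ∣ (k : Ord t n) := by
      rw [← Ideal.span_singleton_le_span_singleton, ← hB, ← hp2, conj_mul, mul_mul_mul_comm]
      exact Ideal.mul_le_left
    rw [natCast_dvd_iff] at h3
    exact Int.natCast_dvd_natCast.1 (by simpa using h3.1)
  obtain ⟨k', rfl⟩ := h2
  exact ⟨k', C, rfl, hp2.of_mul hp0 hB, rfl⟩

theorem AllP.inert {k : ℕ} (hk : AllP (IsI t n) k) {B : Ideal (Ord t n)} (hB : IsN k B) :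
    ∃ q, AllP (IsI t n) q ∧ k = q ^ 2 ∧ B = Ideal.span {(q : Ord t n)} := by
  induction k using Nat.strong_induction_on generalizing B with
  | _ k ih =>
    by_cases h1 : k = 1
    · subst h1
      refine ⟨1, allP_one _, rfl, ?_⟩
      unfold IsN at hB
      simp only [Nat.cast_one, Ideal.span_singleton_one] at hB ⊢
      exact top_le_iff.1 (hB.symm.le.trans Ideal.mul_le_left)
    · obtain ⟨p, hp, hpk⟩ := Nat.exists_prime_and_dvd h1
      have hI := hk.2 p hp hpk
      obtain ⟨k', C, rfl, hC, rfl⟩ := hI.peel hk.1 hpk hB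
      have hk' := (allP_mul.1 hk).2
      have h2 := hp.two_le
      have h3 := Nat.pos_of_ne_zero hk'.1
      obtain ⟨q, hq, rfl, rfl⟩ := ih k' (lt_sq_mul h2 h3) hk' hC
      refine ⟨p * q, allP_mul.2 ⟨(allP_prime hp).2 hI, hq⟩, by ring, ?_⟩
      rw [Ideal.span_singleton_mul_span_singleton, Nat.cast_mul]

theorem IsN.exists_eq {k : ℕ} (hk : k ≠ 0) (hkD : IsCoprime (k : ℤ) (t ^ 2 - 4 * n))
    {B : Ideal (Ord t n)} (hB : IsN k B) :
    ∃ q s₁ s₂, AllP (IsI t n) q ∧ AllP (IsS t n) s₁ ∧ AllP (IsS t n) s₂ ∧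
      k = s₁ * s₂ * q ^ 2 ∧
      B = PS t n s₁ * Bernays.conj (PS t n s₂) * Ideal.span {(q : Ord t n)} := by
  obtain ⟨s, m, rfl, hs, hm⟩ := exists_allP_mul (IsS t n) hk
  have hm' : AllP (IsI t n) m := by
    refine ⟨hm.1, fun p hp hpm => ⟨hp, fun hpD => ?_, fun hr => ?_⟩⟩
    · have hpk : (p : ℤ) ∣ ((s * m : ℕ) : ℤ) := Int.natCast_dvd_natCast.2 (hpm.mul_left s)
      exact (Nat.prime_iff_prime_int.1 hp).not_isUnit (hkD.isUnit_of_dvd' hpk hpD)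
    · have hpk : (p : ℤ) ∣ ((s * m : ℕ) : ℤ) := Int.natCast_dvd_natCast.2 (hpm.mul_left s)
      refine hm.2 p hp hpm ⟨hp, fun hpD => ?_, hr⟩
      exact (Nat.prime_iff_prime_int.1 hp).not_isUnit (hkD.isUnit_of_dvd' hpk hpD)
  obtain ⟨s₁, s₂, B', rfl, hB', rfl⟩ := hs.peel hB
  obtain ⟨q, hq, rfl, rfl⟩ := hm'.inert hB'
  have := allP_mul.1 hs
  exact ⟨q, s₁, s₂, hq, this.1, this.2, rfl, rfl⟩

theorem AllP.PS_le {s p : ℕ} (hs : AllP (IsS t n) s) (hp : IsS t n p) (h : PS t n s ≤ Pid t n p) :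
    p ∣ s := by
  have h1 : (s : Ord t n) ∈ Pid t n p := by
    apply h
    have h2 : Ideal.span {(s : Ord t n)} ≤ PS t n s := by
      rw [← hs.isN_PS]; exact Ideal.mul_le_left
    exact h2 (Ideal.mem_span_singleton_self _)
  exact hp.natCast_mem.1 h1

theorem AllP.not_conj_PS_le {s p : ℕ} (hs : AllP (IsS t n) s) (hp : IsS t n p) :
    ¬ conj (PS t n s) ≤ Pid t n p := by
  induction hs using AllP.induction with
  | one =>
    rw [PS_one, ← Ideal.span_singleton_one, conj_span_singleton, star_one,
      Ideal.span_singleton_one, top_le_iff]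
    exact hp.isPrime_Pid.ne_top
  | mul q a hq hS ha ih =>
    rw [PS_mul hq.ne_zero ha.1, PS_prime hq, conj_mul, Ideal.IsPrime.mul_le hp.isPrime_Pid]
    rintro (h | h)
    · have h1 : q = p := by
        have h2 : (q : Ord t n) ∈ conj (Pid t n q) := hS.natCast_mem_conj.2 dvd_rfl
        have := hp.natCast_mem.1 (h h2)
        exact ((Nat.prime_dvd_prime_iff_eq hp.1 hq).1 this).symm
      subst h1
      exact hS.not_conj_le h
    · exact ih h

theorem AllP.PS_inj {s₁ s₂ r₁ r₂ : ℕ} (hs₁ : AllP (IsS t n) s₁) (hs₂ : AllP (IsS t n) s₂)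
    (hr₁ : AllP (IsS t n) r₁) (hr₂ : AllP (IsS t n) r₂) (hm : s₁ * s₂ = r₁ * r₂)
    (h : PS t n s₁ * conj (PS t n s₂) = PS t n r₁ * conj (PS t n r₂)) : s₁ = r₁ := by
  have key : ∀ {s₁ s₂ r₁ r₂ : ℕ} (hs₁ : AllP (IsS t n) s₁) (hs₂ : AllP (IsS t n) s₂)
      (hr₁ : AllP (IsS t n) r₁) (hr₂ : AllP (IsS t n) r₂)
      (h : PS t n s₁ * conj (PS t n s₂) = PS t n r₁ * conj (PS t n r₂)), s₁ ∣ r₁ := by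
    intro s₁ s₂ r₁ r₂ hs₁ hs₂ hr₁ hr₂ h
    induction hs₁ using AllP.induction generalizing r₁ with
    | one => exact one_dvd _
    | mul p a hp hS ha ih =>
      rw [PS_mul hp.ne_zero ha.1, PS_prime hp, mul_assoc] at h
      have h1 : PS t n r₁ * conj (PS t n r₂) ≤ Pid t n p := by rw [← h]; exact Ideal.mul_le_left
      rcases (Ideal.IsPrime.mul_le hS.isPrime_Pid).1 h1 with h2 | h2
      · obtain ⟨b, rfl⟩ := hr₁.PS_le hS h2
        have hb := (allP_mul.1 hr₁).2
        rw [PS_mul hp.ne_zero hb.1, PS_prime hp, mul_assoc] at h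
        exact mul_dvd_mul_left p (ih hb (hS.isN_Pid.mul_left_cancel hp.ne_zero h))
      · exact absurd h2 (hr₂.not_conj_PS_le hS)
  exact Nat.dvd_antisymm (key hs₁ hs₂ hr₁ hr₂ h) (key hr₁ hr₂ hs₁ hs₂ h.symm)

theorem IsN.exists_squarefree {k : ℕ} (hk : AllP (fun p => ¬ IsS t n p) k)
    {B : Ideal (Ord t n)} (hB : IsN k B) : ∃ r m : ℕ, k = r * m ^ 2 ∧ (r : ℤ) ∣ t ^ 2 - 4 * n := by
  induction k using Nat.strong_induction_on generalizing B with
  | _ k ih =>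
    by_cases h : ∃ p, p ∣ k ∧ IsI t n p
    · obtain ⟨p, hpk, hI⟩ := h
      obtain ⟨k', C, rfl, hC, rfl⟩ := hI.peel hk.1 hpk hB
      have hk' := (allP_mul.1 hk).2
      have h2 := hI.1.two_le
      have h3 := Nat.pos_of_ne_zero hk'.1
      obtain ⟨r, m, rfl, hr⟩ := ih k' (lt_sq_mul h2 h3) hk' hC
      exact ⟨r, p * m, by ring, hr⟩
    · push Not at h
      obtain ⟨r, m, hrm, hr⟩ := Nat.sq_mul_squarefree k
      refine ⟨r, m, by rw [← hrm, mul_comm], ?_⟩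
      rw [Int.natCast_dvd, ← Nat.prod_primeFactors_of_squarefree hr]
      refine Finset.prod_primes_dvd _ (fun p hp => (Nat.prime_of_mem_primeFactors hp).prime) ?_
      intro p hp
      have hp1 := Nat.prime_of_mem_primeFactors hp
      have hp2 : p ∣ k := by
        rw [← hrm]; exact (Nat.dvd_of_mem_primeFactors hp).mul_left _
      rw [← Int.natCast_dvd]
      by_contra hpD
      exact hk.2 p hp1 hp2 ⟨hp1, hpD, by_contra fun hr => h p hp2 ⟨hp1, hpD, hr⟩⟩

end Order
end Bernays

namespace Bernays
open QuadraticAlgebra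

section Form
variable {t n : ℤ} [hD : Fact (t ^ 2 - 4 * n < 0)]

theorem isN_Kid_of_primitive {s : ℕ} {r c : ℤ} (hc : r ^ 2 - t * r + n = s * c)
    (hg : ∃ x y z : ℤ, x * s + y * (t - 2 * r) + z * c = 1) :
    IsN s (Kid (t := t) (n := n) s r) := by
  unfold IsN
  rw [conj_Kid]
  obtain ⟨x, y, z, hg⟩ := hg
  have hs0 : (s : Ord t n) ∈ Ideal.span {(s : Ord t n)} := Ideal.mem_span_singleton_self _
  apply le_antisymm
  · refine Kid_mul_le (Ideal.mul_mem_left _ _ hs0) (Ideal.mul_mem_right _ _ hs0)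
      (Ideal.mul_mem_left _ _ hs0) ?_
    rw [Ideal.mem_span_singleton]
    refine ⟨((-c : ℤ) : Ord t n), ?_⟩
    ext
    · simp; linear_combination -hc
    · simp; ring
  · rw [Ideal.span_singleton_le_iff_mem]
    have := Ideal.sub_mem _ (Ideal.add_mem _ (Ideal.mul_mem_left _ (x : Ord t n)
        (Ideal.mul_mem_mul (natCast_mem_Kid s r) (natCast_mem_Kid s (t - r))))
      (Ideal.mul_mem_left _ (y : Ord t n) (Ideal.sub_mem _
        (Ideal.mul_mem_mul (omega_mem_Kid s r) (natCast_mem_Kid s (t - r)))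
        (Ideal.mul_mem_mul (natCast_mem_Kid s r) (omega_mem_Kid s (t - r))))))
      (Ideal.mul_mem_left _ (z : Ord t n)
        (Ideal.mul_mem_mul (omega_mem_Kid s r) (omega_mem_Kid s (t - r))))
    convert this using 1
    ext
    · simp; linear_combination (-s : ℤ) * hg - z * hc
    · simp; right; ring

theorem norm_Kid_elt {s r c u v : ℤ} (hc : r ^ 2 - t * r + n = s * c) :
    norm (⟨s * u - r * v, v⟩ : Ord t n) = s * (s * u ^ 2 + (t - 2 * r) * u * v + c * v ^ 2) := by
  simp [QuadraticAlgebra.norm_def]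
  linear_combination v ^ 2 * hc

theorem represents_iff {s m : ℕ} {r c : ℤ} (hs : s ≠ 0) (hm : m ≠ 0)
    (hc : r ^ 2 - t * r + n = s * c) (hB : IsN s (Kid (t := t) (n := n) s r)) :
    (∃ u v : ℤ, (m : ℤ) = s * u ^ 2 + (t - 2 * r) * u * v + c * v ^ 2) ↔
      ∃ B : Ideal (Ord t n), IsN m B ∧ cls B = (cls (Kid (t := t) (n := n) s r))⁻¹ := by
  have hr : (s : ℤ) ∣ r ^ 2 - t * r + n := ⟨c, hc⟩
  constructor
  · rintro ⟨u, v, huv⟩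
    set α : Ord t n := ⟨s * u - r * v, v⟩ with hα
    have hN : norm α = (s * m : ℕ) := by rw [hα, norm_Kid_elt hc, ← huv]; push_cast; ring
    have hα0 : α ≠ 0 := by
      intro h0
      rw [h0, QuadraticAlgebra.norm_zero] at hN
      exact mul_ne_zero hs hm (by exact_mod_cast hN.symm)
    have hαK : α ∈ Kid (t := t) (n := n) s r := by
      rw [mem_Kid hr]; exact ⟨u, by simp [hα]; ring⟩
    obtain ⟨C, hC⟩ := hB.dvd hs ((Ideal.span_singleton_le_iff_mem _).2 hαK)
    have hCN : IsN m C := IsN.of_mul hs hB (hC ▸ isN_span hN)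
    refine ⟨C, hCN, ?_⟩
    have := cls_mul hs hB hm hCN
    rw [← hC, cls_span α hα0] at this
    exact (inv_eq_of_mul_eq_one_right this.symm).symm
  · rintro ⟨B, hBN, hcl⟩
    have h1 : cls (Kid (t := t) (n := n) s r * B) = 1 := by
      rw [cls_mul hs hB hm hBN, hcl, mul_inv_cancel]
    obtain ⟨x, hx0, hx⟩ := (cls_eq_one_iff (mul_ne_zero hs hm) (hB.mul hBN)).1 h1
    have hxK : x ∈ Kid (t := t) (n := n) s r := by
      rw [← Ideal.span_singleton_le_iff_mem (I := Kid s r), ← hx]; exact Ideal.mul_le_left (I := Kid s r) (J := B)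
    obtain ⟨u, hu⟩ := (mem_Kid hr).1 hxK
    have hN : norm x = (s * m : ℕ) := IsN.norm_eq (hx ▸ hB.mul hBN)
    refine ⟨u, x.im, ?_⟩
    have hxe : x = ⟨s * u - r * x.im, x.im⟩ := by ext <;> simp; linear_combination hu
    rw [hxe, norm_Kid_elt hc] at hN
    push_cast at hN
    exact (mul_left_cancel₀ (by exact_mod_cast hs) hN).symm

theorem exists_coprime_value {a b c : ℤ} (hg : ∃ x y z : ℤ, x * a + y * b + z * c = 1) {N : ℕ}
    (hN : N ≠ 0) : ∃ u v : ℤ, u ≠ 0 ∧ IsCoprime (a * u ^ 2 + b * u * v + c * v ^ 2) (N : ℤ) := by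
  classical
  obtain ⟨x, y, z, hg⟩ := hg
  set U : Finset ℕ := N.primeFactors.filter fun p => (p : ℤ) ∣ a ∧ ¬ (p : ℤ) ∣ c with hU
  set V : Finset ℕ := N.primeFactors.filter fun p => ¬ (p : ℤ) ∣ a with hV
  have hmem : ∀ (W : Finset ℕ), W ⊆ N.primeFactors → ∀ p : ℕ, p.Prime →
      ((p : ℤ) ∣ ∏ q ∈ W, (q : ℤ) ↔ p ∈ W) := by
    intro W hW p hp
    have hp' := Nat.prime_iff_prime_int.1 hp
    rw [Prime.dvd_finsetProd_iff hp']
    constructor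
    · rintro ⟨q, hq, hpq⟩
      have := (Nat.prime_dvd_prime_iff_eq hp (Nat.prime_of_mem_primeFactors (hW hq))).1
        (by exact_mod_cast hpq)
      exact this ▸ hq
    · exact fun h => ⟨p, h, dvd_rfl⟩
  have hUm := hmem U (Finset.filter_subset _ _)
  have hVm := hmem V (Finset.filter_subset _ _)
  refine ⟨∏ q ∈ U, (q : ℤ), ∏ q ∈ V, (q : ℤ), ?_, ?_⟩
  · rw [Finset.prod_ne_zero_iff]
    intro q hq
    exact_mod_cast (Nat.prime_of_mem_primeFactors (Finset.mem_filter.1 hq).1).ne_zero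
  · set u := ∏ q ∈ U, (q : ℤ)
    set v := ∏ q ∈ V, (q : ℤ)
    rw [Int.isCoprime_iff_gcd_eq_one]
    by_contra hne
    obtain ⟨p, hp, hpd⟩ := Nat.exists_prime_and_dvd hne
    have hp' := Nat.prime_iff_prime_int.1 hp
    have h1 : (p : ℤ) ∣ a * u ^ 2 + b * u * v + c * v ^ 2 :=
      (Int.natCast_dvd_natCast.2 hpd).trans (Int.gcd_dvd_left _ _)
    have h2 : p ∣ N := Int.natCast_dvd_natCast.1
      ((Int.natCast_dvd_natCast.2 hpd).trans (Int.gcd_dvd_right _ _))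
    have hpN : p ∈ N.primeFactors := Nat.mem_primeFactors.2 ⟨hp, h2, hN⟩
    have hpU : (p : ℤ) ∣ u ↔ (p : ℤ) ∣ a ∧ ¬ (p : ℤ) ∣ c := by
      rw [hUm p hp, hU, Finset.mem_filter]; tauto
    have hpV : (p : ℤ) ∣ v ↔ ¬ (p : ℤ) ∣ a := by
      rw [hVm p hp, hV, Finset.mem_filter]; tauto
    by_cases ha : (p : ℤ) ∣ a
    · by_cases hc : (p : ℤ) ∣ c
      · have hb : ¬ (p : ℤ) ∣ b := fun hb => hp'.not_dvd_one
          (hg ▸ dvd_add (dvd_add (ha.mul_left _) (hb.mul_left _)) (hc.mul_left _))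
        have : (p : ℤ) ∣ b * u * v := by
          have := dvd_sub (dvd_sub h1 (ha.mul_right (u ^ 2))) (hc.mul_right (v ^ 2))
          rwa [show a * u ^ 2 + b * u * v + c * v ^ 2 - a * u ^ 2 - c * v ^ 2 = b * u * v by ring]
            at this
        rcases hp'.dvd_or_dvd this with h | h
        · rcases hp'.dvd_or_dvd h with h | h
          · exact hb h
          · exact (hpU.1 h).2 hc
        · exact (hpV.1 h) ha
      · have hu := hpU.2 ⟨ha, hc⟩
        have : (p : ℤ) ∣ c * v ^ 2 := by
          have := dvd_sub (dvd_sub h1 (ha.mul_right (u ^ 2))) ((hu.mul_left b).mul_right v)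
          rwa [show a * u ^ 2 + b * u * v + c * v ^ 2 - a * u ^ 2 - b * u * v = c * v ^ 2 by ring]
            at this
        rcases hp'.dvd_or_dvd this with h | h
        · exact hc h
        · exact hpV.1 (hp'.dvd_of_dvd_pow h) ha
    · have hv := hpV.2 ha
      have : (p : ℤ) ∣ a * u ^ 2 := by
        have := dvd_sub (dvd_sub h1 (hv.mul_left (b * u))) ((hv.mul_left v).mul_left c)
        rwa [show a * u ^ 2 + b * u * v + c * v ^ 2 - b * u * v - c * (v * v) = a * u ^ 2 by ring]
          at this
      rcases hp'.dvd_or_dvd this with h | h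
      · exact ha h
      · exact ha (hpU.1 (hp'.dvd_of_dvd_pow h)).1

end Form

section Group
variable (t n : ℤ) [hD : Fact (t ^ 2 - 4 * n < 0)]

/-- The class of the chosen ideal of norm `s`. -/
noncomputable def chat (s : ℕ) : ClassGroup (Ord t n) := pext (fun p => cls (Pid t n p)) s

variable {t n} in
theorem mem_iff_emod {C : Ideal (Ord t n)} {N : ℕ} (hN : (N : Ord t n) ∈ C) (x : Ord t n) :
    x ∈ C ↔ (⟨x.re % N, x.im % N⟩ : Ord t n) ∈ C := by
  have hx : x = ⟨x.re % N, x.im % N⟩ + (N : Ord t n) * ⟨x.re / N, x.im / N⟩ := by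
    ext
    · simp
      linear_combination -(Int.emod_add_mul_ediv x.re N)
    · simp
      linear_combination -(Int.emod_add_mul_ediv x.im N)
  conv_lhs => rw [hx]
  exact Ideal.add_mem_iff_left _ (Ideal.mul_mem_right _ _ hN)

variable {t n} in
theorem IsN.natCast_mem {m : ℕ} {C : Ideal (Ord t n)} (hC : IsN m C) : (m : Ord t n) ∈ C := by
  have : (m : Ord t n) ∈ C * Bernays.conj C := by
    rw [show C * Bernays.conj C = _ from hC]; exact Ideal.mem_span_singleton_self _
  exact Ideal.mul_le_left this

theorem finite_isN_le (M : ℕ) :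
    {C : Ideal (Ord t n) | ∃ m : ℕ, m ≠ 0 ∧ m ≤ M ∧ IsN m C}.Finite := by
  obtain ⟨N, hN0, hN⟩ : ∃ N : ℕ, 0 < N ∧ ∀ m, m ≠ 0 → m ≤ M → m ∣ N :=
    ⟨M.factorial, M.factorial_pos, fun m h1 h2 => Nat.dvd_factorial (Nat.pos_of_ne_zero h1) h2⟩
  have hmem : ∀ C : Ideal (Ord t n), (∃ m : ℕ, m ≠ 0 ∧ m ≤ M ∧ IsN m C) → (N : Ord t n) ∈ C := by
    rintro C ⟨m, hm0, hmM, hC⟩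
    obtain ⟨k, hk⟩ := hN m hm0 hmM
    rw [hk, Nat.cast_mul]
    exact Ideal.mul_mem_right _ _ hC.natCast_mem
  apply Set.Finite.of_injOn (t := (Set.univ : Set (Set (Fin N × Fin N))))
    (f := fun C => {q | (⟨((q.1 : ℕ) : ℤ), ((q.2 : ℕ) : ℤ)⟩ : Ord t n) ∈ C})
  · exact fun _ _ => Set.mem_univ _
  · intro C hC C' hC' h
    ext x
    rw [mem_iff_emod (hmem C hC), mem_iff_emod (hmem C' hC')]
    have hpos : (0 : ℤ) < N := by exact_mod_cast hN0
    have e1 := Int.emod_nonneg x.re hpos.ne'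
    have e2 := Int.emod_nonneg x.im hpos.ne'
    have l1 := Int.emod_lt_of_pos x.re hpos
    have l2 := Int.emod_lt_of_pos x.im hpos
    have := Set.ext_iff.1 h (⟨(x.re % N).toNat, by omega⟩, ⟨(x.im % N).toNat, by omega⟩)
    simpa only [Set.mem_ofPred_eq, Int.toNat_of_nonneg e1, Int.toNat_of_nonneg e2] using this
  · exact Set.finite_univ

theorem exists_small_vector {s : ℕ} (hs : s ≠ 0) (r : ℤ) :
    ∃ u v : ℤ, (u ≠ 0 ∨ v ≠ 0) ∧ u ^ 2 ≤ s ∧ v ^ 2 ≤ s ∧ (s : ℤ) ∣ u + v * r := by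
  classical
  have : NeZero s := ⟨hs⟩
  set q := Nat.sqrt s with hq
  have hcard : (Finset.univ : Finset (ZMod s)).card <
      (Finset.range (q + 1) ×ˢ Finset.range (q + 1)).card := by
    rw [Finset.card_univ, ZMod.card, Finset.card_product, Finset.card_range]
    exact Nat.lt_succ_sqrt s
  obtain ⟨⟨a, b⟩, hab, ⟨a', b'⟩, hab', hne, he⟩ := Finset.exists_ne_map_eq_of_card_lt_of_maps_to
    hcard (f := fun p : ℕ × ℕ => ((p.1 : ZMod s) + p.2 * (r : ZMod s))) (by intro _ _; simp)
  simp only [Finset.mem_product, Finset.mem_range] at hab hab'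
  have hqq : (q : ℤ) * q ≤ s := by exact_mod_cast Nat.sqrt_le s
  refine ⟨(a : ℤ) - a', (b : ℤ) - b', ?_, ?_, ?_, ?_⟩
  · by_contra hcon
    push Not at hcon
    exact hne (by ext <;> simp <;> omega)
  · nlinarith [abs_le.1 (show |(a : ℤ) - a'| ≤ q by rw [abs_le]; omega)]
  · nlinarith [abs_le.1 (show |(b : ℤ) - b'| ≤ q by rw [abs_le]; omega)]
  · rw [← ZMod.intCast_zmod_eq_zero_iff_dvd]
    push_cast
    linear_combination he

theorem finite_range_chat : {g | ∃ s, AllP (IsS t n) s ∧ chat t n s = g}.Finite := by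
  set M : ℕ := (1 + |t| + |n|).toNat with hM
  refine ((finite_isN_le t n M).image fun C => (cls C)⁻¹).subset ?_
  rintro _ ⟨s, hs, rfl⟩
  obtain ⟨r, hr, hPS, -⟩ := hs.exists_Kid
  obtain ⟨u, v, huv, hu, hv, hd⟩ := exists_small_vector hs.1 r
  have hN := hs.isN_PS
  rw [hPS] at hN
  set α : Ord t n := ⟨u, v⟩ with hα
  have hαK : α ∈ Kid (t := t) (n := n) s r := (mem_Kid hr).2 hd
  have hα0 : α ≠ 0 := by
    intro h0
    have h1 : α.re = 0 := by rw [h0]; rfl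
    have h2 : α.im = 0 := by rw [h0]; rfl
    simp [hα] at h1 h2; tauto
  obtain ⟨w, hw⟩ := hd
  obtain ⟨c, hc⟩ := hr
  have hne : norm α = s * (s * w ^ 2 + (t - 2 * r) * w * v + c * v ^ 2) := by
    rw [← norm_Kid_elt hc]; congr 1; rw [hα]; ext <;> simp; linear_combination hw
  set m' := s * w ^ 2 + (t - 2 * r) * w * v + c * v ^ 2
  have hsp : (0 : ℤ) < s := by exact_mod_cast Nat.pos_of_ne_zero hs.1
  have hm'0 : 0 < m' := by
    have := norm_pos hα0
    rw [hne] at this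
    exact pos_of_mul_pos_right this hsp.le
  have hle : m' ≤ 1 + |t| + |n| := by
    have h1 : norm α ≤ (1 + |t| + |n|) * s := by
      have e : norm α = u ^ 2 + t * (u * v) + n * v ^ 2 := by
        simp [QuadraticAlgebra.norm_def, hα]; ring
      have h2 : |u * v| ≤ s := by
        rw [abs_mul]
        nlinarith [sq_abs u, sq_abs v, sq_nonneg (|u| - |v|)]
      have h3 : t * (u * v) ≤ |t| * s :=
        (le_abs_self _).trans (by rw [abs_mul]; gcongr)
      have h4 : n * v ^ 2 ≤ |n| * s :=
        (mul_le_mul_of_nonneg_right (le_abs_self n) (sq_nonneg v)).trans (by gcongr)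
      rw [e]; linarith
    rw [hne, mul_comm] at h1
    exact le_of_mul_le_mul_right h1 hsp
  obtain ⟨C, hC⟩ := hN.dvd hs.1 ((Ideal.span_singleton_le_iff_mem _).2 hαK)
  have hm'c : ((m'.toNat : ℕ) : ℤ) = m' := Int.toNat_of_nonneg hm'0.le
  have hNα : norm α = (s * m'.toNat : ℕ) := by rw [hne]; push_cast; rw [hm'c]
  have hCN : IsN m'.toNat C := IsN.of_mul hs.1 hN (hC ▸ isN_span hNα)
  have hm0 : m'.toNat ≠ 0 := by omega
  refine ⟨C, ⟨m'.toNat, hm0, by omega, hCN⟩, ?_⟩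
  have h1 := cls_mul hs.1 hN hm0 hCN
  rw [← hC, cls_span α hα0, ← hPS, hs.cls_PS] at h1
  exact inv_eq_of_mul_eq_one_left h1.symm

/-- The subgroup of classes of ideals composed of the chosen primes. -/
def HS : Subgroup (ClassGroup (Ord t n)) where
  carrier := {g | ∃ s, AllP (IsS t n) s ∧ chat t n s = g}
  mul_mem' := by
    rintro _ _ ⟨s, hs, rfl⟩ ⟨s', hs', rfl⟩
    exact ⟨s * s', allP_mul.2 ⟨hs, hs'⟩, pext_mul _ hs.1 hs'.1⟩
  one_mem' := ⟨1, allP_one _, pext_one _⟩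
  inv_mem' := by
    rintro _ ⟨s, hs, rfl⟩
    have hpow : ∀ k : ℕ, AllP (IsS t n) (s ^ k) ∧ chat t n (s ^ k) = chat t n s ^ k := by
      intro k
      induction k with
      | zero => exact ⟨by simpa using allP_one _, by simp [chat]⟩
      | succ k ih =>
        rw [pow_succ, pow_succ, ← ih.2]
        exact ⟨allP_mul.2 ⟨ih.1, hs⟩, pext_mul _ ih.1.1 hs.1⟩
    have hfin : (Set.range fun k : ℕ => chat t n s ^ k).Finite :=
      (finite_range_chat t n).subset (by rintro _ ⟨k, rfl⟩; exact ⟨s ^ k, hpow k⟩)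
    have hfo : IsOfFinOrder (chat t n s) := by
      rw [← finite_powers]
      exact hfin.subset (by rintro _ ⟨k, rfl⟩; exact ⟨k, rfl⟩)
    obtain ⟨k, hk, hk1⟩ := hfo.exists_pow_eq_one
    refine ⟨s ^ (k - 1), (hpow _).1, ?_⟩
    rw [(hpow _).2]
    refine (inv_eq_of_mul_eq_one_left ?_).symm
    rw [← pow_succ, Nat.sub_add_cancel hk, hk1]

instance : Finite (HS t n) := (finite_range_chat t n).to_subtype

open Classical in
/-- The class of the chosen ideal above a splitting prime. -/
noncomputable def cH (p : ℕ) : HS t n :=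
  if h : IsS t n p then ⟨chat t n p, p, (allP_prime h.1).2 h, rfl⟩ else 1

variable {t n}

theorem AllP.coe_pext_cH {s : ℕ} (hs : AllP (IsS t n) s) :
    ((pext (cH t n) s : HS t n) : ClassGroup (Ord t n)) = chat t n s := by
  rw [← Subgroup.subtype_apply, map_pext]
  refine pext_congr fun p hp hd => ?_
  rw [Subgroup.subtype_apply, cH, dif_pos (hs.2 p hp hd)]
  exact pext_prime _ hp

theorem exists_pext_cH (g : HS t n) : ∃ s, AllP (IsS t n) s ∧ pext (cH t n) s = g := by
  obtain ⟨g, s, hs, hg⟩ := g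
  exact ⟨s, hs, Subtype.ext (hs.coe_pext_cH.trans hg)⟩

theorem IsN.cls_mem_HS {k : ℕ} (hk : k ≠ 0) (hkD : IsCoprime (k : ℤ) (t ^ 2 - 4 * n))
    {B : Ideal (Ord t n)} (hB : IsN k B) : cls B ∈ HS t n := by
  obtain ⟨q, s₁, s₂, hq, hs₁, hs₂, -, rfl⟩ := hB.exists_eq hk hkD
  have hq0 : (q ^ 2) ≠ 0 := pow_ne_zero 2 hq.1
  rw [cls_mul (mul_ne_zero hs₁.1 hs₂.1) (hs₁.isN_PS.mul hs₂.isN_PS.conj) hq0 (isN_span_natCast q),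
    cls_mul hs₁.1 hs₁.isN_PS hs₂.1 hs₂.isN_PS.conj, cls_conj hs₂.1 hs₂.isN_PS,
    cls_span _ (natCast_ne_zero hq.1), hs₁.cls_PS, hs₂.cls_PS, mul_one]
  exact mul_mem ⟨s₁, hs₁, rfl⟩ (inv_mem ⟨s₂, hs₂, rfl⟩)

/-- The classes in `HS` containing an ideal of norm `k`. -/
def ClS (t n : ℤ) [Fact (t ^ 2 - 4 * n < 0)] (k : ℕ) : Set (HS t n) :=
  {e | ∃ B : Ideal (Ord t n), IsN k B ∧ cls B = e}

theorem one_mem_ClS : (1 : HS t n) ∈ ClS t n 1 := ⟨⊤, isN_one, cls_top⟩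

theorem exists_isN_iff {s k : ℕ} (hs : AllP (IsS t n) s) (hk : k ≠ 0) (h : HS t n) :
    (∃ B : Ideal (Ord t n), IsN (k * s) B ∧ cls B = h) ↔
      ∃ d, d ∣ s ∧ ∃ e ∈ ClS t n k, h = pext (cH t n) s * (pext (cH t n) d ^ 2)⁻¹ * e := by
  constructor
  · rintro ⟨B, hB, hBh⟩
    rw [mul_comm] at hB
    obtain ⟨s₁, s₂, B', rfl, hB', rfl⟩ := hs.peel hB
    obtain ⟨hs₁, hs₂⟩ := allP_mul.1 hs
    rw [cls_mul (mul_ne_zero hs₁.1 hs₂.1) (hs₁.isN_PS.mul hs₂.isN_PS.conj) hk hB',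
      cls_mul hs₁.1 hs₁.isN_PS hs₂.1 hs₂.isN_PS.conj, cls_conj hs₂.1 hs₂.isN_PS,
      hs₁.cls_PS, hs₂.cls_PS] at hBh
    have hBh' : ((pext (cH t n) s₁ * (pext (cH t n) s₂)⁻¹ : HS t n) : ClassGroup (Ord t n)) *
        cls B' = h := by
      rw [← hBh]; push_cast; rw [hs₁.coe_pext_cH, hs₂.coe_pext_cH]; rfl
    refine ⟨s₂, dvd_mul_left _ _, (pext (cH t n) s₁ * (pext (cH t n) s₂)⁻¹)⁻¹ * h,
      ⟨B', hB', ?_⟩, ?_⟩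
    · rw [Subgroup.coe_mul, ← hBh', Subgroup.coe_inv, inv_mul_cancel_left]
    · rw [pext_mul _ hs₁.1 hs₂.1]
      generalize pext (cH t n) s₁ = a
      generalize pext (cH t n) s₂ = b
      rw [pow_two]; group
  · rintro ⟨s₂, ⟨s₁, rfl⟩, e, ⟨B', hB', he⟩, rfl⟩
    obtain ⟨hs₂, hs₁⟩ := allP_mul.1 hs
    refine ⟨PS t n s₁ * conj (PS t n s₂) * B', ?_, ?_⟩
    · have := (hs₁.isN_PS.mul hs₂.isN_PS.conj).mul hB'
      rwa [show s₁ * s₂ * k = k * (s₂ * s₁) by ring] at this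
    · rw [cls_mul (mul_ne_zero hs₁.1 hs₂.1) (hs₁.isN_PS.mul hs₂.isN_PS.conj) hk hB',
        cls_mul hs₁.1 hs₁.isN_PS hs₂.1 hs₂.isN_PS.conj, cls_conj hs₂.1 hs₂.isN_PS,
        hs₁.cls_PS, hs₂.cls_PS, he, pext_mul _ hs₂.1 hs₁.1]
      push_cast
      rw [hs₁.coe_pext_cH, hs₂.coe_pext_cH]
      change chat t n s₁ * (chat t n s₂)⁻¹ * (e : ClassGroup (Ord t n)) = _
      congr 1
      generalize chat t n s₁ = a
      generalize chat t n s₂ = b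
      rw [mul_comm b a, pow_two, mul_inv, mul_assoc, mul_inv_cancel_left]

end Group
end Bernays

namespace Bernays
open QuadraticAlgebra

section Lattice
open MeasureTheory Complex Pointwise

/-- The region `‖e₁ x + e₂ y‖ ≤ R` of the plane. -/
def region (e₁ e₂ : ℂ) (R : ℝ) : Set (ℝ × ℝ) := {q | ‖e₁ * q.1 + e₂ * q.2‖ ≤ R}

/-- The unit box with lower left corner `q`. -/
def box (q : ℤ × ℤ) : Set (ℝ × ℝ) := Set.Ico (q.1 : ℝ) (q.1 + 1) ×ˢ Set.Ico (q.2 : ℝ) (q.2 + 1)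

theorem mem_box {q : ℤ × ℤ} {z : ℝ × ℝ} : z ∈ box q ↔ ⌊z.1⌋ = q.1 ∧ ⌊z.2⌋ = q.2 := by
  simp [box, Int.floor_eq_iff]

theorem volume_box (q : ℤ × ℤ) : volume (box q) = 1 := by
  simp [box, Measure.volume_eq_prod, Measure.prod_prod]

theorem measurableSet_box (q : ℤ × ℤ) : MeasurableSet (box q) :=
  measurableSet_Ico.prod measurableSet_Ico

theorem region_bound {e₁ e₂ : ℂ} (he : (star e₁ * e₂).im ≠ 0) :
    ∃ K : ℝ, 0 < K ∧ ∀ x y : ℝ, |x| ≤ K * ‖e₁ * x + e₂ * y‖ ∧ |y| ≤ K * ‖e₁ * x + e₂ * y‖ := by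
  set d := (star e₁ * e₂).im with hd
  have hd0 : 0 < |d| := abs_pos.2 he
  refine ⟨(‖e₁‖ + ‖e₂‖ + 1) / |d|, by positivity, fun x y => ?_⟩
  set z := e₁ * x + e₂ * y with hz
  have h1 : (star e₁ * z).im = d * y := by
    simp [hz, hd]; ring
  have h2 : (star e₂ * z).im = -d * x := by
    simp [hz, hd]; ring
  have h3 : |d| * |y| ≤ ‖e₁‖ * ‖z‖ := by
    rw [← abs_mul, ← h1]
    exact (abs_im_le_norm _).trans (by simp)
  have h4 : |d| * |x| ≤ ‖e₂‖ * ‖z‖ := by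
    rw [← abs_neg d, ← abs_mul, ← h2]
    exact (abs_im_le_norm _).trans (by simp)
  have := _root_.norm_nonneg z
  have := _root_.norm_nonneg e₁
  have := _root_.norm_nonneg e₂
  constructor
  · rw [div_mul_eq_mul_div, le_div_iff₀ hd0]; nlinarith
  · rw [div_mul_eq_mul_div, le_div_iff₀ hd0]; nlinarith

theorem volume_region {e₁ e₂ : ℂ} {R : ℝ} (hR : 0 < R) :
    volume (region e₁ e₂ R) = ENNReal.ofReal (R ^ 2) * volume (region e₁ e₂ 1) := by
  have : region e₁ e₂ R = R • region e₁ e₂ 1 := by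
    ext q
    rw [Set.mem_smul_set_iff_inv_smul_mem₀ hR.ne']
    simp only [region, Set.mem_ofPred_eq, Prod.smul_fst, Prod.smul_snd, smul_eq_mul, ofReal_mul]
    have : e₁ * ((R⁻¹ : ℝ) * q.1) + e₂ * ((R⁻¹ : ℝ) * q.2) =
        ((R⁻¹ : ℝ) : ℂ) * (e₁ * q.1 + e₂ * q.2) := by ring
    rw [this, norm_mul, norm_real, Real.norm_of_nonneg (inv_pos.2 hR).le, inv_mul_le_iff₀ hR,
      mul_one]
  rw [this, Measure.addHaar_smul]
  simp [Module.finrank_prod, abs_of_pos hR]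

theorem region_finite {e₁ e₂ : ℂ} (he : (star e₁ * e₂).im ≠ 0) (R : ℝ) :
    volume (region e₁ e₂ R) < ⊤ := by
  obtain ⟨K, hK, h⟩ := region_bound he
  apply Bornology.IsBounded.measure_lt_top
  refine (Metric.isBounded_closedBall (x := (0 : ℝ × ℝ)) (r := K * R)).subset ?_
  intro q hq
  have hq' : ‖e₁ * q.1 + e₂ * q.2‖ ≤ R := hq
  rw [mem_closedBall_zero_iff, Prod.norm_def]
  exact max_le ((h q.1 q.2).1.trans (by gcongr)) ((h q.1 q.2).2.trans (by gcongr))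

theorem region_volume_pos (e₁ e₂ : ℂ) : 0 < volume (region e₁ e₂ 1) := by
  have hopen : IsOpen {q : ℝ × ℝ | ‖e₁ * q.1 + e₂ * q.2‖ < 1} :=
    isOpen_lt (by fun_prop) continuous_const
  refine (hopen.measure_pos volume ⟨0, by simp⟩).trans_le (measure_mono fun q hq => ?_)
  exact (show ‖e₁ * q.1 + e₂ * q.2‖ < 1 from hq).le

/-- The lattice points with `‖z + e₁ i + e₂ j‖ ≤ R`. -/
def lpts (z e₁ e₂ : ℂ) (R : ℝ) : Set (ℤ × ℤ) := {q | ‖z + e₁ * q.1 + e₂ * q.2‖ ≤ R}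

theorem lpts_finite {e₁ e₂ : ℂ} (he : (star e₁ * e₂).im ≠ 0) (z : ℂ) (R : ℝ) :
    (lpts z e₁ e₂ R).Finite := by
  obtain ⟨K, hK, h⟩ := region_bound he
  refine ((Set.finite_Icc (-⌈K * (R + ‖z‖)⌉) ⌈K * (R + ‖z‖)⌉).prod
    (Set.finite_Icc (-⌈K * (R + ‖z‖)⌉) ⌈K * (R + ‖z‖)⌉)).subset ?_
  intro q hq
  have hq' : ‖z + e₁ * q.1 + e₂ * q.2‖ ≤ R := hq
  have h1 : ‖e₁ * ((q.1 : ℝ) : ℂ) + e₂ * ((q.2 : ℝ) : ℂ)‖ ≤ R + ‖z‖ := by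
    have : e₁ * ((q.1 : ℝ) : ℂ) + e₂ * ((q.2 : ℝ) : ℂ) = (z + e₁ * q.1 + e₂ * q.2) - z := by
      push_cast; ring
    rw [this]
    exact (norm_sub_le _ _).trans (by gcongr)
  have key : ∀ i : ℤ, |(i : ℝ)| ≤ K * ‖e₁ * ((q.1 : ℝ) : ℂ) + e₂ * ((q.2 : ℝ) : ℂ)‖ →
      i ∈ Set.Icc (-⌈K * (R + ‖z‖)⌉) ⌈K * (R + ‖z‖)⌉ := by
    intro i hi
    have h2 : |(i : ℝ)| ≤ ⌈K * (R + ‖z‖)⌉ := (hi.trans (by gcongr)).trans (Int.le_ceil _)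
    rw [Set.mem_Icc, ← abs_le]
    exact_mod_cast h2
  exact ⟨key _ (h q.1 q.2).1, key _ (h q.1 q.2).2⟩

theorem lattice_count {e₁ e₂ : ℂ} (he : (star e₁ * e₂).im ≠ 0) (z : ℂ) :
    ∃ c : ℝ, 0 < c ∧ ∀ R : ℝ, 1 ≤ R →
      |((lpts z e₁ e₂ R).ncard : ℝ) - volume.real (region e₁ e₂ 1) * R ^ 2| ≤ c * R := by
  set κ := volume.real (region e₁ e₂ 1) with hκ
  set c₀ := ‖z‖ + ‖e₁‖ + ‖e₂‖ + 1 with hc₀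
  have hc0 : 0 < c₀ := by positivity
  have hκ0 : 0 ≤ κ := measureReal_nonneg
  have hvol : ∀ R : ℝ, 0 < R → volume.real (region e₁ e₂ R) = κ * R ^ 2 := by
    intro R hR
    rw [measureReal_def, volume_region hR, ENNReal.toReal_mul,
      ENNReal.toReal_ofReal (sq_nonneg R), mul_comm]; rfl
  set U : ℝ → Set (ℝ × ℝ) := fun R => ⋃ q ∈ (lpts_finite he z R).toFinset, box q with hU
  have hUvol : ∀ R, volume.real (U R) = (lpts z e₁ e₂ R).ncard := by
    intro R
    rw [measureReal_def, hU]
    simp only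
    rw [measure_biUnion_finset]
    · simp only [volume_box, Finset.sum_const, nsmul_eq_mul, mul_one]
      rw [← Set.ncard_eq_toFinset_card _ (lpts_finite he z R)]; simp
    · intro q _ q' _ hqq
      rw [Function.onFun, Set.disjoint_left]
      intro w hw hw'
      rw [mem_box] at hw hw'
      exact hqq (Prod.ext (hw.1.symm.trans hw'.1) (hw.2.symm.trans hw'.2))
    · exact fun q _ => measurableSet_box q
  have hdiff : ∀ (w : ℝ × ℝ), ‖(z + e₁ * (⌊w.1⌋ : ℤ) + e₂ * (⌊w.2⌋ : ℤ)) - (e₁ * w.1 + e₂ * w.2)‖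
      ≤ c₀ := by
    intro w
    have e : (z + e₁ * (⌊w.1⌋ : ℤ) + e₂ * (⌊w.2⌋ : ℤ)) - (e₁ * w.1 + e₂ * w.2) =
      z - e₁ * ((Int.fract w.1 : ℝ) : ℂ) - e₂ * ((Int.fract w.2 : ℝ) : ℂ) := by
      simp only [Int.fract]; push_cast; ring
    have hf : ∀ x : ℝ, ‖((Int.fract x : ℝ) : ℂ)‖ ≤ 1 := fun x => by
      rw [norm_real, Real.norm_of_nonneg (Int.fract_nonneg x)]; exact (Int.fract_lt_one x).le
    rw [e]
    refine (norm_sub_le _ _).trans ?_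
    have h1 := norm_sub_le z (e₁ * ((Int.fract w.1 : ℝ) : ℂ))
    rw [norm_mul] at h1 ⊢
    have h2 := mul_le_mul_of_nonneg_left (hf w.1) (_root_.norm_nonneg e₁)
    have h3 := mul_le_mul_of_nonneg_left (hf w.2) (_root_.norm_nonneg e₂)
    rw [hc₀]; linarith
  have hsub1 : ∀ R, U R ⊆ region e₁ e₂ (R + c₀) := by
    intro R w hw
    simp only [hU, Set.mem_iUnion, Set.Finite.mem_toFinset] at hw
    obtain ⟨q, hq, hwq⟩ := hw
    rw [mem_box] at hwq
    have hq' : ‖z + e₁ * q.1 + e₂ * q.2‖ ≤ R := hq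
    rw [← hwq.1, ← hwq.2] at hq'
    have h := norm_sub_norm_le (e₁ * (w.1 : ℂ) + e₂ * w.2) (z + e₁ * (⌊w.1⌋ : ℤ) + e₂ * (⌊w.2⌋ : ℤ))
    rw [norm_sub_rev] at h
    have := hdiff w
    change ‖e₁ * (w.1 : ℂ) + e₂ * w.2‖ ≤ R + c₀
    linarith
  have hsub2 : ∀ R, region e₁ e₂ (R - c₀) ⊆ U R := by
    intro R w hw
    have hw' : ‖e₁ * (w.1 : ℂ) + e₂ * w.2‖ ≤ R - c₀ := hw
    simp only [hU, Set.mem_iUnion, Set.Finite.mem_toFinset]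
    refine ⟨(⌊w.1⌋, ⌊w.2⌋), ?_, mem_box.2 ⟨rfl, rfl⟩⟩
    have h := norm_sub_norm_le (z + e₁ * (⌊w.1⌋ : ℤ) + e₂ * (⌊w.2⌋ : ℤ)) (e₁ * (w.1 : ℂ) + e₂ * w.2)
    have := hdiff w
    change ‖z + e₁ * (⌊w.1⌋ : ℤ) + e₂ * (⌊w.2⌋ : ℤ)‖ ≤ R
    linarith
  refine ⟨κ * (2 * c₀ + c₀ ^ 2) + 1, by positivity, fun R hR => ?_⟩
  have hup : ((lpts z e₁ e₂ R).ncard : ℝ) ≤ κ * (R + c₀) ^ 2 := by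
    rw [← hUvol, ← hvol _ (by linarith)]
    exact measureReal_mono (hsub1 R) (region_finite he _).ne
  have hlo : κ * R ^ 2 - κ * (2 * c₀ * R) ≤ (lpts z e₁ e₂ R).ncard := by
    rcases le_or_gt R c₀ with h | h
    · have : κ * R ^ 2 ≤ κ * (2 * c₀ * R) := by gcongr; nlinarith
      have : (0 : ℝ) ≤ (lpts z e₁ e₂ R).ncard := Nat.cast_nonneg _
      linarith
    · have := measureReal_mono (μ := volume) (hsub2 R)
        ((measure_mono (hsub1 R)).trans_lt (region_finite he _)).ne
      rw [hUvol, hvol _ (by linarith)] at this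
      nlinarith [mul_nonneg hκ0 (sq_nonneg c₀)]
  rw [abs_le]
  have hk1 : κ * c₀ ^ 2 ≤ κ * c₀ ^ 2 * R := by
    nlinarith [mul_nonneg hκ0 (sq_nonneg c₀)]
  constructor <;> nlinarith [mul_nonneg hκ0 (sq_nonneg c₀)]

theorem volume_region_comp {e₁ e₂ f₁ f₂ : ℂ} {a b d : ℝ} (ha : 0 < a) (hd : 0 < d)
    (h1 : f₁ = e₁ * a) (h2 : f₂ = e₁ * b + e₂ * d) :
    volume.real (region f₁ f₂ 1) = (a * d)⁻¹ * volume.real (region e₁ e₂ 1) := by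
  set L : (ℝ × ℝ) →ₗ[ℝ] (ℝ × ℝ) :=
    Matrix.toLin (Module.Basis.finTwoProd ℝ) (Module.Basis.finTwoProd ℝ) !![a, b; 0, d] with hL
  have hdet : LinearMap.det L = a * d := by
    rw [hL, LinearMap.det_toLin, Matrix.det_fin_two_of]; ring
  have hpre : region f₁ f₂ 1 = L ⁻¹' region e₁ e₂ 1 := by
    ext q
    simp only [region, Set.mem_preimage, Set.mem_ofPred_eq, hL, Matrix.toLin_finTwoProd_apply]
    rw [h1, h2]
    push_cast
    ring_nf
  rw [measureReal_def, measureReal_def, hpre, Measure.addHaar_preimage_linearMap _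
    (by rw [hdet]; positivity), hdet, ENNReal.toReal_mul,
    ENNReal.toReal_ofReal (abs_nonneg _), abs_of_pos (by positivity)]

end Lattice
end Bernays

namespace Bernays
open QuadraticAlgebra

section Count
variable (t n : ℤ) [hD : Fact (t ^ 2 - 4 * n < 0)]

/-- The image of `ω` in the upper half plane. -/
noncomputable def omegaC : ℂ := ⟨t / 2, √(4 * n - t ^ 2) / 2⟩

theorem sqrt_disc_pos : 0 < √((4 * n - t ^ 2 : ℤ) : ℝ) := by
  rw [Real.sqrt_pos]
  have := hD.out
  exact_mod_cast (by linarith : 0 < 4 * n - t ^ 2)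

theorem norm_sq_embed (u v : ℝ) :
    ‖(u : ℂ) + omegaC t n * v‖ ^ 2 = u ^ 2 + t * u * v + n * v ^ 2 := by
  have h := Real.sq_sqrt (show (0 : ℝ) ≤ 4 * n - t ^ 2 by
    have := hD.out
    have h2 : (0 : ℝ) ≤ ((4 * n - t ^ 2 : ℤ) : ℝ) := by exact_mod_cast (by linarith)
    push_cast at h2; exact h2)
  rw [← Complex.normSq_eq_norm_sq, Complex.normSq_apply]
  simp [omegaC]
  linear_combination (v ^ 2 / 4) * h

/-- The absolute value of the discriminant. -/
def dsc (t n : ℤ) : ℕ := (t ^ 2 - 4 * n).natAbs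

/-- The elements of an ideal with bounded norm coprime to the discriminant. -/
def elts (J : Ideal (Ord t n)) (y : ℝ) : Set (Ord t n) :=
  {α | α ∈ J ∧ ((QuadraticAlgebra.norm α : ℤ) : ℝ) ≤ y ∧ IsCoprime (norm α) (t ^ 2 - 4 * n)}

/-- Residues modulo the discriminant of norm coprime to it. -/
def goodRes : Set (ZMod (dsc t n) × ZMod (dsc t n)) :=
  {q | IsUnit (q.1 ^ 2 + t * q.1 * q.2 + n * q.2 ^ 2)}

instance : NeZero (dsc t n) := ⟨by rw [dsc]; exact Int.natAbs_ne_zero.2 hD.out.ne⟩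

variable {t n}

theorem isCoprime_disc_iff {m : ℤ} :
    IsCoprime m (t ^ 2 - 4 * n) ↔ IsUnit (m : ZMod (dsc t n)) := by
  rw [ZMod.coe_int_isUnit_iff_isCoprime, dsc, Int.isCoprime_iff_gcd_eq_one,
    Int.isCoprime_iff_gcd_eq_one, Int.gcd_comm, Int.gcd_def, Int.gcd_def, Int.natAbs_natCast]

theorem ncard_shift {s : ℕ} (hs : IsCoprime (s : ℤ) (t ^ 2 - 4 * n)) (r : ℤ) :
    {q : ZMod (dsc t n) × ZMod (dsc t n) |
      ((s : ZMod (dsc t n)) * q.1 - (r : ZMod (dsc t n)) * q.2, q.2) ∈ goodRes t n}.ncard = (goodRes t n).ncard := by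
  have hu : IsUnit (s : ZMod (dsc t n)) := by
    have := isCoprime_disc_iff.1 hs
    simpa using this
  obtain ⟨u, hu⟩ := hu
  refine Set.ncard_congr (fun q _ => ((s : ZMod (dsc t n)) * q.1 - (r : ZMod (dsc t n)) * q.2, q.2)) (fun q hq => hq) ?_ ?_
  · rintro ⟨a, b⟩ ⟨a', b'⟩ - - h
    simp only [Prod.mk.injEq] at h
    obtain ⟨h1, rfl⟩ := h
    rw [sub_left_inj, ← hu, Units.mul_right_inj] at h1
    rw [h1]
  · rintro ⟨a, b⟩ hq
    have e : (s : ZMod (dsc t n)) * ((u⁻¹ : (ZMod _)ˣ) * (a + (r : ZMod (dsc t n)) * b)) - (r : ZMod (dsc t n)) * b = a := by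
      rw [← hu, Units.mul_inv_cancel_left]; ring
    refine ⟨((u⁻¹ : (ZMod _)ˣ) * (a + (r : ZMod (dsc t n)) * b), b), ?_, ?_⟩
    · rw [Set.mem_ofPred_eq]; simp only [e]; exact hq
    · simp only [e]

theorem elts_eq {s : ℕ} (hs0 : s ≠ 0) {r : ℤ} (hr : (s : ℤ) ∣ r ^ 2 - t * r + n) (y : ℝ) :
    (elts t n (Kid s r) y).ncard = {q : ℤ × ℤ |
      ((⟨s * q.1 - r * q.2, q.2⟩ : Ord t n)) ∈ elts t n ⊤ y}.ncard := by
  symm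
  refine Set.ncard_congr (fun q _ => (⟨s * q.1 - r * q.2, q.2⟩ : Ord t n)) ?_ ?_ ?_
  · rintro ⟨a, b⟩ ⟨-, h⟩
    exact ⟨(mem_Kid hr).2 ⟨a, by simp; ring⟩, h⟩
  · rintro ⟨a, b⟩ ⟨a', b'⟩ - - h
    rw [QuadraticAlgebra.ext_iff] at h
    obtain ⟨h1, h2⟩ := h
    simp only at h1 h2
    subst h2
    have : (s : ℤ) * a = s * a' := by linarith
    rw [mul_left_cancel₀ (by exact_mod_cast hs0) this]
  · rintro α ⟨hα, h⟩
    obtain ⟨u, hu⟩ := (mem_Kid hr).1 hα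
    have e : (⟨s * u - r * α.im, α.im⟩ : Ord t n) = α := by
      ext <;> simp; linear_combination -hu
    exact ⟨(u, α.im), by rw [Set.mem_ofPred_eq]; simp only [e]; exact ⟨trivial, h⟩, e⟩

theorem mem_elts_iff {s : ℕ} {r : ℤ} {y : ℝ} (hy : 0 ≤ y) (q : ℤ × ℤ) :
    (⟨s * q.1 - r * q.2, q.2⟩ : Ord t n) ∈ elts t n ⊤ y ↔
      ‖(s : ℂ) * q.1 + (omegaC t n - r) * q.2‖ ≤ √y ∧
      (((s : ZMod (dsc t n)) * (q.1 : ZMod (dsc t n)) - (r : ZMod (dsc t n)) *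
        (q.2 : ZMod (dsc t n)), (q.2 : ZMod (dsc t n))) ∈ goodRes t n) := by
  have h1 : ((QuadraticAlgebra.norm (⟨s * q.1 - r * q.2, q.2⟩ : Ord t n) : ℤ) : ℝ) =
      ‖(s : ℂ) * q.1 + (omegaC t n - r) * q.2‖ ^ 2 := by
    have := norm_sq_embed t n ((s : ℝ) * q.1 - r * q.2) q.2
    rw [show (s : ℂ) * q.1 + (omegaC t n - r) * q.2 =
      (((s : ℝ) * q.1 - r * q.2 : ℝ) : ℂ) + omegaC t n * ((q.2 : ℝ) : ℂ) by push_cast; ring, this]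
    simp [QuadraticAlgebra.norm_def]
    ring
  simp only [elts, Set.mem_ofPred_eq, Submodule.mem_top, true_and, goodRes]
  rw [isCoprime_disc_iff, h1, Real.le_sqrt (_root_.norm_nonneg _) hy]
  refine and_congr Iff.rfl ?_
  simp [QuadraticAlgebra.norm_def]
  ring_nf

theorem omegaC_im_ne {s : ℕ} (hs0 : s ≠ 0) (r : ℤ) {a b : ℝ} (ha : 0 < a) (hb : 0 < b) :
    (star ((s : ℂ) * a) * ((omegaC t n - r) * b)).im ≠ 0 := by
  have := sqrt_disc_pos t n
  push_cast at this
  have h2 : (0 : ℝ) < s := by exact_mod_cast Nat.pos_of_ne_zero hs0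
  simp [omegaC]
  exact ⟨⟨hs0, ha.ne'⟩, this.ne', hb.ne'⟩

open Classical in
theorem ncard_elts_eq_sum {s : ℕ} (hs0 : s ≠ 0) (r : ℤ) {y : ℝ} (hy : 0 ≤ y) :
    {q : ℤ × ℤ | ((⟨s * q.1 - r * q.2, q.2⟩ : Ord t n)) ∈ elts t n ⊤ y}.ncard =
      ∑ ρ : ZMod (dsc t n) × ZMod (dsc t n),
        if ((s : ZMod (dsc t n)) * ρ.1 - (r : ZMod (dsc t n)) * ρ.2, ρ.2) ∈ goodRes t n then
      (lpts (s * (ρ.1.val : ℂ) + (omegaC t n - r) * (ρ.2.val : ℂ))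
        (s * ((dsc t n : ℝ) : ℂ)) ((omegaC t n - r) * ((dsc t n : ℝ) : ℂ)) (√y)).ncard
        else 0 := by
  have hd : (0 : ℝ) < dsc t n := by exact_mod_cast Nat.pos_of_ne_zero (NeZero.ne _)
  set X := {q : ℤ × ℤ | ((⟨s * q.1 - r * q.2, q.2⟩ : Ord t n)) ∈ elts t n ⊤ y} with hX
  have hmem : ∀ q : ℤ × ℤ, q ∈ X ↔ _ := fun q => mem_elts_iff hy q
  have hfin : X.Finite := by
    refine (lpts_finite (omegaC_im_ne (t := t) (n := n) hs0 r one_pos one_pos) 0 (√y)).subset ?_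
    intro q hq
    have := ((hmem q).1 hq).1
    simpa [lpts] using this
  rw [Set.ncard_eq_toFinset_card X hfin, Finset.card_eq_sum_card_fiberwise
    (f := fun q : ℤ × ℤ => ((q.1 : ZMod (dsc t n)), (q.2 : ZMod (dsc t n))))
    (t := Finset.univ) (by intro _ _; simp)]
  refine Finset.sum_congr rfl fun ρ _ => ?_
  split_ifs with hρ
  · rw [← Set.ncard_coe_finset]
    symm
    have hd0 : (dsc t n : ℤ) ≠ 0 := by exact_mod_cast NeZero.ne (dsc t n)
    refine Set.ncard_congr (fun q _ => ((ρ.1.val : ℤ) + dsc t n * q.1, (ρ.2.val : ℤ) + dsc t n * q.2))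
      ?_ ?_ ?_
    · intro q hq
      simp only [Finset.coe_filter, Set.Finite.mem_toFinset, Set.mem_ofPred_eq]
      rw [hmem]
      have hcast : ∀ (z : ZMod (dsc t n)) (k : ℤ),
          (((z.val : ℤ) + dsc t n * k : ℤ) : ZMod (dsc t n)) = z := by
        intro z k
        rw [Int.cast_add, Int.cast_mul, Int.cast_natCast, Int.cast_natCast, ZMod.natCast_self,
          zero_mul, add_zero, ZMod.natCast_zmod_val]
      simp only [hcast]
      refine ⟨⟨?_, hρ⟩, trivial⟩
      have hq' : ‖_‖ ≤ _ := hq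
      convert hq' using 2
      push_cast
      ring
    · rintro ⟨a, b⟩ ⟨a', b'⟩ - - h
      simp only [Prod.mk.injEq, add_right_inj, mul_eq_mul_left_iff, hd0, or_false] at h
      exact Prod.ext h.1 h.2
    · rintro ⟨a, b⟩ hq
      simp only [Finset.coe_filter, Set.Finite.mem_toFinset, Set.mem_ofPred_eq] at hq
      obtain ⟨hq, rfl⟩ := hq
      have key : ∀ a : ℤ, ∃ k : ℤ, (((a : ZMod (dsc t n)).val : ℕ) : ℤ) + dsc t n * k = a := by
        intro a
        refine ⟨a / dsc t n, ?_⟩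
        rw [ZMod.val_intCast]
        exact Int.emod_add_mul_ediv a _
      obtain ⟨k, hk⟩ := key a
      obtain ⟨l, hl⟩ := key b
      refine ⟨(k, l), ?_, Prod.ext hk hl⟩
      have h1 := ((hmem _).1 hq).1
      simp only at h1
      change ‖_‖ ≤ _
      convert h1 using 2
      conv_rhs => rw [← hk, ← hl]
      push_cast
      ring
  · rw [Finset.card_eq_zero, Finset.filter_eq_empty_iff]
    rintro q hq rfl
    rw [Set.Finite.mem_toFinset] at hq
    exact hρ ((hmem q).1 hq).2

end Count
end Bernays

namespace Bernays
open QuadraticAlgebra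

section Count
variable (t n : ℤ) [hD : Fact (t ^ 2 - 4 * n < 0)]

open Classical in
theorem exists_elts_count : ∃ κ : ℝ, 0 < κ ∧ ∀ (s : ℕ) (r : ℤ), s ≠ 0 →
    IsCoprime (s : ℤ) (t ^ 2 - 4 * n) → (s : ℤ) ∣ r ^ 2 - t * r + n →
    ∃ C : ℝ, ∀ x : ℝ, 1 ≤ x → |((elts t n (Kid s r) (s * x)).ncard : ℝ) - κ * x| ≤ C * √x := by
  have hd : (0 : ℝ) < dsc t n := by exact_mod_cast Nat.pos_of_ne_zero (NeZero.ne _)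
  have hU : 0 < (goodRes t n).ncard := by
    rw [Set.ncard_pos (Set.toFinite _)]
    exact ⟨(1, 0), by simp [goodRes]⟩
  have hV : 0 < MeasureTheory.volume.real (region 1 (omegaC t n) 1) := by
    refine ENNReal.toReal_pos (region_volume_pos _ _).ne' (region_finite ?_ 1).ne
    have := omegaC_im_ne (t := t) (n := n) one_ne_zero 0 one_pos one_pos
    simpa using this
  refine ⟨(goodRes t n).ncard * MeasureTheory.volume.real (region 1 (omegaC t n) 1) /
    (dsc t n : ℝ) ^ 2, by positivity, fun s r hs0 hs hr => ?_⟩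
  have hs' : (1 : ℝ) ≤ s := by exact_mod_cast Nat.one_le_iff_ne_zero.2 hs0
  have hs'' : (0 : ℝ) < s := by linarith
  have key := fun z => lattice_count (omegaC_im_ne (t := t) (n := n) hs0 r hd hd) z
  have hvol := volume_region_comp (e₁ := 1) (e₂ := omegaC t n) (f₁ := (s : ℂ) * (dsc t n : ℝ))
    (f₂ := (omegaC t n - r) * (dsc t n : ℝ)) (a := s * dsc t n) (b := -(dsc t n * r))
    (d := dsc t n) (by positivity) hd (by push_cast; ring) (by push_cast; ring)
  choose c hc0 hc using key
  let P : ZMod (dsc t n) × ZMod (dsc t n) → Prop := fun ρ =>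
    ((s : ZMod (dsc t n)) * ρ.1 - (r : ZMod (dsc t n)) * ρ.2, ρ.2) ∈ goodRes t n
  let z : ZMod (dsc t n) × ZMod (dsc t n) → ℂ := fun ρ =>
    s * (ρ.1.val : ℂ) + (omegaC t n - r) * (ρ.2.val : ℂ)
  refine ⟨(∑ ρ, c (z ρ)) * √s, fun x hx => ?_⟩
  have hx0 : 0 ≤ x := by linarith
  have hR : 1 ≤ √(s * x) := Real.one_le_sqrt.2 (one_le_mul_of_one_le_of_one_le hs' hx)
  rw [elts_eq hs0 hr, ncard_elts_eq_sum hs0 r (by positivity)]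
  have hcount : (∑ ρ, if P ρ then (1 : ℝ) else 0) = (goodRes t n).ncard := by
    rw [← ncard_shift hs r, Finset.sum_boole, Set.ncard_eq_toFinset_card']
    congr 2
    ext ρ; simp [P]
  have hmain : (goodRes t n).ncard * MeasureTheory.volume.real (region 1 (omegaC t n) 1) /
    (dsc t n : ℝ) ^ 2 * x = ∑ ρ, if P ρ then MeasureTheory.volume.real
      (region ((s : ℂ) * (dsc t n : ℝ)) ((omegaC t n - r) * (dsc t n : ℝ)) 1) * √(s * x) ^ 2
      else 0 := by
    rw [← hcount, Finset.sum_mul, Finset.sum_div, Finset.sum_mul]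
    refine Finset.sum_congr rfl fun ρ _ => ?_
    split_ifs
    · rw [hvol, Real.sq_sqrt (by positivity)]
      field_simp
    · simp
  rw [hmain]
  push_cast
  rw [← Finset.sum_sub_distrib]
  refine (Finset.abs_sum_le_sum_abs _ _).trans ?_
  rw [mul_assoc, ← Real.sqrt_mul hs''.le, Finset.sum_mul]
  refine Finset.sum_le_sum fun ρ _ => ?_
  change |(if P ρ then _ else _) - (if P ρ then _ else _)| ≤ _
  split_ifs
  · exact hc (z ρ) _ hR
  · simp only [sub_self, abs_zero]
    have := hc0 (z ρ)
    positivity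

end Count
end Bernays

namespace Bernays
open QuadraticAlgebra

section Count
variable (t n : ℤ) [hD : Fact (t ^ 2 - 4 * n < 0)]

theorem finite_elts (J : Ideal (Ord t n)) (y : ℝ) : (elts t n J y).Finite := by
  rcases lt_or_ge y 0 with hy | hy
  · convert Set.finite_empty
    rw [Set.eq_empty_iff_forall_notMem]
    rintro α ⟨-, h, -⟩
    have : (0 : ℝ) ≤ (QuadraticAlgebra.norm α : ℤ) := by exact_mod_cast norm_nonneg α
    linarith
  · refine ((lpts_finite (omegaC_im_ne (t := t) (n := n) one_ne_zero 0 one_pos one_pos) 0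
      (√y)).image fun q : ℤ × ℤ => (⟨q.1, q.2⟩ : Ord t n)).subset ?_
    rintro ⟨a, b⟩ ⟨-, h⟩
    refine ⟨(a, b), ?_, rfl⟩
    have := (mem_elts_iff (t := t) (n := n) (s := 1) (r := 0) hy (a, b)).1
      ⟨Submodule.mem_top, by simpa using h⟩
    simpa [lpts] using this.1

theorem norm_unit (u : (Ord t n)ˣ) : norm (u : Ord t n) = 1 := by
  have h1 : IsN 1 (Ideal.span {(u : Ord t n)}) := by
    rw [Ideal.span_singleton_eq_top.2 u.isUnit]; exact isN_one
  simpa using h1.norm_eq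

instance : Finite (Ord t n)ˣ := by
  have := (finite_elts t n ⊤ 1).to_subtype
  refine Finite.of_injective (fun u : (Ord t n)ˣ => (⟨(u : Ord t n), ?_⟩ : elts t n ⊤ 1)) ?_
  · refine ⟨Submodule.mem_top, ?_, ?_⟩ <;> rw [norm_unit]
    · simp
    · exact isCoprime_one_left
  · intro u v h
    exact Units.ext (congrArg Subtype.val h)

theorem not_isUnit_disc : ¬ IsUnit (t ^ 2 - 4 * n) := by
  intro h
  rcases Int.isUnit_iff.1 h with h | h
  · have := hD.out; omega
  · rcases Int.even_or_odd' t with ⟨k, rfl | rfl⟩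
    · ring_nf at h; omega
    · ring_nf at h; omega

/-- Invertible ideals of a given class and bounded norm coprime to the discriminant. -/
def idl (g : HS t n) (x : ℝ) : Set (Ideal (Ord t n)) :=
  {B | ∃ m : ℕ, m ≠ 0 ∧ (m : ℝ) ≤ x ∧ IsCoprime (m : ℤ) (t ^ 2 - 4 * n) ∧ IsN m B ∧ cls B = g}

theorem finite_idl (g : HS t n) (x : ℝ) : (idl t n g x).Finite := by
  refine (finite_isN_le t n ⌊x⌋₊).subset ?_
  rintro B ⟨m, hm, hx, -, hB, -⟩
  exact ⟨m, hm, Nat.le_floor hx, hB⟩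

variable {t n}

theorem IsN.natCast_dvd_norm {s : ℕ} {J : Ideal (Ord t n)} (hJ : IsN s J) {α : Ord t n}
    (hα : α ∈ J) : (s : ℤ) ∣ norm α := by
  have h : α * star α ∈ J * Bernays.conj J := Ideal.mul_mem_mul hα (star_mem_conj hα)
  rw [hJ, Ideal.mem_span_singleton] at h
  rw [← norm_cast_eq] at h
  exact (natCast_dvd_iff.1 h).1

theorem elts_ncard {s : ℕ} {g : HS t n} {J : Ideal (Ord t n)} (hs0 : s ≠ 0) (hJ : IsN s J)
    (hs : IsCoprime (s : ℤ) (t ^ 2 - 4 * n)) (hg : cls J = (g : ClassGroup (Ord t n))⁻¹) (x : ℝ) :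
    (elts t n J (s * x)).ncard = Nat.card (Ord t n)ˣ * (idl t n g x).ncard := by
  classical
  have hs' : (0 : ℝ) < s := by exact_mod_cast Nat.pos_of_ne_zero hs0
  have ex : ∀ α ∈ elts t n J (s * x), α ≠ 0 ∧ ∃ B ∈ idl t n g x, Ideal.span {α} = J * B := by
    rintro α ⟨hα, hx, hc⟩
    have h0 : α ≠ 0 := by
      rintro rfl
      rw [QuadraticAlgebra.norm_def] at hc
      simp only [re_zero, im_zero] at hc
      exact not_isUnit_disc t n (isCoprime_zero_left.1 (by simpa using hc))
    obtain ⟨m, hm⟩ := hJ.natCast_dvd_norm hα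
    have hpos := norm_pos h0
    have hm0 : 0 < m := by
      have : (0 : ℤ) < s := by exact_mod_cast Nat.pos_of_ne_zero hs0
      rw [hm] at hpos
      exact pos_of_mul_pos_right hpos this.le
    lift m to ℕ using hm0.le
    have hN : IsN (s * m) (Ideal.span {α}) := isN_span (by rw [hm]; push_cast; rfl)
    obtain ⟨B, hB⟩ := hJ.dvd hs0 ((Ideal.span_singleton_le_iff_mem _).2 hα)
    have hm0' : m ≠ 0 := by rintro rfl; simp at hm0
    have hNB : IsN m B := hJ.of_mul hs0 (hB ▸ hN)
    refine ⟨h0, B, ⟨m, hm0', ?_, ?_, hNB, ?_⟩, hB⟩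
    · rw [hm] at hx
      push_cast at hx
      exact le_of_mul_le_mul_left hx hs'
    · rw [hm] at hc
      exact hc.of_mul_left_right
    · have := cls_span α h0
      rw [hB, cls_mul hs0 hJ hm0' hNB, hg, inv_mul_eq_one] at this
      exact this.symm
  choose! f hf hfJ using fun α hα => (ex α hα).2
  have hfin := finite_elts t n J (s * x)
  have hfin' := finite_idl t n g x
  rw [Set.ncard_eq_toFinset_card _ hfin, Set.ncard_eq_toFinset_card _ hfin',
    Finset.card_eq_sum_card_fiberwise (f := f) (t := hfin'.toFinset)
      (by intro α hα; simpa using hf α (by simpa using hα)),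
    mul_comm (Nat.card _), Finset.sum_const_nat]
  intro B hB
  rw [Set.Finite.mem_toFinset] at hB
  obtain ⟨m, hm0, hmx, hmc, hNB, hcB⟩ := hB
  obtain ⟨α₀, h₀, hα₀⟩ := (cls_eq_one_iff (mul_ne_zero hs0 hm0) (hJ.mul hNB)).1
    (by rw [cls_mul hs0 hJ hm0 hNB, hg, hcB, inv_mul_cancel])
  rw [← Set.ncard_coe_finset, ← Set.ncard_univ]
  symm
  have hmem : ∀ u : (Ord t n)ˣ, Ideal.span {α₀ * u} = J * B := fun u => by
    rw [Ideal.span_singleton_mul_right_unit u.isUnit, hα₀]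
  have hin : ∀ u : (Ord t n)ˣ, α₀ * u ∈ elts t n J (s * x) := by
    intro u
    have hNu : IsN (s * m) (Ideal.span {α₀ * (u : Ord t n)}) := by
      rw [hmem u]; exact hJ.mul hNB
    have hn := hNu.norm_eq
    refine ⟨?_, ?_, ?_⟩
    · have : α₀ * (u : Ord t n) ∈ J * B := by rw [← hmem u]; exact Ideal.mem_span_singleton_self (α₀ * (u : Ord t n))
      exact Ideal.mul_le_left this
    · rw [hn]; push_cast; gcongr
    · rw [hn]; push_cast; exact hs.mul_left hmc
  have hfB : ∀ u : (Ord t n)ˣ, f (α₀ * u) = B := fun u =>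
    hJ.mul_left_cancel hs0 ((hfJ _ (hin u)).symm.trans (hmem u))
  refine Set.ncard_congr (fun u _ => α₀ * (u : Ord t n)) ?_ ?_ ?_
  · intro u _
    simp only [Finset.coe_filter, Set.Finite.mem_toFinset, Set.mem_ofPred_eq]
    exact ⟨hin u, hfB u⟩
  · intro u v _ _ h
    exact Units.ext (mul_left_cancel₀ h₀ h)
  · intro α hα
    simp only [Finset.coe_filter, Set.Finite.mem_toFinset, Set.mem_ofPred_eq] at hα
    have := hfJ α hα.1
    rw [hα.2, hα₀, Ideal.span_singleton_eq_span_singleton] at this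
    obtain ⟨u, hu⟩ := this.symm
    exact ⟨u, trivial, hu⟩

variable (t n)

theorem exists_idl_count : ∃ κ : ℝ, 0 < κ ∧ ∀ g : HS t n, ∃ C : ℝ, ∀ x : ℝ, 1 ≤ x →
    |((idl t n g x).ncard : ℝ) - κ * x| ≤ C * √x := by
  obtain ⟨κ, hκ, h⟩ := exists_elts_count t n
  have hw : (0 : ℝ) < Nat.card (Ord t n)ˣ := by exact_mod_cast Nat.card_pos
  refine ⟨κ / Nat.card (Ord t n)ˣ, by positivity, fun g => ?_⟩
  obtain ⟨s, hs, hg⟩ := exists_pext_cH g⁻¹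
  obtain ⟨r, hr, hPS, -⟩ := hs.exists_Kid
  obtain ⟨C, hC⟩ := h s r hs.1 hs.coprime hr
  refine ⟨C / Nat.card (Ord t n)ˣ, fun x hx => ?_⟩
  have hcls : cls (Kid s r) = (g : ClassGroup (Ord t n))⁻¹ := by
    rw [← hPS, hs.cls_PS, ← Subgroup.coe_inv, ← hg, hs.coe_pext_cH, chat]
  have h1 := hC x hx
  rw [elts_ncard hs.1 (hPS ▸ hs.isN_PS) hs.coprime hcls] at h1
  rw [div_mul_eq_mul_div, div_mul_eq_mul_div, le_div_iff₀ hw, ← abs_of_pos hw, ← abs_mul,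
    abs_of_pos hw]
  refine le_of_eq_of_le ?_ h1
  congr 1
  push_cast
  field_simp

end Count
end Bernays

namespace Bernays
open ArithmeticFunction ArithmeticFunction.Moebius ArithmeticFunction.zeta

section CompMul

open Classical in
/-- The completely multiplicative function supported on products of primes in `S`
with prescribed values on primes. -/
noncomputable def cm {R : Type*} [CommSemiring R] (S : ℕ → Prop) (g : ℕ → R) : ℕ →*₀ R where
  toFun m := if AllP S m then pext g m else 0
  map_zero' := if_neg fun h => h.1 rfl
  map_one' := by rw [if_pos (allP_one S), pext_one]
  map_mul' a b := by
    by_cases ha : AllP S a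
    · by_cases hb : AllP S b
      · rw [if_pos ha, if_pos hb, if_pos (allP_mul.2 ⟨ha, hb⟩), pext_mul _ ha.1 hb.1]
      · rw [if_neg hb, if_neg fun h => hb (allP_mul.1 h).2, mul_zero]
    · rw [if_neg ha, if_neg fun h => ha (allP_mul.1 h).1, zero_mul]

theorem AllP.cm_eq {R : Type*} [CommSemiring R] {S : ℕ → Prop} (g : ℕ → R) {m : ℕ}
    (h : AllP S m) : cm S g m = pext g m := if_pos h

theorem cm_eq_zero {R : Type*} [CommSemiring R] {S : ℕ → Prop} (g : ℕ → R) {m : ℕ}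
    (h : ¬ AllP S m) : cm S g m = 0 := if_neg h

variable {R : Type*} [CommRing R]

/-- A completely multiplicative function as an arithmetic function. -/
def af (f : ℕ →*₀ R) : ArithmeticFunction R := ⟨f, map_zero f⟩

@[simp] theorem af_apply (f : ℕ →*₀ R) (m : ℕ) : af f m = f m := rfl

theorem sum_conv_filter (f g : ArithmeticFunction R) (W : ℕ → R) (N : ℕ) :
    ∑ m ∈ Finset.Ioc 0 N, (f * g) m * W m =
      ∑ x ∈ (Finset.Ioc 0 N ×ˢ Finset.Ioc 0 N).filter (fun x => x.1 * x.2 ≤ N),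
        f x.1 * g x.2 * W (x.1 * x.2) := by
  simp only [ArithmeticFunction.mul_apply]
  trans ∑ m ∈ Finset.Ioc 0 N, ∑ x ∈ (Finset.Ioc 0 N ×ˢ Finset.Ioc 0 N).filter
    (fun x => x.1 * x.2 = m), f x.1 * g x.2 * W (x.1 * x.2)
  · refine Finset.sum_congr rfl fun m hm => ?_
    simp only [Finset.mem_Ioc] at hm
    rw [Nat.divisorsAntidiagonal_eq_prod_filter_of_le hm.1.ne' hm.2, Finset.sum_mul]
    refine Finset.sum_congr rfl fun x hx => ?_
    rw [(Finset.mem_filter.1 hx).2]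
  · simp_rw [Finset.sum_filter]
    rw [Finset.sum_comm]
    refine Finset.sum_congr rfl fun x hx => ?_
    simp only [Finset.mem_product, Finset.mem_Ioc] at hx
    have : 0 < x.1 * x.2 := Nat.mul_pos hx.1.1 hx.2.1
    simp [this]

theorem sum_conv (f g : ArithmeticFunction R) (W : ℕ → R) (N : ℕ) :
    ∑ m ∈ Finset.Ioc 0 N, (f * g) m * W m =
      ∑ d ∈ Finset.Ioc 0 N, f d * ∑ k ∈ Finset.Ioc 0 (N / d), g k * W (d * k) := by
  rw [sum_conv_filter, Finset.sum_filter, Finset.sum_product]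
  refine Finset.sum_congr rfl fun d hd => ?_
  rw [Finset.mem_Ioc] at hd
  rw [← Finset.sum_filter, Finset.mul_sum]
  refine Finset.sum_congr ?_ fun k _ => mul_assoc _ _ _
  ext k
  simp only [Finset.mem_filter, Finset.mem_Ioc, Nat.le_div_iff_mul_le hd.1]
  constructor
  · rintro ⟨⟨h0, -⟩, h⟩; exact ⟨h0, by rwa [mul_comm]⟩
  · rintro ⟨h0, h⟩
    exact ⟨⟨h0, le_trans (Nat.le_mul_of_pos_right _ hd.1) h⟩, by rwa [mul_comm]⟩

theorem pmul_af_mul (f : ℕ →*₀ R) (g h : ArithmeticFunction R) :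
    (af f).pmul g * (af f).pmul h = (af f).pmul (g * h) := by
  ext m
  simp only [ArithmeticFunction.mul_apply, pmul_apply, af_apply, Finset.mul_sum]
  refine Finset.sum_congr rfl fun x hx => ?_
  rw [← (Nat.mem_divisorsAntidiagonal.1 hx).1, map_mul]
  ring

/-- The Dirichlet inverse of a completely multiplicative function. -/
def minv (f : ℕ →*₀ R) : ArithmeticFunction R := (af f).pmul (μ : ArithmeticFunction R)

theorem minv_mul (f : ℕ →*₀ R) : minv f * af f = 1 := by
  have h : af f = (af f).pmul (ζ : ArithmeticFunction R) := by
    ext m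
    rcases eq_or_ne m 0 with rfl | hm
    · simp
    · simp
  conv_lhs => rw [minv, h, ← h]
  conv_lhs => arg 2; rw [h]
  rw [pmul_af_mul, coe_moebius_mul_coe_zeta]
  ext m
  rcases eq_or_ne m 1 with rfl | hm
  · simp
  · simp [pmul_apply, one_apply_ne hm]

theorem dirichlet_invert (β : ℕ →*₀ ℝ) {F T : ℝ → ℝ} (hT : ∀ y < 1, T y = 0)
    (h : ∀ (y : ℝ) (N : ℕ), y < (N + 1) ^ 2 →
      F y = ∑ q ∈ Finset.Ioc 0 N, β q * T (y / q ^ 2)) {x : ℝ} {N : ℕ} (hx : x < (N + 1) ^ 2) :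
    T x = ∑ q ∈ Finset.Ioc 0 N, minv β q * F (x / q ^ 2) := by
  have h1 : ∑ q ∈ Finset.Ioc 0 N, minv β q * F (x / q ^ 2) =
      ∑ m ∈ Finset.Ioc 0 N, (minv β * af β) m * T (x / (m : ℝ) ^ 2) := by
    rw [sum_conv]
    refine Finset.sum_congr rfl fun q hq => ?_
    rw [Finset.mem_Ioc] at hq
    have hq0 : (0 : ℝ) < q := by exact_mod_cast hq.1
    congr 1
    rw [h (x / q ^ 2) (N / q)]
    · refine Finset.sum_congr rfl fun k hk => ?_
      rw [af_apply]; push_cast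
      rw [mul_pow, div_div]
    · rw [div_lt_iff₀ (by positivity), ← mul_pow]
      refine hx.trans_le (pow_le_pow_left₀ (by positivity) ?_ 2)
      have : N + 1 ≤ (N / q + 1) * q := by
        nlinarith [Nat.div_add_mod N q, Nat.mod_lt N hq.1]
      exact_mod_cast this
  rw [h1, minv_mul]
  rcases Nat.eq_zero_or_pos N with rfl | hN
  · simp only [Finset.Ioc_self, Finset.sum_empty]
    exact hT x (by simpa using hx)
  · rw [Finset.sum_eq_single_of_mem 1 (by simp; omega)]
    · simp
    · intro m _ hm
      rw [one_apply_ne hm, zero_mul]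

theorem abs_minv_le {β : ℕ →*₀ ℝ} (hβ : ∀ m, |β m| ≤ 1) (m : ℕ) : |minv β m| ≤ 1 := by
  rw [minv, pmul_apply, abs_mul, af_apply]
  refine mul_le_one₀ (hβ m) (abs_nonneg _) ?_
  rw [intCoe_apply]
  exact_mod_cast abs_moebius_le_one

theorem tsum_minv_pos {β : ℕ →*₀ ℝ} (hβ : ∀ m, |β m| ≤ 1) :
    Summable (fun q : ℕ => minv β q / (q : ℝ) ^ 2) ∧ 0 < ∑' q : ℕ, minv β q / (q : ℝ) ^ 2 := by
  have hs : Summable (fun q : ℕ => minv β q / (q : ℝ) ^ 2) := by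
    refine Summable.of_norm_bounded (g := fun q : ℕ => 1 / (q : ℝ) ^ 2) hasSum_zeta_two.summable ?_
    intro q
    rw [norm_div, Real.norm_eq_abs, norm_pow, Real.norm_natCast]
    gcongr
    exact abs_minv_le hβ q
  refine ⟨hs, ?_⟩
  have h2 : HasSum (fun q : ℕ => (if q = 1 then (2 : ℝ) else 0) - 1 / (q : ℝ) ^ 2)
      (2 - π ^ 2 / 6) := (hasSum_ite_eq 1 2).sub hasSum_zeta_two
  have h3 : 2 - π ^ 2 / 6 ≤ ∑' q : ℕ, minv β q / (q : ℝ) ^ 2 := by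
    refine hasSum_le (fun q => ?_) h2 hs.hasSum
    split_ifs with hq
    · subst hq
      simp [minv]; norm_num
    · have := abs_le.1 (abs_minv_le hβ q)
      rw [zero_sub, ← neg_div]
      gcongr
      exact this.1
  have : π ^ 2 < 12 := by nlinarith [Real.pi_lt_d2, Real.pi_pos]
  linarith

theorem invert_asymp (β : ℕ →*₀ ℝ) (hβ : ∀ m, |β m| ≤ 1) {F T : ℝ → ℝ} (hT : ∀ y < 1, T y = 0)
    (h : ∀ (y : ℝ) (N : ℕ), y < (N + 1) ^ 2 →
      F y = ∑ q ∈ Finset.Ioc 0 N, β q * T (y / q ^ 2)) (hF : ∀ y < 1, F y = 0) {κ C : ℝ}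
    (hFa : ∀ y > 0, |F y - κ * y| ≤ C * y ^ (2 / 3 : ℝ)) :
    ∃ C', ∀ x > 0, |T x - κ * (∑' q : ℕ, minv β q / (q : ℝ) ^ 2) * x| ≤ C' * x ^ (2 / 3 : ℝ) := by
  have hs43 : Summable (fun q : ℕ => (q : ℝ) ^ (-(4 / 3) : ℝ)) :=
    Real.summable_nat_rpow.2 (by norm_num)
  refine ⟨C * ∑' q : ℕ, (q : ℝ) ^ (-(4 / 3) : ℝ), fun x hx => ?_⟩
  set N := ⌊√x⌋₊
  have hN : x < (N + 1 : ℝ) ^ 2 := by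
    rw [← Real.sqrt_lt' (by positivity)]
    exact Nat.lt_floor_add_one _
  have h1 : HasSum (fun q : ℕ => minv β q * F (x / q ^ 2)) (T x) := by
    rw [dirichlet_invert β hT h hN]
    refine hasSum_sum_of_ne_finset_zero fun q hq => ?_
    rw [Finset.mem_Ioc, not_and_or] at hq
    rcases hq with hq | hq
    · have : q = 0 := by omega
      subst this; simp
    · rw [hF, mul_zero]
      rw [div_lt_one (by have : 0 < q := by omega
                         positivity)]
      refine hN.trans_le (pow_le_pow_left₀ (by positivity) ?_ 2)
      exact_mod_cast (by omega : N + 1 ≤ q)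
  have h2 := ((tsum_minv_pos hβ).1.hasSum.mul_left κ).mul_right x
  have h3 := h1.sub h2
  have h4 := (hs43.hasSum.mul_left C).mul_right (x ^ (2 / 3 : ℝ))
  rw [← h3.tsum_eq, ← Real.norm_eq_abs]
  refine tsum_of_norm_bounded h4 fun q => ?_
  rcases Nat.eq_zero_or_pos q with rfl | hq
  · simp
  have hq' : (0 : ℝ) < q := by exact_mod_cast hq
  have e : minv β q * F (x / q ^ 2) - κ * (minv β q / (q : ℝ) ^ 2) * x =
    minv β q * (F (x / q ^ 2) - κ * (x / q ^ 2)) := by field_simp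
  rw [e, norm_mul, Real.norm_eq_abs, Real.norm_eq_abs]
  refine (mul_le_of_le_one_left (abs_nonneg _) (abs_minv_le hβ q)).trans ?_
  refine (hFa _ (by positivity)).trans_eq ?_
  rw [Real.div_rpow hx.le (by positivity), ← Real.rpow_natCast, ← Real.rpow_mul hq'.le,
    Real.rpow_neg hq'.le, mul_assoc, div_eq_inv_mul]
  norm_num

end CompMul
end Bernays

namespace Bernays
open QuadraticAlgebra

/-- Pairs of integers composed of primes in `S` with bounded product and prescribed class
quotient. -/
def prs {G : Type*} [CommGroup G] (S : ℕ → Prop) (c : ℕ → G) (g : G) (x : ℝ) : Set (ℕ × ℕ) :=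
  {p | AllP S p.1 ∧ AllP S p.2 ∧ ((p.1 * p.2 : ℕ) : ℝ) ≤ x ∧ pext c p.1 * (pext c p.2)⁻¹ = g}

theorem finite_prs {G : Type*} [CommGroup G] (S : ℕ → Prop) (c : ℕ → G) (g : G) (x : ℝ) :
    (prs S c g x).Finite := by
  refine ((Set.finite_Iic ⌊x⌋₊).prod (Set.finite_Iic ⌊x⌋₊)).subset ?_
  rintro ⟨a, b⟩ ⟨ha, hb, hx, -⟩
  have h := Nat.le_floor hx
  exact ⟨(Nat.le_mul_of_pos_right a (Nat.pos_of_ne_zero hb.1)).trans h,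
    (Nat.le_mul_of_pos_left b (Nat.pos_of_ne_zero ha.1)).trans h⟩

section Count
variable (t n : ℤ) [hD : Fact (t ^ 2 - 4 * n < 0)]

theorem isS_not_isI (p : ℕ) (h : IsS t n p) : ¬ IsI t n p := fun h' => h'.2.2 h.2.2

variable {t n} in
theorem IsI.coprime {p : ℕ} (h : IsI t n p) : IsCoprime (p : ℤ) (t ^ 2 - 4 * n) :=
  (Nat.prime_iff_prime_int.1 h.1).irreducible.coprime_iff_not_dvd.2 h.2.1

variable {t n} in
theorem AllP.coprime_isI {q : ℕ} (h : AllP (IsI t n) q) : IsCoprime (q : ℤ) (t ^ 2 - 4 * n) := by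
  induction h using AllP.induction with
  | one => simpa using isCoprime_one_left
  | mul p a hp hS ha ih => rw [Nat.cast_mul]; exact IsCoprime.mul_left hS.coprime ih

theorem ncard_idl_eq (g : HS t n) {y : ℝ} :
    (idl t n g y).ncard = {z : ℕ × (ℕ × ℕ) | AllP (IsI t n) z.1 ∧
      z.2 ∈ prs (IsS t n) (cH t n) g (y / z.1 ^ 2)}.ncard := by
  symm
  have hN : ∀ z : ℕ × (ℕ × ℕ), AllP (IsI t n) z.1 → AllP (IsS t n) z.2.1 → AllP (IsS t n) z.2.2 →
      IsN (z.2.1 * z.2.2 * z.1 ^ 2)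
        (PS t n z.2.1 * conj (PS t n z.2.2) * Ideal.span {(z.1 : Ord t n)}) :=
    fun z _ h1 h2 => (h1.isN_PS.mul h2.isN_PS.conj).mul (isN_span_natCast z.1)
  have hC : ∀ z : ℕ × (ℕ × ℕ), AllP (IsI t n) z.1 → AllP (IsS t n) z.2.1 → AllP (IsS t n) z.2.2 →
      cls (PS t n z.2.1 * conj (PS t n z.2.2) * Ideal.span {(z.1 : Ord t n)}) =
        ((pext (cH t n) z.2.1 * (pext (cH t n) z.2.2)⁻¹ : HS t n) : ClassGroup (Ord t n)) := by
    intro z hq h1 h2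
    rw [cls_mul (mul_ne_zero h1.1 h2.1) (h1.isN_PS.mul h2.isN_PS.conj) (pow_ne_zero 2 hq.1)
      (isN_span_natCast _), cls_mul h1.1 h1.isN_PS h2.1 h2.isN_PS.conj, cls_conj h2.1 h2.isN_PS,
      cls_span _ (natCast_ne_zero hq.1), h1.cls_PS, h2.cls_PS, mul_one, Subgroup.coe_mul,
      Subgroup.coe_inv, h1.coe_pext_cH, h2.coe_pext_cH]
    rfl
  have hx : ∀ z : ℕ × (ℕ × ℕ), AllP (IsI t n) z.1 → (((z.2.1 * z.2.2 : ℕ) : ℝ) ≤ y / z.1 ^ 2 ↔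
      ((z.2.1 * z.2.2 * z.1 ^ 2 : ℕ) : ℝ) ≤ y) := by
    intro z hz
    have : (0 : ℝ) < z.1 := by exact_mod_cast Nat.pos_of_ne_zero hz.1
    rw [le_div_iff₀ (by positivity)]
    push_cast; rfl
  refine Set.ncard_congr (fun z _ => PS t n z.2.1 * conj (PS t n z.2.2) *
    Ideal.span {(z.1 : Ord t n)}) ?_ ?_ ?_
  · rintro z ⟨hq, h1, h2, hz, hg⟩
    refine ⟨_, mul_ne_zero (mul_ne_zero h1.1 h2.1) (pow_ne_zero 2 hq.1), (hx z hq).1 hz, ?_,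
      hN z hq h1 h2, ?_⟩
    · push_cast
      exact (h1.coprime.mul_left h2.coprime).mul_left hq.coprime_isI.pow_left
    · rw [hC z hq h1 h2, hg]
  · rintro ⟨q, s₁, s₂⟩ ⟨q', s₁', s₂'⟩ ⟨hq, h1, h2, -⟩ ⟨hq', h1', h2', -⟩ h
    simp only at hq h1 h2 hq' h1' h2' h
    have e := (hN (q, s₁, s₂) hq h1 h2).unique (h ▸ hN (q', s₁', s₂') hq' h1' h2')
    simp only at e
    obtain ⟨e1, e2⟩ := AllP.mul_inj (isS_not_isI t n) (allP_mul.2 ⟨h1, h2⟩)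
      (by rw [sq]; exact allP_mul.2 ⟨hq, hq⟩) (allP_mul.2 ⟨h1', h2'⟩)
      (by rw [sq]; exact allP_mul.2 ⟨hq', hq'⟩) e
    have e3 : q = q' := Nat.pow_left_injective two_ne_zero e2
    subst e3
    rw [mul_comm _ (Ideal.span _), mul_comm _ (Ideal.span _)] at h
    have h' := (isN_span_natCast q).mul_left_cancel (pow_ne_zero 2 hq.1) h
    have e4 := AllP.PS_inj h1 h2 h1' h2' e1 h'
    subst e4
    have e5 : s₂ = s₂' := Nat.eq_of_mul_eq_mul_left (Nat.pos_of_ne_zero h1.1) e1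
    rw [e5]
  · rintro B ⟨m, hm0, hm, hmc, hB, hcB⟩
    obtain ⟨q, s₁, s₂, hq, h1, h2, rfl, rfl⟩ := hB.exists_eq hm0 hmc
    refine ⟨(q, s₁, s₂), ⟨hq, h1, h2, (hx (q, s₁, s₂) hq).2 hm, ?_⟩, rfl⟩
    have := hC (q, s₁, s₂) hq h1 h2
    exact Subtype.ext (this.symm.trans hcB)

theorem ncard_idl_eq_sum (g : HS t n) {y : ℝ} {N : ℕ} (hy : y < (N + 1) ^ 2) :
    ((idl t n g y).ncard : ℝ) = ∑ q ∈ Finset.Ioc 0 N, cm (R := ℝ) (IsI t n) (fun _ => 1) q *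
      (prs (IsS t n) (cH t n) g (y / q ^ 2)).ncard := by
  classical
  rw [ncard_idl_eq]
  set Z := {z : ℕ × (ℕ × ℕ) | AllP (IsI t n) z.1 ∧
      z.2 ∈ prs (IsS t n) (cH t n) g (y / z.1 ^ 2)} with hZ
  have hle : ∀ z ∈ Z, z.1 ∈ Finset.Ioc 0 N := by
    rintro ⟨q, s₁, s₂⟩ ⟨hq, h1, h2, hz, -⟩
    simp only at hq h1 h2 hz
    have hq0 := Nat.pos_of_ne_zero hq.1
    rw [Finset.mem_Ioc]
    refine ⟨hq0, ?_⟩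
    by_contra hlt
    push Not at hlt
    have h3 : (1 : ℝ) ≤ ((s₁ * s₂ : ℕ) : ℝ) := by
      exact_mod_cast Nat.one_le_iff_ne_zero.2 (mul_ne_zero h1.1 h2.1)
    have h4 := h3.trans hz
    rw [le_div_iff₀ (by positivity), one_mul] at h4
    have h5 : ((N + 1 : ℕ) : ℝ) ≤ q := by exact_mod_cast hlt
    push_cast at h5
    have : ((N : ℝ) + 1) ^ 2 ≤ (q : ℝ) ^ 2 := pow_le_pow_left₀ (by positivity) h5 2
    linarith
  have hZe : Z = ↑((Finset.Ioc 0 N).biUnion fun q => if AllP (IsI t n) q then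
      (finite_prs (IsS t n) (cH t n) g (y / q ^ 2)).toFinset.image (Prod.mk q) else ∅) := by
    ext ⟨q, p⟩
    simp only [Finset.coe_biUnion, Set.mem_iUnion, Finset.mem_coe, exists_prop]
    constructor
    · intro hz
      refine ⟨q, hle _ hz, ?_⟩
      rw [if_pos hz.1]
      exact Finset.mem_image.2 ⟨p, (Set.Finite.mem_toFinset _).2 hz.2, rfl⟩
    · rintro ⟨q', hq', h⟩
      split_ifs at h with hI
      · simp only [Finset.mem_image, Set.Finite.mem_toFinset, Prod.mk.injEq] at h
        obtain ⟨p', hp', rfl, rfl⟩ := h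
        exact ⟨hI, hp'⟩
      · simp at h
  rw [hZe, Set.ncard_coe_finset, Finset.card_biUnion]
  · push_cast
    refine Finset.sum_congr rfl fun q _ => ?_
    split_ifs with hI
    · rw [Finset.card_image_of_injective _ (Prod.mk_right_injective q), hI.cm_eq, Set.ncard_eq_toFinset_card _ (finite_prs _ _ _ _)]
      simp [pext]
    · rw [cm_eq_zero _ hI]; simp
  · intro q _ q' _ hne
    simp only [Function.onFun]
    rw [Finset.disjoint_left]
    intro z hz hz'
    split_ifs at hz hz'
    · obtain ⟨_, -, rfl⟩ := Finset.mem_image.1 hz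
      obtain ⟨_, -, h⟩ := Finset.mem_image.1 hz'
      exact hne (Prod.mk.inj h).1.symm
    all_goals simp_all

theorem exists_prs_count : ∃ K : ℝ, 0 < K ∧ ∃ C : ℝ, ∀ (g : HS t n) (x : ℝ), 0 < x →
    |((prs (IsS t n) (cH t n) g x).ncard : ℝ) - K * x| ≤ C * x ^ (2 / 3 : ℝ) := by
  obtain ⟨κ, hκ, h⟩ := exists_idl_count t n
  have hβ : ∀ m, |cm (R := ℝ) (IsI t n) (fun _ => 1) m| ≤ 1 := by
    intro m
    by_cases hm : AllP (IsI t n) m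
    · rw [hm.cm_eq]; simp [pext]
    · rw [cm_eq_zero _ hm]; simp
  refine ⟨κ * ∑' q : ℕ, minv (cm (R := ℝ) (IsI t n) (fun _ => 1)) q / (q : ℝ) ^ 2,
    mul_pos hκ (tsum_minv_pos hβ).2, ?_⟩
  have key : ∀ g : HS t n, ∃ C, ∀ x : ℝ, 0 < x →
    |((prs (IsS t n) (cH t n) g x).ncard : ℝ) - κ * (∑' q : ℕ, minv (cm (R := ℝ) (IsI t n) (fun _ => 1)) q / (q : ℝ) ^ 2) * x| ≤ C * x ^ (2 / 3 : ℝ) := by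
    intro g
    obtain ⟨C, hC⟩ := h g
    have hF0 : ∀ y < (1 : ℝ), ((idl t n g y).ncard : ℝ) = 0 := by
      intro y hy
      rw [Nat.cast_eq_zero, Set.ncard_eq_zero (finite_idl t n g y)]
      rw [Set.eq_empty_iff_forall_notMem]
      rintro B ⟨m, hm, hmy, -⟩
      have : (1 : ℝ) ≤ m := by exact_mod_cast Nat.one_le_iff_ne_zero.2 hm
      linarith
    refine invert_asymp (C := max κ |C|) _ hβ (F := fun y => (idl t n g y).ncard)
      (T := fun y => (prs (IsS t n) (cH t n) g y).ncard) ?_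
      (fun y N hy => ncard_idl_eq_sum t n g hy) hF0 ?_
    · intro y hy
      rw [Nat.cast_eq_zero, Set.ncard_eq_zero (finite_prs _ _ _ _)]
      rw [Set.eq_empty_iff_forall_notMem]
      rintro p ⟨h1, h2, hmy, -⟩
      have : (1 : ℝ) ≤ ((p.1 * p.2 : ℕ) : ℝ) := by
        exact_mod_cast Nat.one_le_iff_ne_zero.2 (mul_ne_zero h1.1 h2.1)
      linarith
    · intro y hy
      rcases lt_or_ge y 1 with h1 | h1
      · simp only [hF0 y h1, zero_sub, abs_neg]
        rw [abs_of_pos (by positivity)]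
        have : y ≤ y ^ (2 / 3 : ℝ) := by
          conv_lhs => rw [← Real.rpow_one y]
          exact Real.rpow_le_rpow_of_exponent_ge hy h1.le (by norm_num)
        exact mul_le_mul (le_max_left _ _) this hy.le (hκ.le.trans (le_max_left _ _))
      · refine (hC y h1).trans ?_
        refine mul_le_mul ((le_abs_self C).trans (le_max_right _ _)) ?_ (Real.sqrt_nonneg _)
          (hκ.le.trans (le_max_left _ _))
        rw [Real.sqrt_eq_rpow]
        exact Real.rpow_le_rpow_of_exponent_le h1 (by norm_num)
  choose C hC using key
  have : Nonempty (HS t n) := ⟨1⟩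
  obtain ⟨g₀, hg₀⟩ := Finite.exists_max C
  refine ⟨C g₀, fun g x hx => (hC g x hx).trans ?_⟩
  gcongr
  exact hg₀ g

end Count
end Bernays

namespace Bernays
open ArithmeticFunction ArithmeticFunction.Moebius ArithmeticFunction.zeta

section Chebyshev

theorem abs_sub_le_of_succ {u w : ℕ → ℝ} {N₀ : ℕ}
    (h : ∀ N, N₀ ≤ N → |u (N + 1) - u N| ≤ w (N + 1) - w N) {M N : ℕ} (hM : N₀ ≤ M) (hN : M ≤ N) :
    |u N - u M| ≤ w N - w M := by
  induction N, hN using Nat.le_induction with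
  | base => simp
  | succ N hN ih =>
    have := abs_sub_le (u (N + 1)) (u N) (u M)
    have := h N (hM.trans hN)
    linarith

theorem sum_Ioc_succ (f : ℕ → ℝ) (N : ℕ) :
    ∑ k ∈ Finset.Ioc 0 (N + 1), f k = ∑ k ∈ Finset.Ioc 0 N, f k + f (N + 1) := by
  rw [Finset.sum_Ioc_succ_top (Nat.zero_le N)]

theorem abel_succ (a f : ℕ → ℝ) (N : ℕ) :
    (∑ k ∈ Finset.Ioc 0 (N + 1), a k * f k - (∑ k ∈ Finset.Ioc 0 (N + 1), a k) * f (N + 1)) -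
    (∑ k ∈ Finset.Ioc 0 N, a k * f k - (∑ k ∈ Finset.Ioc 0 N, a k) * f N) =
      (∑ k ∈ Finset.Ioc 0 N, a k) * (f N - f (N + 1)) := by
  rw [sum_Ioc_succ, sum_Ioc_succ]; ring

theorem exists_sum_vonMangoldt_le : ∃ C : ℝ, 0 < C ∧ ∀ y : ℝ, 0 ≤ y →
    ∑ k ∈ Finset.Ioc 0 ⌊y⌋₊, vonMangoldt k * (y / k) ^ (3 / 4 : ℝ) ≤ C * y := by
  have h4 : 0 < Real.log 4 := Real.log_pos (by norm_num)
  set c := Real.log 4 + 4 with hc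
  have hψ : ∀ N : ℕ, ∑ k ∈ Finset.Ioc 0 N, vonMangoldt k ≤ c * N := fun N => by
    have := Chebyshev.psi_le_const_mul_self (x := N) (by positivity)
    rwa [Chebyshev.psi, Nat.floor_natCast] at this
  have hψ0 : ∀ N : ℕ, 0 ≤ ∑ k ∈ Finset.Ioc 0 N, vonMangoldt k := fun N =>
    Finset.sum_nonneg fun k _ => vonMangoldt_nonneg
  have hroot : ∀ N : ℕ, 0 < N → ∃ a : ℝ, 0 < a ∧ (N : ℝ) ^ (1 / 4 : ℝ) = a ∧ a ^ 4 = N ∧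
      (N : ℝ) ^ (-(3 / 4) : ℝ) = (a ^ 3)⁻¹ := fun N hN => by
    have hN' : (0 : ℝ) < N := by exact_mod_cast hN
    refine ⟨(N : ℝ) ^ (1 / 4 : ℝ), by positivity, rfl, ?_, ?_⟩
    · rw [← Real.rpow_natCast, ← Real.rpow_mul hN'.le]; norm_num
    · rw [← Real.rpow_natCast, ← Real.rpow_mul hN'.le, ← Real.rpow_neg hN'.le]; norm_num
  have key : ∀ N : ℕ, 1 ≤ N →
      ∑ k ∈ Finset.Ioc 0 N, vonMangoldt k * (k : ℝ) ^ (-(3 / 4) : ℝ) ≤ 4 * c * (N : ℝ) ^ (1 / 4 : ℝ) := by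
    intro N hN
    have h1 := abs_sub_le_of_succ (N₀ := 1) (M := 1) (N := N)
      (u := fun N : ℕ => ∑ k ∈ Finset.Ioc 0 N, vonMangoldt k * (k : ℝ) ^ (-(3 / 4) : ℝ) -
        (∑ k ∈ Finset.Ioc 0 N, vonMangoldt k) * (N : ℝ) ^ (-(3 / 4) : ℝ))
      (w := fun N : ℕ => 3 * c * (N : ℝ) ^ (1 / 4 : ℝ)) ?_ le_rfl hN
    · simp only [Finset.sum_Ioc_succ_top (le_refl 0), Finset.Ioc_self, Finset.sum_empty,
        Nat.cast_one, Real.one_rpow] at h1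
      have h2 := (abs_le.1 h1).2
      have h3 : (∑ k ∈ Finset.Ioc 0 N, vonMangoldt k) * (N : ℝ) ^ (-(3 / 4) : ℝ) ≤
          c * (N : ℝ) ^ (1 / 4 : ℝ) := by
        obtain ⟨a, ha, e1, e2, e3⟩ := hroot N hN
        rw [e1, e3]
        have := hψ N
        rw [← e2] at this
        rw [← div_eq_mul_inv, div_le_iff₀ (by positivity)]
        linarith [this, (by ring : c * a * a ^ 3 = c * a ^ 4)]
      simp at h2
      have : 0 < c := by linarith
      linarith
    · intro N hN
      rw [abel_succ, abs_mul, abs_of_nonneg (hψ0 N)]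
      obtain ⟨a, ha, e1, e2, e3⟩ := hroot N hN
      obtain ⟨b, hb, e1', e2', e3'⟩ := hroot (N + 1) (by omega)
      rw [e1, e3, e1', e3']
      have hab : a ≤ b := by
        rw [← e1, ← e1']
        exact Real.rpow_le_rpow (by positivity) (by push_cast; linarith) (by norm_num)
      have h3 : (b ^ 3)⁻¹ ≤ (a ^ 3)⁻¹ := by gcongr
      rw [abs_of_nonneg (by linarith)]
      refine (mul_le_mul_of_nonneg_right (hψ N) (by linarith)).trans ?_
      rw [← e2, mul_assoc, show 3 * c * b - 3 * c * a = c * (3 * b - 3 * a) by ring]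
      have hc0 : 0 < c := by linarith
      refine mul_le_mul_of_nonneg_left ?_ hc0.le
      rw [mul_sub, show a ^ 4 * (a ^ 3)⁻¹ = a by field_simp, ← div_eq_mul_inv]
      have : (4 * a - 3 * b) ≤ a ^ 4 / b ^ 3 := by
        rw [le_div_iff₀ (by positivity)]
        nlinarith [mul_nonneg (sq_nonneg (a - b)) (by positivity : 0 ≤ a ^ 2 + 2 * a * b + 3 * b ^ 2)]
      linarith
  refine ⟨4 * c, by positivity, fun y hy => ?_⟩
  rcases lt_or_ge y 1 with h1 | h1
  · rw [Nat.floor_eq_zero.2 h1]; simp; positivity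
  have hf : 1 ≤ ⌊y⌋₊ := Nat.le_floor (by simpa using h1)
  have e : ∑ k ∈ Finset.Ioc 0 ⌊y⌋₊, vonMangoldt k * (y / k) ^ (3 / 4 : ℝ) =
      y ^ (3 / 4 : ℝ) * ∑ k ∈ Finset.Ioc 0 ⌊y⌋₊, vonMangoldt k * (k : ℝ) ^ (-(3 / 4) : ℝ) := by
    rw [Finset.mul_sum]
    refine Finset.sum_congr rfl fun k _ => ?_
    rw [Real.div_rpow hy (Nat.cast_nonneg k), Real.rpow_neg (Nat.cast_nonneg k)]
    ring
  rw [e]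
  refine (mul_le_mul_of_nonneg_left (key _ hf) (by positivity)).trans ?_
  have h5 : (⌊y⌋₊ : ℝ) ^ (1 / 4 : ℝ) ≤ y ^ (1 / 4 : ℝ) :=
    Real.rpow_le_rpow (by positivity) (Nat.floor_le hy) (by norm_num)
  have h6 : y ^ (3 / 4 : ℝ) * y ^ (1 / 4 : ℝ) = y := by
    rw [← Real.rpow_add (by linarith)]; norm_num
  calc y ^ (3 / 4 : ℝ) * (4 * c * (⌊y⌋₊ : ℝ) ^ (1 / 4 : ℝ))
      ≤ y ^ (3 / 4 : ℝ) * (4 * c * y ^ (1 / 4 : ℝ)) := by gcongr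
    _ = 4 * c * (y ^ (3 / 4 : ℝ) * y ^ (1 / 4 : ℝ)) := by ring
    _ = 4 * c * y := by rw [h6]

end Chebyshev
end Bernays

namespace Bernays
open ArithmeticFunction ArithmeticFunction.Moebius ArithmeticFunction.zeta

section Abel

theorem natCast_floor_div (x : ℝ) (d : ℕ) : ⌊x⌋₊ / d = ⌊x / d⌋₊ := (Nat.floor_div_natCast x d).symm

theorem le_of_mem_Ioc_floor {x : ℝ} {m : ℕ} (hm : m ∈ Finset.Ioc 0 ⌊x⌋₊) :
    (0 : ℝ) < m ∧ (m : ℝ) ≤ x := by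
  rw [Finset.mem_Ioc] at hm
  exact ⟨by exact_mod_cast hm.1, (Nat.le_floor_iff' hm.1.ne').1 hm.2⟩

/-- A comparison of the weights `(x/m)^{3/4}` and `x/m` for completely multiplicative functions. -/
theorem exists_log_mul_sum_le : ∃ C : ℝ, 0 < C ∧ ∀ h : ℕ →*₀ ℝ, (∀ m, 0 ≤ h m) → (∀ m, h m ≤ 1) →
    ∀ x : ℝ, 1 ≤ x → Real.log x * ∑ m ∈ Finset.Ioc 0 ⌊x⌋₊, h m * (x / m) ^ (3 / 4 : ℝ) ≤
      C * x * ∑ m ∈ Finset.Ioc 0 ⌊x⌋₊, h m / m := by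
  obtain ⟨c, hc, hL⟩ := exists_sum_vonMangoldt_le
  refine ⟨4 + c, by positivity, fun h h0 h1 x hx => ?_⟩
  have e : Real.log x * ∑ m ∈ Finset.Ioc 0 ⌊x⌋₊, h m * (x / m) ^ (3 / 4 : ℝ) =
      ∑ m ∈ Finset.Ioc 0 ⌊x⌋₊, h m * (Real.log (x / m) * (x / m) ^ (3 / 4 : ℝ)) +
      ∑ m ∈ Finset.Ioc 0 ⌊x⌋₊, Real.log m * (h m * (x / m) ^ (3 / 4 : ℝ)) := by
    rw [Finset.mul_sum, ← Finset.sum_add_distrib]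
    refine Finset.sum_congr rfl fun m hm => ?_
    obtain ⟨hm0, hmx⟩ := le_of_mem_Ioc_floor hm
    rw [Real.log_div (by linarith) hm0.ne']
    ring
  have e1 : ∑ m ∈ Finset.Ioc 0 ⌊x⌋₊, h m * (Real.log (x / m) * (x / m) ^ (3 / 4 : ℝ)) ≤
      4 * x * ∑ m ∈ Finset.Ioc 0 ⌊x⌋₊, h m / m := by
    rw [Finset.mul_sum]
    refine Finset.sum_le_sum fun m hm => ?_
    obtain ⟨hm0, hmx⟩ := le_of_mem_Ioc_floor hm
    have hp : 0 < x / m := by positivity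
    have := Real.log_le_rpow_div hp.le (ε := 1 / 4) (by norm_num)
    calc h m * (Real.log (x / m) * (x / m) ^ (3 / 4 : ℝ))
        ≤ h m * ((x / m) ^ (1 / 4 : ℝ) / (1 / 4) * (x / m) ^ (3 / 4 : ℝ)) := by
          gcongr
          exact h0 m
      _ = h m * (4 * ((x / m) ^ (1 / 4 : ℝ) * (x / m) ^ (3 / 4 : ℝ))) := by ring
      _ = h m * (4 * (x / m)) := by
          rw [← Real.rpow_add hp]; norm_num
      _ = 4 * x * (h m / m) := by ring
  have e2 : ∑ m ∈ Finset.Ioc 0 ⌊x⌋₊, Real.log m * (h m * (x / m) ^ (3 / 4 : ℝ)) ≤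
      c * x * ∑ m ∈ Finset.Ioc 0 ⌊x⌋₊, h m / m := by
    have h2 := sum_conv ((ζ : ArithmeticFunction ℝ)) vonMangoldt
      (fun m => h m * (x / m) ^ (3 / 4 : ℝ)) ⌊x⌋₊
    rw [zeta_mul_vonMangoldt] at h2
    simp only [log_apply] at h2
    rw [h2, Finset.mul_sum]
    refine Finset.sum_le_sum fun d hd => ?_
    obtain ⟨hd0, hdx⟩ := le_of_mem_Ioc_floor hd
    have hd1 : d ≠ 0 := by rintro rfl; simp at hd0
    rw [natCoe_apply, zeta_apply_ne hd1, Nat.cast_one, one_mul, natCast_floor_div]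
    have := hL (x / d) (by positivity)
    calc ∑ k ∈ Finset.Ioc 0 ⌊x / d⌋₊, vonMangoldt k * (h (d * k) * (x / (d * k : ℕ)) ^ (3 / 4 : ℝ))
        ≤ ∑ k ∈ Finset.Ioc 0 ⌊x / d⌋₊, h d * (vonMangoldt k * (x / d / k) ^ (3 / 4 : ℝ)) := by
          refine Finset.sum_le_sum fun k hk => ?_
          obtain ⟨hk0, -⟩ := le_of_mem_Ioc_floor hk
          rw [map_mul, Nat.cast_mul, ← div_div]
          have : 0 ≤ vonMangoldt k * (x / d / k) ^ (3 / 4 : ℝ) :=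
            mul_nonneg vonMangoldt_nonneg (by positivity)
          calc vonMangoldt k * (h d * h k * (x / d / k) ^ (3 / 4 : ℝ))
              = h k * (h d * (vonMangoldt k * (x / d / k) ^ (3 / 4 : ℝ))) := by ring
            _ ≤ _ := mul_le_of_le_one_left (mul_nonneg (h0 d) this) (h1 k)
      _ ≤ h d * (c * (x / d)) := by
          rw [← Finset.mul_sum]
          exact mul_le_mul_of_nonneg_left this (h0 d)
      _ = c * x * (h d / d) := by ring
  rw [e]
  linarith

theorem inv_succ_le_log_sub {N : ℕ} (hN : 1 ≤ N) :
    ((N : ℝ) + 1)⁻¹ ≤ Real.log ((N + 1 : ℕ) : ℝ) - Real.log N ∧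
      Real.log ((N + 1 : ℕ) : ℝ) - Real.log N ≤ (N : ℝ)⁻¹ := by
  have h : (0 : ℝ) < N := by exact_mod_cast hN
  push_cast
  rw [← Real.log_div (by positivity) h.ne']
  have h1 := Real.one_sub_inv_le_log_of_pos (x := ((N : ℝ) + 1) / N) (by positivity)
  have h2 := Real.log_le_sub_one_of_pos (x := ((N : ℝ) + 1) / N) (by positivity)
  constructor
  · refine le_trans (le_of_eq ?_) h1
    field_simp; ring
  · refine h2.trans (le_of_eq ?_)
    field_simp; ring

theorem exists_limit_of_succ {u v : ℕ → ℝ} {N₀ : ℕ}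
    (h : ∀ N, N₀ ≤ N → |u (N + 1) - u N| ≤ v N - v (N + 1)) (hv0 : ∀ N, 0 ≤ v N)
    (hv : Tendsto v atTop (nhds 0)) : ∃ L, ∀ N, N₀ ≤ N → |u N - L| ≤ v N := by
  have key : ∀ M N, N₀ ≤ M → M ≤ N → |u N - u M| ≤ v M := fun M N hM hN => by
    have := abs_sub_le_of_succ (u := u) (w := fun N => - v N) (N₀ := N₀)
      (fun N hN => (h N hN).trans_eq (by ring)) hM hN
    have := hv0 N
    linarith
  have hc : CauchySeq u := by
    rw [Metric.cauchySeq_iff']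
    intro ε hε
    obtain ⟨N, hN1, hN2⟩ := ((hv.eventually_lt_const hε).and (eventually_ge_atTop N₀)).exists
    exact ⟨N, fun n hn => (key N n hN2 hn).trans_lt hN1⟩
  obtain ⟨L, hL⟩ := cauchySeq_tendsto_of_complete hc
  refine ⟨L, fun N hN => ?_⟩
  have h1 : Tendsto (fun M => |u N - u M|) atTop (nhds |u N - L|) := (tendsto_const_nhds.sub hL).abs
  refine le_of_tendsto h1 ?_
  filter_upwards [eventually_ge_atTop N] with M hM
  rw [abs_sub_comm]
  exact key N M hN hM

theorem cube_root_facts {N : ℕ} (hN : 1 ≤ N) : ∃ a : ℝ, 0 < a ∧ a ^ 3 = N ∧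
    (N : ℝ) ^ (2 / 3 : ℝ) = a ^ 2 ∧ (N : ℝ) ^ (-(1 / 3) : ℝ) = a⁻¹ := by
  have hN' : (0 : ℝ) < N := by exact_mod_cast hN
  refine ⟨(N : ℝ) ^ (1 / 3 : ℝ), by positivity, ?_, ?_, ?_⟩
  · rw [← Real.rpow_natCast, ← Real.rpow_mul hN'.le]; norm_num
  · rw [← Real.rpow_natCast, ← Real.rpow_mul hN'.le]; norm_num
  · rw [← Real.rpow_neg hN'.le]

theorem abs_sum_mul_log_le {a : ℕ → ℝ} {C : ℝ}
    (h : ∀ N, 1 ≤ N → |∑ k ∈ Finset.Ioc 0 N, a k| ≤ C * (N : ℝ) ^ (2 / 3 : ℝ)) {N : ℕ} (hN : 1 ≤ N) :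
    |∑ k ∈ Finset.Ioc 0 N, a k * Real.log k| ≤ 24 * C * (N : ℝ) ^ (3 / 4 : ℝ) := by
  have hC : 0 ≤ C := by
    have := h 1 le_rfl
    have h2 := abs_nonneg (∑ k ∈ Finset.Ioc 0 1, a k)
    simp only [Nat.cast_one, Real.one_rpow] at this
    linarith
  have h1 := abs_sub_le_of_succ (N₀ := 1) (M := 1) (N := N)
    (u := fun N : ℕ => ∑ k ∈ Finset.Ioc 0 N, a k * Real.log k -
      (∑ k ∈ Finset.Ioc 0 N, a k) * Real.log N)
    (w := fun N : ℕ => C * ((N : ℝ) ^ (2 / 3 : ℝ) * Real.log N)) ?_ le_rfl hN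
  · simp only [Nat.cast_one, Real.log_one, mul_zero, sub_zero] at h1
    rw [show ∑ k ∈ Finset.Ioc 0 1, a k * Real.log k = 0 by simp, sub_zero] at h1
    have hN' : (0 : ℝ) < N := by exact_mod_cast hN
    have hl : 0 ≤ Real.log N := Real.log_natCast_nonneg N
    have h2 := h N hN
    have h3 : |(∑ k ∈ Finset.Ioc 0 N, a k) * Real.log N| ≤
        C * (N : ℝ) ^ (2 / 3 : ℝ) * Real.log N := by
      rw [abs_mul, abs_of_nonneg hl]
      gcongr
    have h4 := abs_add_le (∑ k ∈ Finset.Ioc 0 N, a k * Real.log k -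
      (∑ k ∈ Finset.Ioc 0 N, a k) * Real.log N) ((∑ k ∈ Finset.Ioc 0 N, a k) * Real.log N)
    rw [sub_add_cancel] at h4
    have h5 : (N : ℝ) ^ (2 / 3 : ℝ) * Real.log N ≤ 12 * (N : ℝ) ^ (3 / 4 : ℝ) := by
      have := Real.log_le_rpow_div hN'.le (ε := 1 / 12) (by norm_num)
      calc (N : ℝ) ^ (2 / 3 : ℝ) * Real.log N
          ≤ (N : ℝ) ^ (2 / 3 : ℝ) * ((N : ℝ) ^ (1 / 12 : ℝ) / (1 / 12)) := by gcongr
        _ = 12 * ((N : ℝ) ^ (2 / 3 : ℝ) * (N : ℝ) ^ (1 / 12 : ℝ)) := by ring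
        _ = 12 * (N : ℝ) ^ (3 / 4 : ℝ) := by
          rw [← Real.rpow_add hN']; norm_num
    have h6 := mul_le_mul_of_nonneg_left h5 hC
    linarith
  · intro n hn
    rw [abel_succ, abs_mul, abs_sub_comm]
    have hn' : (0 : ℝ) < n := by exact_mod_cast hn
    have h2 := (inv_succ_le_log_sub hn).1
    have h3 : 0 ≤ Real.log ((n + 1 : ℕ) : ℝ) - Real.log n := le_trans (by positivity) h2
    rw [abs_of_nonneg h3]
    refine (mul_le_mul_of_nonneg_right (h n hn) h3).trans ?_
    rw [mul_assoc, ← mul_sub]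
    refine mul_le_mul_of_nonneg_left ?_ hC
    rw [mul_sub]
    have h4 : (n : ℝ) ^ (2 / 3 : ℝ) ≤ ((n + 1 : ℕ) : ℝ) ^ (2 / 3 : ℝ) :=
      Real.rpow_le_rpow hn'.le (by push_cast; linarith) (by norm_num)
    have := mul_le_mul_of_nonneg_right h4 (Real.log_natCast_nonneg (n + 1))
    linarith

theorem exists_sum_div_limit {a : ℕ → ℝ} {C : ℝ}
    (h : ∀ N, 1 ≤ N → |∑ k ∈ Finset.Ioc 0 N, a k| ≤ C * (N : ℝ) ^ (2 / 3 : ℝ)) :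
    ∃ c₀ : ℝ, ∀ N : ℕ, 1 ≤ N →
      |∑ k ∈ Finset.Ioc 0 N, a k / k - c₀| ≤ 4 * C * (N : ℝ) ^ (-(1 / 3) : ℝ) := by
  have hC : 0 ≤ C := by
    have := h 1 le_rfl
    have h2 := abs_nonneg (∑ k ∈ Finset.Ioc 0 1, a k)
    simp only [Nat.cast_one, Real.one_rpow] at this
    linarith
  have hlim : ∃ L, ∀ N : ℕ, 1 ≤ N → |∑ k ∈ Finset.Ioc 0 N, a k * (k : ℝ)⁻¹ -
      (∑ k ∈ Finset.Ioc 0 N, a k) * (N : ℝ)⁻¹ - L| ≤ 3 * C * (N : ℝ) ^ (-(1 / 3) : ℝ) := by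
    refine exists_limit_of_succ (N₀ := 1)
      (u := fun N : ℕ => ∑ k ∈ Finset.Ioc 0 N, a k * (k : ℝ)⁻¹ -
        (∑ k ∈ Finset.Ioc 0 N, a k) * (N : ℝ)⁻¹)
      (v := fun N : ℕ => 3 * C * (N : ℝ) ^ (-(1 / 3) : ℝ)) ?_ (fun N => by positivity) ?_
    · intro n hn
      rw [abel_succ, abs_mul]
      obtain ⟨b, hb, e1, e2, e3⟩ := cube_root_facts hn
      obtain ⟨d, hd, e1', e2', e3'⟩ := cube_root_facts (N := n + 1) (by omega)
      have h2 := h n hn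
      rw [e2] at h2
      rw [e3, e3', ← e1, ← e1']
      have hbd : b ≤ d := by
        refine le_of_pow_le_pow_left₀ (n := 3) (by norm_num) hd.le ?_
        rw [e1, e1']; push_cast; linarith
      have e4 : d ^ 3 = b ^ 3 + 1 := by rw [e1, e1']; push_cast; ring
      have h5 : (d ^ 3)⁻¹ ≤ (b ^ 3)⁻¹ := by gcongr
      rw [abs_of_nonneg (a := (b ^ 3)⁻¹ - (d ^ 3)⁻¹) (by linarith)]
      refine (mul_le_mul_of_nonneg_right h2 (by linarith)).trans ?_
      rw [← mul_sub, mul_assoc, mul_comm 3 C, mul_assoc]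
      refine mul_le_mul_of_nonneg_left ?_ hC
      rw [show b ^ 2 * ((b ^ 3)⁻¹ - (d ^ 3)⁻¹) = b⁻¹ - b ^ 2 / d ^ 3 by field_simp]
      have : 3 * d⁻¹ ≤ 2 * b⁻¹ + b ^ 2 / d ^ 3 := by
        rw [show 3 * d⁻¹ = 3 * b * d ^ 2 / (b * d ^ 3) by field_simp,
          show 2 * b⁻¹ + b ^ 2 / d ^ 3 = (2 * d ^ 3 + b ^ 3) / (b * d ^ 3) by field_simp]
        gcongr
        nlinarith [mul_nonneg (sq_nonneg (d - b)) (by positivity : 0 ≤ 2 * d + b)]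
      linarith
    · have := (tendsto_rpow_neg_atTop (y := 1 / 3) (by norm_num)).comp
        (tendsto_natCast_atTop_atTop (R := ℝ))
      simpa using this.const_mul (3 * C)
  obtain ⟨L, hL⟩ := hlim
  refine ⟨L, fun N hN => ?_⟩
  have h1 := hL N hN
  have h2 := h N hN
  obtain ⟨b, hb, e1, e2, e3⟩ := cube_root_facts hN
  have h3 : |(∑ k ∈ Finset.Ioc 0 N, a k) * (N : ℝ)⁻¹| ≤ C * (N : ℝ) ^ (-(1 / 3) : ℝ) := by
    rw [abs_mul, abs_of_nonneg (a := (N : ℝ)⁻¹) (by positivity), e3]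
    rw [e2] at h2
    refine (mul_le_mul_of_nonneg_right h2 (by positivity)).trans_eq ?_
    rw [← e1]
    field_simp
  have h4 := abs_add_le (∑ k ∈ Finset.Ioc 0 N, a k * (k : ℝ)⁻¹ -
    (∑ k ∈ Finset.Ioc 0 N, a k) * (N : ℝ)⁻¹ - L) ((∑ k ∈ Finset.Ioc 0 N, a k) * (N : ℝ)⁻¹)
  rw [show ∑ k ∈ Finset.Ioc 0 N, a k * (k : ℝ)⁻¹ -
    (∑ k ∈ Finset.Ioc 0 N, a k) * (N : ℝ)⁻¹ - L + (∑ k ∈ Finset.Ioc 0 N, a k) * (N : ℝ)⁻¹ =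
    ∑ k ∈ Finset.Ioc 0 N, a k * (k : ℝ)⁻¹ - L by ring] at h4
  simp only [div_eq_mul_inv (a _)]
  linarith

end Abel
end Bernays

namespace Bernays
open ArithmeticFunction ArithmeticFunction.Moebius ArithmeticFunction.zeta

section Weighted

theorem abs_sum_log_sub_le {N : ℕ} (hN : 1 ≤ N) :
    |∑ k ∈ Finset.Ioc 0 N, Real.log k - (N * Real.log N - N) - 1| ≤ Real.log N := by
  have h1 := abs_sub_le_of_succ (N₀ := 1) (M := 1) (N := N)
    (u := fun N : ℕ => ∑ k ∈ Finset.Ioc 0 N, Real.log k - (N * Real.log N - N))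
    (w := fun N : ℕ => Real.log N) ?_ le_rfl hN
  · simpa using h1
  · intro n hn
    rw [sum_Ioc_succ]
    obtain ⟨h2, h3⟩ := inv_succ_le_log_sub hn
    have hn' : (0 : ℝ) < n := by exact_mod_cast hn
    set l := Real.log ((n + 1 : ℕ) : ℝ)
    push_cast
    have e : ∑ k ∈ Finset.Ioc 0 n, Real.log k + l - (((n : ℝ) + 1) * l - (n + 1)) -
      (∑ k ∈ Finset.Ioc 0 n, Real.log k - (n * Real.log n - n)) = 1 - n * (l - Real.log n) := by
      ring
    rw [e]
    have h4 : n * (l - Real.log n) ≤ 1 := by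
      have := mul_le_mul_of_nonneg_left h3 hn'.le
      rwa [mul_inv_cancel₀ hn'.ne'] at this
    rw [abs_of_nonneg (by linarith)]
    have h5 := mul_le_mul_of_nonneg_left h2 (by positivity : (0 : ℝ) ≤ n + 1)
    rw [mul_inv_cancel₀ (by positivity)] at h5
    linarith

theorem exists_harmonic_limit : ∃ γ : ℝ, ∀ N : ℕ, 1 ≤ N →
    |∑ k ∈ Finset.Ioc 0 N, ((k : ℝ))⁻¹ - Real.log N - γ| ≤ (N : ℝ)⁻¹ := by
  refine exists_limit_of_succ (N₀ := 1) (u := fun N : ℕ => ∑ k ∈ Finset.Ioc 0 N, (k : ℝ)⁻¹ - Real.log N)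
    (v := fun N : ℕ => (N : ℝ)⁻¹) ?_ (fun N => by positivity) tendsto_inv_atTop_nhds_zero_nat
  intro n hn
  rw [sum_Ioc_succ]
  obtain ⟨h2, h3⟩ := inv_succ_le_log_sub hn
  push_cast at *
  rw [abs_le]
  constructor <;> linarith

theorem abs_sum_mul_log_le_real {a : ℕ → ℝ} {C : ℝ}
    (h : ∀ N, 1 ≤ N → |∑ k ∈ Finset.Ioc 0 N, a k| ≤ C * (N : ℝ) ^ (2 / 3 : ℝ)) {y : ℝ} (hy : 1 ≤ y) :
    |∑ k ∈ Finset.Ioc 0 ⌊y⌋₊, a k * Real.log k| ≤ 24 * C * y ^ (3 / 4 : ℝ) := by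
  have hN : 1 ≤ ⌊y⌋₊ := Nat.le_floor (by simpa using hy)
  have hC : 0 ≤ C := by
    have := h 1 le_rfl
    have h2 := abs_nonneg (∑ k ∈ Finset.Ioc 0 1, a k)
    simp only [Nat.cast_one, Real.one_rpow] at this
    linarith
  refine (abs_sum_mul_log_le h hN).trans ?_
  gcongr
  exact Nat.floor_le (by linarith)

theorem exists_weighted_bound {R : ℕ → ℝ} {K C : ℝ} (hK : 0 < K)
    (h : ∀ N : ℕ, 1 ≤ N → |∑ k ∈ Finset.Ioc 0 N, R k - K * N| ≤ C * (N : ℝ) ^ (2 / 3 : ℝ)) :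
    ∃ l C' : ℝ, ∀ y : ℝ, 1 ≤ y →
      |∑ k ∈ Finset.Ioc 0 ⌊y⌋₊, R k * (Real.log k - y / k + l)| ≤ C' * y ^ (3 / 4 : ℝ) := by
  have hC : 0 ≤ C := by
    have := h 1 le_rfl
    have h2 := abs_nonneg (∑ k ∈ Finset.Ioc 0 1, R k - K * (1 : ℕ))
    simp only [Nat.cast_one, Real.one_rpow] at this h2
    linarith
  have ha : ∀ N : ℕ, 1 ≤ N → |∑ k ∈ Finset.Ioc 0 N, (R k - K)| ≤ C * (N : ℝ) ^ (2 / 3 : ℝ) :=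
    fun N hN => by
      convert h N hN using 3
      rw [Finset.sum_sub_distrib]
      simp [mul_comm]
  obtain ⟨c₀, hc₀⟩ := exists_sum_div_limit ha
  obtain ⟨γ, hγ⟩ := exists_harmonic_limit
  set l := 1 + γ + c₀ / K with hl
  refine ⟨l, 24 * C + K * 3 + 8 * C + 2 * K + |l| * C + |c₀ + K * γ| + K * 2, fun y hy => ?_⟩
  have hN : 1 ≤ ⌊y⌋₊ := Nat.le_floor (by simpa using hy)
  have hNy : (⌊y⌋₊ : ℝ) ≤ y := Nat.floor_le (by linarith)
  have hyN : y < ⌊y⌋₊ + 1 := Nat.lt_floor_add_one y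
  have b1 := abs_sum_mul_log_le_real ha hy
  have b2 := hc₀ _ hN
  have b3 := hγ _ hN
  have b4 := abs_sum_log_sub_le hN
  have b5 := h _ hN
  set N := ⌊y⌋₊
  have hN' : (1 : ℝ) ≤ N := by exact_mod_cast hN
  set Q := y ^ (3 / 4 : ℝ) with hQ
  have hQ1 : 1 ≤ Q := Real.one_le_rpow hy (by norm_num)
  have q1 : Real.log N ≤ 2 * Q := by
    have h1 := Real.log_le_rpow_div (x := y) (by linarith) (ε := 3 / 4) (by norm_num)
    have h2 := Real.log_le_log (by linarith) hNy
    rw [← hQ] at h1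
    linarith
  have q0 : 0 ≤ Real.log N := Real.log_nonneg hN'
  have q2 : (N : ℝ) ^ (2 / 3 : ℝ) ≤ Q :=
    (Real.rpow_le_rpow (by positivity) hNy (by norm_num)).trans
      (Real.rpow_le_rpow_of_exponent_le hy (by norm_num))
  have q3 : y * (N : ℝ) ^ (-(1 / 3) : ℝ) ≤ 2 * Q := by
    have : (N : ℝ) * (N : ℝ) ^ (-(1 / 3) : ℝ) = (N : ℝ) ^ (2 / 3 : ℝ) := by
      conv_lhs => rw [← Real.rpow_one_add' (by positivity) (by norm_num)]
      norm_num
    calc y * (N : ℝ) ^ (-(1 / 3) : ℝ) ≤ (2 * N) * (N : ℝ) ^ (-(1 / 3) : ℝ) := by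
          gcongr; linarith
      _ = 2 * ((N : ℝ) * (N : ℝ) ^ (-(1 / 3) : ℝ)) := by ring
      _ ≤ 2 * Q := by rw [this]; linarith
  have q4 : y * (N : ℝ)⁻¹ ≤ 2 * Q := by
    rw [← div_eq_mul_inv, div_le_iff₀ (by linarith)]
    nlinarith
  have e : ∑ k ∈ Finset.Ioc 0 N, R k * (Real.log k - y / k + l) =
      ∑ k ∈ Finset.Ioc 0 N, (R k - K) * Real.log k +
      K * (∑ k ∈ Finset.Ioc 0 N, Real.log k - (N * Real.log N - N) - 1) + K -
      y * (∑ k ∈ Finset.Ioc 0 N, (R k - K) / k - c₀) -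
      y * K * (∑ k ∈ Finset.Ioc 0 N, ((k : ℝ))⁻¹ - Real.log N - γ) +
      l * (∑ k ∈ Finset.Ioc 0 N, R k - K * N) +
      ((N : ℝ) - y) * (c₀ + K * γ) + K * ((N : ℝ) - y) * Real.log N := by
    have e1 : ∑ k ∈ Finset.Ioc 0 N, R k * (Real.log k - y / k + l) =
        ∑ k ∈ Finset.Ioc 0 N, (R k - K) * Real.log k + K * ∑ k ∈ Finset.Ioc 0 N, Real.log k -
        y * (∑ k ∈ Finset.Ioc 0 N, (R k - K) / k) - y * K * ∑ k ∈ Finset.Ioc 0 N, ((k : ℝ))⁻¹ +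
        l * ∑ k ∈ Finset.Ioc 0 N, R k := by
      simp only [Finset.mul_sum, ← Finset.sum_add_distrib, ← Finset.sum_sub_distrib]
      refine Finset.sum_congr rfl fun k _ => ?_
      ring
    rw [e1]
    have : l * K = K + K * γ + c₀ := by rw [hl]; field_simp
    clear_value l
    linear_combination (N : ℝ) * this
  rw [e]
  have B2 : |K * (∑ k ∈ Finset.Ioc 0 N, Real.log k - (N * Real.log N - N) - 1)| ≤ K * (2 * Q) := by
    rw [abs_mul, abs_of_pos hK]
    gcongr
    linarith
  have B3 : |y * (∑ k ∈ Finset.Ioc 0 N, (R k - K) / k - c₀)| ≤ 8 * C * Q := by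
    rw [abs_mul, abs_of_pos (by linarith)]
    have := mul_le_mul_of_nonneg_left b2 (by linarith : 0 ≤ y)
    have := mul_le_mul_of_nonneg_left q3 hC
    linarith
  have B4 : |y * K * (∑ k ∈ Finset.Ioc 0 N, ((k : ℝ))⁻¹ - Real.log N - γ)| ≤ 2 * K * Q := by
    rw [abs_mul, abs_of_pos (by positivity)]
    have := mul_le_mul_of_nonneg_left b3 (by positivity : 0 ≤ y * K)
    have := mul_le_mul_of_nonneg_left q4 hK.le
    linarith
  have B5 : |l * (∑ k ∈ Finset.Ioc 0 N, R k - K * N)| ≤ |l| * C * Q := by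
    rw [abs_mul, mul_assoc]
    gcongr
    exact b5.trans (by gcongr)
  have hd : |(N : ℝ) - y| ≤ 1 := by rw [abs_le]; constructor <;> linarith
  have B6 : |((N : ℝ) - y) * (c₀ + K * γ)| ≤ |c₀ + K * γ| * Q := by
    rw [abs_mul, mul_comm]
    gcongr
    linarith
  have B7 : |K * ((N : ℝ) - y) * Real.log N| ≤ K * (2 * Q) := by
    rw [abs_mul, abs_mul, abs_of_pos hK, abs_of_nonneg q0]
    calc K * |(N : ℝ) - y| * Real.log N ≤ K * 1 * (2 * Q) := by gcongr
      _ = _ := by ring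
  have hKQ : K ≤ K * Q := le_mul_of_one_le_right hK.le hQ1
  rw [abs_le] at *
  constructor <;> linarith [b1.1, b1.2, B2.1, B2.2, B3.1, B3.2, B4.1, B4.2, B5.1, B5.2, B6.1, B6.2,
    B7.1, B7.2]

end Weighted
end Bernays

namespace Bernays
open ArithmeticFunction ArithmeticFunction.Moebius ArithmeticFunction.zeta

section CharSums

variable {G : Type*} [CommGroup G] [Finite G] {S : ℕ → Prop} {c : ℕ → G}
  {𝕜 : Type*} [RCLike 𝕜]

/-- The completely multiplicative function attached to a character of the group. -/
noncomputable def cmc (S : ℕ → Prop) (c : ℕ → G) (χ : G →* 𝕜) : ℕ →*₀ 𝕜 := cm S fun p => χ (c p)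

theorem AllP.cmc_eq (χ : G →* 𝕜) {m : ℕ} (h : AllP S m) : cmc S c χ m = χ (pext c m) := by
  rw [cmc, h.cm_eq, map_pext]

theorem cmc_eq_zero (χ : G →* 𝕜) {m : ℕ} (h : ¬ AllP S m) : cmc S c χ m = 0 := cm_eq_zero _ h

theorem norm_char_eq (χ : G →* 𝕜) (g : G) : ‖χ g‖ = 1 := by
  have h : (χ g) ^ Nat.card G = 1 := by rw [← map_pow, pow_card_eq_one', map_one]
  have h2 : ‖χ g‖ ^ Nat.card G = 1 := by rw [← norm_pow, h, norm_one]
  exact (pow_eq_one_iff_of_nonneg (_root_.norm_nonneg _) Nat.card_pos.ne').1 h2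

theorem norm_cmc_le (χ : G →* 𝕜) (m : ℕ) : ‖cmc S c χ m‖ ≤ 1 := by
  by_cases h : AllP S m
  · rw [h.cmc_eq, norm_char_eq]
  · rw [cmc_eq_zero χ h, norm_zero]; exact zero_le_one

/-- The convolution of a character function with its conjugate. -/
noncomputable def cconv (S : ℕ → Prop) (c : ℕ → G) (χ : G →* 𝕜) : ArithmeticFunction 𝕜 :=
  af (cmc S c χ) * af (cmc S c (χ.comp invMonoidHom))

theorem sum_cconv [Fintype G] (χ : G →* 𝕜) (N : ℕ) :
    ∑ m ∈ Finset.Ioc 0 N, cconv S c χ m = ∑ g, χ g * ((prs S c g N).ncard : 𝕜) := by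
  classical
  have h1 := sum_conv_filter (af (cmc S c χ)) (af (cmc S c (χ.comp invMonoidHom))) (fun _ => 1) N
  simp only [mul_one] at h1
  rw [cconv, h1]
  set A := (Finset.Ioc 0 N ×ˢ Finset.Ioc 0 N).filter (fun x => x.1 * x.2 ≤ N)
  have h2 : ∀ g, ((prs S c g N).ncard : 𝕜) =
      ∑ x ∈ A, if (AllP S x.1 ∧ AllP S x.2) ∧ pext c x.1 * (pext c x.2)⁻¹ = g then (1 : 𝕜) else 0 := by
    intro g
    rw [Finset.sum_boole]
    congr 1
    rw [← Set.ncard_coe_finset]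
    congr 1
    ext ⟨a, b⟩
    simp only [prs, Set.mem_ofPred_eq, Finset.coe_filter, A, Finset.mem_filter, Finset.mem_product,
      Finset.mem_Ioc]
    constructor
    · rintro ⟨ha, hb, h, hg⟩
      have h' : a * b ≤ N := by exact_mod_cast h
      have ha0 := Nat.pos_of_ne_zero ha.1
      have hb0 := Nat.pos_of_ne_zero hb.1
      exact ⟨⟨⟨⟨ha0, (Nat.le_mul_of_pos_right a hb0).trans h'⟩, hb0,
        (Nat.le_mul_of_pos_left b ha0).trans h'⟩, h'⟩, ⟨ha, hb⟩, hg⟩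
    · rintro ⟨⟨-, h⟩, ⟨ha, hb⟩, hg⟩
      exact ⟨ha, hb, by exact_mod_cast h, hg⟩
  simp_rw [h2, Finset.mul_sum]
  rw [Finset.sum_comm]
  refine Finset.sum_congr rfl fun x _ => ?_
  by_cases hx : AllP S x.1 ∧ AllP S x.2
  · simp only [hx, true_and, mul_ite, mul_one, mul_zero, and_self, Finset.sum_ite_eq,
      Finset.mem_univ, if_true]
    rw [af_apply, af_apply, hx.1.cmc_eq, hx.2.cmc_eq, map_mul]
    rfl
  · simp only [hx, false_and, if_false, mul_zero, Finset.sum_const_zero]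
    rw [not_and_or] at hx
    rcases hx with hx | hx
    · rw [af_apply, cmc_eq_zero _ hx, zero_mul]
    · rw [af_apply, af_apply, cmc_eq_zero _ hx, mul_zero]

theorem norm_sum_cconv_sub_le [Fintype G] {K C : ℝ}
    (hT : ∀ (g : G) (x : ℝ), 0 < x → |((prs S c g x).ncard : ℝ) - K * x| ≤ C * x ^ (2 / 3 : ℝ))
    (χ : G →* 𝕜) (N : ℕ) (hN : 1 ≤ N) :
    ‖∑ m ∈ Finset.Ioc 0 N, cconv S c χ m - (∑ g, χ g) * ((K * N : ℝ) : 𝕜)‖ ≤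
      Nat.card G * C * (N : ℝ) ^ (2 / 3 : ℝ) := by
  rw [sum_cconv, Finset.sum_mul, ← Finset.sum_sub_distrib]
  refine (norm_sum_le _ _).trans ?_
  rw [mul_assoc, Nat.card_eq_fintype_card, ← Finset.card_univ, ← nsmul_eq_mul]
  refine Finset.sum_le_card_nsmul _ _ _ fun g _ => ?_
  rw [← mul_sub, norm_mul, norm_char_eq, one_mul, ← RCLike.ofReal_natCast, ← RCLike.ofReal_sub,
    RCLike.norm_ofReal]
  exact hT g N (by exact_mod_cast hN)

end CharSums

section Dirichlet

theorem norm_sub_le_of_succ {E : Type*} [SeminormedAddCommGroup E] {u : ℕ → E} {w : ℕ → ℝ} {N₀ : ℕ}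
    (h : ∀ N, N₀ ≤ N → ‖u (N + 1) - u N‖ ≤ w (N + 1) - w N) {M N : ℕ} (hM : N₀ ≤ M) (hN : M ≤ N) :
    ‖u N - u M‖ ≤ w N - w M := by
  induction N, hN using Nat.le_induction with
  | base => simp
  | succ N hN ih =>
    have := norm_sub_le_norm_sub_add_norm_sub (u (N + 1)) (u N) (u M)
    have := h N (hM.trans hN)
    linarith

theorem rpow_neg_sub_le {σ : ℝ} (h1 : 1 ≤ σ) (h2 : σ ≤ 2) {n : ℕ} (hn : 1 ≤ n) :
    (n : ℝ) ^ (-σ) - ((n + 1 : ℕ) : ℝ) ^ (-σ) ≤ 2 * ((n : ℝ) ^ 2)⁻¹ := by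
  have hn0 : (0 : ℝ) < n := by exact_mod_cast hn
  have hn1 : (1 : ℝ) ≤ n := by exact_mod_cast hn
  have e : ((n + 1 : ℕ) : ℝ) ^ (-σ) =
      (n : ℝ) ^ (-σ) * Real.exp (-σ * (Real.log ((n + 1 : ℕ) : ℝ) - Real.log n)) := by
    rw [Real.rpow_def_of_pos (by positivity), Real.rpow_def_of_pos hn0, ← Real.exp_add]
    congr 1; ring
  have h3 := Real.add_one_le_exp (-σ * (Real.log ((n + 1 : ℕ) : ℝ) - Real.log n))
  have h4 := (inv_succ_le_log_sub hn).2
  have h5 : 1 - 2 * (n : ℝ)⁻¹ ≤ Real.exp (-σ * (Real.log ((n + 1 : ℕ) : ℝ) - Real.log n)) := by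
    refine le_trans ?_ h3
    have := mul_le_mul_of_nonneg_left h4 (by linarith : 0 ≤ σ)
    have := mul_le_mul_of_nonneg_right h2 (by positivity : 0 ≤ (n : ℝ)⁻¹)
    linarith
  have h6 : (n : ℝ) ^ (-σ) ≤ (n : ℝ)⁻¹ := by
    rw [← Real.rpow_neg_one]
    exact Real.rpow_le_rpow_of_exponent_le hn1 (by linarith)
  have h7 : 0 ≤ (n : ℝ) ^ (-σ) := by positivity
  rw [e]
  calc (n : ℝ) ^ (-σ) - (n : ℝ) ^ (-σ) * Real.exp (-σ * (Real.log ((n + 1 : ℕ) : ℝ) - Real.log n))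
      ≤ (n : ℝ) ^ (-σ) - (n : ℝ) ^ (-σ) * (1 - 2 * (n : ℝ)⁻¹) := by gcongr
    _ = (n : ℝ) ^ (-σ) * (2 * (n : ℝ)⁻¹) := by ring
    _ ≤ (n : ℝ)⁻¹ * (2 * (n : ℝ)⁻¹) := by gcongr
    _ = _ := by field_simp

theorem sum_rpow_neg_le {σ : ℝ} (h1 : 1 < σ) (N : ℕ) :
    ∑ n ∈ Finset.Ioc 0 N, (n : ℝ) ^ (-σ) ≤ 1 + (σ - 1)⁻¹ := by
  rcases Nat.eq_zero_or_pos N with rfl | hN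
  · simp; have : 0 < σ - 1 := by linarith
    positivity
  set s := σ - 1 with hs
  have hs0 : 0 < s := by linarith
  have h := abs_sub_le_of_succ (N₀ := 1) (M := 1) (N := N)
    (u := fun N : ℕ => ∑ n ∈ Finset.Ioc 0 N, (n : ℝ) ^ (-σ))
    (w := fun N : ℕ => - (s⁻¹ * (N : ℝ) ^ (-s))) ?_ le_rfl hN
  · have h2 := (abs_le.1 h).2
    simp only [Nat.cast_one, Real.one_rpow, mul_one, zero_add, Finset.sum_Ioc_succ_top (le_refl 0),
      Finset.Ioc_self, Finset.sum_empty] at h2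
    have : 0 ≤ s⁻¹ * (N : ℝ) ^ (-s) := by positivity
    simp at h2
    linarith
  · intro n hn
    have hn0 : (0 : ℝ) < n := by exact_mod_cast hn
    rw [sum_Ioc_succ, add_sub_cancel_left, abs_of_nonneg (by positivity)]
    have e : (n : ℝ) ^ (-s) = ((n + 1 : ℕ) : ℝ) ^ (-s) *
        Real.exp (s * (Real.log ((n + 1 : ℕ) : ℝ) - Real.log n)) := by
      rw [Real.rpow_def_of_pos (by positivity), Real.rpow_def_of_pos (by positivity), ← Real.exp_add]
      congr 1; ring
    have h3 := Real.add_one_le_exp (s * (Real.log ((n + 1 : ℕ) : ℝ) - Real.log n))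
    have h4 := (inv_succ_le_log_sub hn).1
    have e2 : ((n + 1 : ℕ) : ℝ) ^ (-σ) = ((n + 1 : ℕ) : ℝ) ^ (-s) * ((n : ℝ) + 1)⁻¹ := by
      rw [show -σ = -s + (-1) by rw [hs]; ring, Real.rpow_add (by positivity), Real.rpow_neg_one]
      push_cast; rfl
    rw [e2, e]
    set q := ((n + 1 : ℕ) : ℝ) ^ (-s)
    have hq : 0 ≤ q := by positivity
    have h5 : s * ((n : ℝ) + 1)⁻¹ ≤ Real.exp (s * (Real.log ((n + 1 : ℕ) : ℝ) - Real.log n)) - 1 := by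
      have := mul_le_mul_of_nonneg_left h4 hs0.le
      linarith
    have h6 : ((n : ℝ) + 1)⁻¹ ≤ s⁻¹ * (Real.exp (s * (Real.log ((n + 1 : ℕ) : ℝ) - Real.log n)) - 1) := by
      rw [inv_mul_eq_div, le_div_iff₀ hs0]; linarith
    have := mul_le_mul_of_nonneg_left h6 hq
    linarith

theorem norm_sum_mul_rpow_le {a : ℕ → ℂ} {K C : ℝ} (hK : 0 ≤ K)
    (h : ∀ N : ℕ, 1 ≤ N → ‖∑ k ∈ Finset.Ioc 0 N, a k‖ ≤ K * N + C * (N : ℝ) ^ (2 / 3 : ℝ))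
    (hC : 0 ≤ C) {σ : ℝ} (h1 : 1 < σ) (h2 : σ ≤ 2) (N : ℕ) :
    ‖∑ k ∈ Finset.Ioc 0 N, a k * (((k : ℝ) ^ (-σ) : ℝ) : ℂ)‖ ≤
      K * (1 + (σ - 1)⁻¹) + C * (1 + 2 * ∑' n : ℕ, (n : ℝ) ^ (-(4 / 3) : ℝ)) := by
  have hs43 : Summable (fun q : ℕ => (q : ℝ) ^ (-(4 / 3) : ℝ)) :=
    Real.summable_nat_rpow.2 (by norm_num)
  have hts : 0 ≤ ∑' n : ℕ, (n : ℝ) ^ (-(4 / 3) : ℝ) := tsum_nonneg fun n => by positivity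
  have hinv : 0 < (σ - 1)⁻¹ := inv_pos.2 (by linarith)
  rcases Nat.eq_zero_or_pos N with rfl | hN
  · simp only [Finset.Ioc_self, Finset.sum_empty, norm_zero]; positivity
  have hm : ∀ n : ℕ, 1 ≤ n → ((n + 1 : ℕ) : ℝ) ^ (-σ) ≤ (n : ℝ) ^ (-σ) := fun n hn => by
    have hn0 : (0 : ℝ) < n := by exact_mod_cast hn
    exact Real.rpow_le_rpow_of_nonpos hn0 (by push_cast; linarith) (by linarith)
  set f : ℕ → ℝ := fun n => (n : ℝ) ^ (-σ) with hf
  have hf0 : ∀ n, 0 ≤ f n := fun n => by positivity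
  set P : ℕ → ℂ := fun N => ∑ k ∈ Finset.Ioc 0 N, a k with hP
  have key := norm_sub_le_of_succ (N₀ := 1) (M := 1) (N := N)
    (u := fun N : ℕ => ∑ k ∈ Finset.Ioc 0 N, a k * (f k : ℂ) - P N * (f N : ℂ))
    (w := fun N : ℕ => K * (∑ n ∈ Finset.Ioc 0 N, f n - N * f N) +
      2 * C * ∑ n ∈ Finset.range N, (n : ℝ) ^ (-(4 / 3) : ℝ)) ?_ le_rfl hN
  · have e1 : ∑ k ∈ Finset.Ioc 0 1, a k * (f k : ℂ) - P 1 * (f 1 : ℂ) = 0 := by simp [hP]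
    have e2 : ∑ n ∈ Finset.Ioc 0 1, f n - (1 : ℕ) * f 1 = 0 := by simp
    have e3 : ∑ n ∈ Finset.range 1, (n : ℝ) ^ (-(4 / 3) : ℝ) = 0 := by
      rw [Finset.sum_range_one, Nat.cast_zero, Real.zero_rpow (by norm_num)]
    simp only [e1, e2, e3, sub_zero, mul_zero, add_zero] at key
    have k1 : ∑ n ∈ Finset.range N, (n : ℝ) ^ (-(4 / 3) : ℝ) ≤ ∑' n : ℕ, (n : ℝ) ^ (-(4 / 3) : ℝ) :=
      hs43.sum_le_tsum _ fun n _ => by positivity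
    have k2 := sum_rpow_neg_le h1 N
    have k3 : ‖P N * (f N : ℂ)‖ ≤ K * (N * f N) + C := by
      rw [norm_mul, Complex.norm_real, Real.norm_of_nonneg (hf0 N)]
      refine (mul_le_mul_of_nonneg_right (h N hN) (hf0 N)).trans ?_
      have hN1 : (1 : ℝ) ≤ N := by exact_mod_cast hN
      have : (N : ℝ) ^ (2 / 3 : ℝ) * f N ≤ 1 := by
        rw [hf]
        simp only
        rw [← Real.rpow_add (by linarith)]
        exact Real.rpow_le_one_of_one_le_of_nonpos hN1 (by linarith)
      have := mul_le_mul_of_nonneg_left this hC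
      linarith
    have k4 := norm_add_le (∑ k ∈ Finset.Ioc 0 N, a k * (f k : ℂ) - P N * (f N : ℂ)) (P N * (f N : ℂ))
    rw [sub_add_cancel] at k4
    have k5 := mul_le_mul_of_nonneg_left k2 hK
    have k6 := mul_le_mul_of_nonneg_left k1 hC
    linarith
  · intro n hn
    have hn0 : (0 : ℝ) < n := by exact_mod_cast hn
    have e1 : (∑ k ∈ Finset.Ioc 0 (n + 1), a k * (f k : ℂ) - P (n + 1) * (f (n + 1) : ℂ)) -
        (∑ k ∈ Finset.Ioc 0 n, a k * (f k : ℂ) - P n * (f n : ℂ)) =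
        P n * ((f n - f (n + 1) : ℝ) : ℂ) := by
      simp only [hP]
      rw [Finset.sum_Ioc_succ_top (Nat.zero_le n), Finset.sum_Ioc_succ_top (Nat.zero_le n)]
      push_cast; ring
    have hd : 0 ≤ f n - f (n + 1) := sub_nonneg.2 (hm n hn)
    have hd2 : f n - f (n + 1) ≤ 2 * ((n : ℝ) ^ 2)⁻¹ := rpow_neg_sub_le h1.le h2 hn
    simp only [e1, norm_mul, Complex.norm_real, Real.norm_of_nonneg hd]
    refine (mul_le_mul_of_nonneg_right (h n hn) hd).trans ?_
    rw [sum_Ioc_succ, Finset.sum_range_succ]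
    have e2 : (n : ℝ) ^ (2 / 3 : ℝ) * ((n : ℝ) ^ 2)⁻¹ = (n : ℝ) ^ (-(4 / 3) : ℝ) := by
      rw [← Real.rpow_natCast, ← Real.rpow_neg hn0.le, ← Real.rpow_add hn0]; norm_num
    have k1 : (n : ℝ) ^ (2 / 3 : ℝ) * (f n - f (n + 1)) ≤ 2 * (n : ℝ) ^ (-(4 / 3) : ℝ) := by
      rw [← e2]
      have := mul_le_mul_of_nonneg_left hd2 (by positivity : 0 ≤ (n : ℝ) ^ (2 / 3 : ℝ))
      linarith
    have := mul_le_mul_of_nonneg_left k1 hC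
    push_cast
    linarith

end Dirichlet
end Bernays

namespace Bernays
open ArithmeticFunction ArithmeticFunction.Moebius ArithmeticFunction.zeta

section Twist

variable {𝕜 : Type*} [RCLike 𝕜]

/-- The twist of a completely multiplicative function by `m ↦ m ^ (-σ)`. -/
noncomputable def tw (σ : ℝ) (f : ℕ →*₀ 𝕜) : ℕ →*₀ 𝕜 where
  toFun m := f m * (((m : ℝ) ^ (-σ) : ℝ) : 𝕜)
  map_zero' := by simp
  map_one' := by simp
  map_mul' a b := by
    rw [map_mul, Nat.cast_mul, Real.mul_rpow (Nat.cast_nonneg a) (Nat.cast_nonneg b)]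
    push_cast; ring

theorem tw_apply (σ : ℝ) (f : ℕ →*₀ 𝕜) (m : ℕ) : tw σ f m = f m * (((m : ℝ) ^ (-σ) : ℝ) : 𝕜) := rfl

theorem norm_tw_le {σ : ℝ} {f : ℕ →*₀ 𝕜} (hf : ∀ m, ‖f m‖ ≤ 1) (m : ℕ) :
    ‖tw σ f m‖ ≤ (m : ℝ) ^ (-σ) := by
  rw [tw_apply, norm_mul, RCLike.norm_ofReal, abs_of_nonneg (by positivity)]
  exact mul_le_of_le_one_left (by positivity) (hf m)

theorem summable_norm_tw {σ : ℝ} (hσ : 1 < σ) {f : ℕ →*₀ 𝕜} (hf : ∀ m, ‖f m‖ ≤ 1) :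
    Summable fun m => ‖tw σ f m‖ :=
  Summable.of_nonneg_of_le (fun _ => _root_.norm_nonneg _) (norm_tw_le hf)
    (Real.summable_nat_rpow.2 (by linarith))

theorem LSeries_term_eq (σ : ℝ) (f : ℕ → ℂ) (hf : f 0 = 0) :
    LSeries.term f (σ : ℂ) = fun m => f m * (((m : ℝ) ^ (-σ) : ℝ) : ℂ) := by
  ext m
  rw [LSeries.term_def]
  split_ifs with h
  · rw [h, hf, zero_mul]
  · rw [Real.rpow_neg (Nat.cast_nonneg m), Complex.ofReal_inv, Complex.ofReal_cpow (Nat.cast_nonneg m),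
      div_eq_mul_inv, Complex.ofReal_natCast]

theorem sum_range_succ_eq_Ioc {E : Type*} [AddCommMonoid E] {f : ℕ → E} (hf : f 0 = 0) (N : ℕ) :
    ∑ k ∈ Finset.range (N + 1), f k = ∑ k ∈ Finset.Ioc 0 N, f k := by
  induction N with
  | zero => simp [hf]
  | succ N ih => rw [Finset.sum_range_succ, ih, Finset.sum_Ioc_succ_top (Nat.zero_le N)]

end Twist

section CharSeries

variable {G : Type*} [CommGroup G] [Finite G] {S : ℕ → Prop} {c : ℕ → G}

theorem char_inv_eq_conj (χ : G →* ℂ) (g : G) : χ g⁻¹ = (starRingEnd ℂ) (χ g) := by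
  rw [← Complex.inv_eq_conj (norm_char_eq χ g)]
  refine eq_inv_of_mul_eq_one_left ?_
  rw [← map_mul, inv_mul_cancel, map_one]

theorem norm_tsum_sq_eq (χ : G →* ℂ) {σ : ℝ} (hσ : 1 < σ) :
    HasSum (fun m => cconv S c χ m * (((m : ℝ) ^ (-σ) : ℝ) : ℂ))
      ((‖∑' m, tw σ (cmc S c χ) m‖ ^ 2 : ℝ) : ℂ) := by
  have hs : ∀ χ : G →* ℂ, LSeriesSummable (fun n => af (cmc S c χ) n) (σ : ℂ) := fun χ => by
    rw [LSeriesSummable, LSeries_term_eq σ _ (by simp)]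
    exact (summable_norm_tw hσ (norm_cmc_le χ)).of_norm
  have hF : ∀ χ : G →* ℂ, LSeries (fun n => af (cmc S c χ) n) (σ : ℂ) = ∑' m, tw σ (cmc S c χ) m :=
    fun χ => by
    rw [LSeries, LSeries_term_eq σ _ (by simp)]
    rfl
  have h1 := LSeries_mul' (hs χ) (hs (χ.comp invMonoidHom))
  have h2 := LSeriesSummable_mul (hs χ) (hs (χ.comp invMonoidHom))
  have e : ∑' m, tw σ (cmc S c (χ.comp invMonoidHom)) m =
      (starRingEnd ℂ) (∑' m, tw σ (cmc S c χ) m) := by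
    rw [Complex.conj_tsum]
    congr 1
    ext m
    rw [tw_apply, tw_apply, map_mul]
    congr 1
    · by_cases hm : AllP S m
      · rw [hm.cmc_eq, hm.cmc_eq, ← char_inv_eq_conj]; rfl
      · rw [cmc_eq_zero _ hm, cmc_eq_zero _ hm, _root_.map_zero]
    · exact (Complex.conj_ofReal _).symm
  rw [hF, hF, e, Complex.mul_conj, Complex.normSq_eq_norm_sq] at h1
  rw [← h1, LSeries]
  have h3 := h2.hasSum
  rw [LSeries_term_eq σ _ (by simp)] at h3 ⊢
  exact h3

theorem exists_norm_tsum_sq_le {K C : ℝ} (hK : 0 < K)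
    (hT : ∀ (g : G) (x : ℝ), 0 < x → |((prs S c g x).ncard : ℝ) - K * x| ≤ C * x ^ (2 / 3 : ℝ)) :
    ∃ A : ℝ, 0 < A ∧ ∀ χ : G →* ℂ, ∀ σ : ℝ, 1 < σ → σ ≤ 2 →
      ‖∑' m, tw σ (cmc S c χ) m‖ ^ 2 ≤ A * (σ - 1)⁻¹ ∧
      (χ ≠ 1 → ‖∑' m, tw σ (cmc S c χ) m‖ ^ 2 ≤ A) := by
  classical
  have := Fintype.ofFinite G
  have hC : 0 ≤ C := by
    have := hT 1 1 one_pos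
    rw [Real.one_rpow] at this
    linarith [abs_nonneg (((prs S c 1 1).ncard : ℝ) - K * 1)]
  set n : ℝ := (Nat.card G : ℝ) with hn
  have hn0 : 0 < n := by rw [hn]; exact_mod_cast Nat.card_pos
  set Z := ∑' n : ℕ, (n : ℝ) ^ (-(4 / 3) : ℝ) with hZ
  have hts : 0 ≤ Z := tsum_nonneg fun n => by positivity
  have key : ∀ χ : G →* ℂ, ∀ σ : ℝ, 1 < σ → σ ≤ 2 → ‖∑' m, tw σ (cmc S c χ) m‖ ^ 2 ≤
      ‖∑ g, χ g‖ * K * (1 + (σ - 1)⁻¹) + n * C * (1 + 2 * Z) := by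
    intro χ σ h1 h2
    have hs := ((norm_tsum_sq_eq (S := S) (c := c) χ h1).tendsto_sum_nat.norm).comp (tendsto_add_atTop_nat 1)
    rw [Complex.norm_real, Real.norm_of_nonneg (by positivity)] at hs
    refine le_of_tendsto' hs fun N => ?_
    simp only [Function.comp_apply]
    rw [sum_range_succ_eq_Ioc (by simp)]
    refine norm_sum_mul_rpow_le (by positivity) (fun N hN => ?_) (by positivity) h1 h2 N
    have h3 := norm_sum_cconv_sub_le hT χ N hN
    have h4 := norm_add_le (∑ m ∈ Finset.Ioc 0 N, cconv S c χ m - (∑ g, χ g) * ((K * N : ℝ) : ℂ))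
      ((∑ g, χ g) * ((K * N : ℝ) : ℂ))
    rw [sub_add_cancel, norm_mul, Complex.norm_real, Real.norm_of_nonneg (by positivity)] at h4
    refine h4.trans ?_
    have h5 : ‖∑ m ∈ Finset.Ioc 0 N, cconv S c χ m - (∑ g, χ g) * ((K * N : ℝ) : ℂ)‖ ≤
      n * C * (N : ℝ) ^ (2 / 3 : ℝ) := h3
    linarith
  refine ⟨2 * n * K + n * C * (1 + 2 * Z), by positivity, fun χ σ h1 h2 => ⟨?_, fun hχ => ?_⟩⟩
  · refine (key χ σ h1 h2).trans ?_
    have h3 : ‖∑ g, χ g‖ ≤ n := by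
      refine (norm_sum_le _ _).trans ?_
      simp [norm_char_eq, hn]
    have h4 : 1 ≤ (σ - 1)⁻¹ := (one_le_inv₀ (by linarith)).2 (by linarith)
    have h5 : n * C * (1 + 2 * Z) ≤ n * C * (1 + 2 * Z) * (σ - 1)⁻¹ :=
      le_mul_of_one_le_right (by positivity) h4
    have h6 : ‖∑ g, χ g‖ * K * (1 + (σ - 1)⁻¹) ≤ n * K * (2 * (σ - 1)⁻¹) := by
      gcongr; linarith
    linarith
  · refine (key χ σ h1 h2).trans ?_
    rw [sum_hom_units, if_neg hχ, Nat.cast_zero, norm_zero, zero_mul, zero_mul, zero_add]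
    have : 0 ≤ 2 * n * K := by positivity
    linarith

end CharSeries

section HalfDensity

variable {G : Type*} [CommGroup G] [Finite G] {S : ℕ → Prop} {c : ℕ → G}

theorem pext_mem_unit {g : ℕ → ℝ} (h : ∀ p, 0 ≤ g p ∧ g p ≤ 1) (m : ℕ) :
    0 ≤ pext g m ∧ pext g m ≤ 1 := by
  rw [pext]
  induction m.primeFactorsList with
  | nil => simp
  | cons p l ih =>
    rw [List.map_cons, List.prod_cons]
    exact ⟨mul_nonneg (h p).1 ih.1, mul_le_one₀ (h p).2 ih.1 ih.2⟩

/-- The completely multiplicative function with prime values `(1 + Re ω(c p)) / 2` on `S`. -/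
noncomputable def hh (S : ℕ → Prop) (c : ℕ → G) (ω : G →* ℂ) : ℕ →*₀ ℝ :=
  cm S fun p => (1 + (ω (c p)).re) / 2

theorem hh_prime_mem (ω : G →* ℂ) (g : G) : 0 ≤ (1 + (ω g).re) / 2 ∧ (1 + (ω g).re) / 2 ≤ 1 := by
  have := abs_le.1 ((Complex.abs_re_le_norm (ω g)).trans_eq (norm_char_eq ω g))
  constructor <;> linarith [this.1, this.2]

theorem hh_mem (ω : G →* ℂ) (m : ℕ) : 0 ≤ hh S c ω m ∧ hh S c ω m ≤ 1 := by
  by_cases hm : AllP S m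
  · rw [hh, hm.cm_eq]
    exact pext_mem_unit (fun p => hh_prime_mem ω (c p)) m
  · rw [hh, cm_eq_zero _ hm]; simp

theorem norm_hh_le (ω : G →* ℂ) (m : ℕ) : ‖hh S c ω m‖ ≤ 1 := by
  rw [Real.norm_of_nonneg (hh_mem ω m).1]; exact (hh_mem ω m).2

theorem euler_factor_le {z : ℂ} (hz : ‖z‖ = 1) {t h : ℝ} (ht0 : 0 ≤ t) (ht : t ≤ 1 / 2)
    (hh : h = (1 + z.re) / 2) :
    ((1 - h * t)⁻¹) ^ 2 ≤ (1 + 4 * t ^ 2) * ((1 - t)⁻¹ * ‖(1 - z * t)⁻¹‖) := by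
  have hx := abs_le.1 ((Complex.abs_re_le_norm z).trans_eq hz)
  have h1 : h ≤ 1 := by linarith
  have h0 : 0 ≤ h := by linarith
  have hn : z.re ^ 2 + z.im ^ 2 = 1 := by
    have := Complex.sq_norm z
    rw [hz, Complex.normSq_apply] at this
    linarith
  have hzx : z.re = 2 * h - 1 := by linarith
  set x := z.re
  have b1 : ‖1 - z * t‖ ≤ 1 - x * t + t ^ 2 := by
    refine abs_le_of_sq_le_sq' ?_ (by nlinarith) |>.2
    rw [Complex.sq_norm, Complex.normSq_apply]
    simp only [Complex.sub_re, Complex.one_re, Complex.mul_re, Complex.ofReal_re, Complex.ofReal_im,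
      mul_zero, sub_zero, Complex.sub_im, Complex.one_im, Complex.mul_im, zero_add, zero_sub]
    have e1 : (1 - x * t) * (1 - x * t) + -(z.im * t) * -(z.im * t) = 1 - 2 * x * t + t ^ 2 := by
      linear_combination t ^ 2 * hn
    rw [show z.re = x from rfl, e1]
    have : x * t ≤ t := by nlinarith
    nlinarith [mul_nonneg (sq_nonneg t) (by linarith : 0 ≤ 1 / 2 - x * t), sq_nonneg (x * t), sq_nonneg (t ^ 2)]
  have hht : h * t ≤ 1 / 2 := by nlinarith
  have b2 : 0 < ‖1 - z * t‖ := by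
    rw [_root_.norm_pos_iff]
    intro h3
    have : ‖z * t‖ = 1 := by rw [← sub_eq_zero.1 h3, norm_one]
    rw [norm_mul, hz, Complex.norm_real, Real.norm_of_nonneg ht0] at this
    linarith
  rw [norm_inv, ← mul_inv, inv_pow, ← div_eq_mul_inv, inv_eq_one_div, div_le_div_iff₀ (by nlinarith)
    (by have : 0 < 1 - t := by linarith
        positivity), one_mul]
  have b3 : (1 - t) * ‖1 - z * t‖ ≤ (1 - t) * (1 - x * t + t ^ 2) :=
    mul_le_mul_of_nonneg_left b1 (by linarith)
  refine b3.trans ?_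
  rw [hzx]
  have h5 : 0 ≤ t ^ 2 * ((1 - h * t) - 1 / 2) * ((1 - h * t) + 1 / 2) :=
    mul_nonneg (mul_nonneg (sq_nonneg t) (by linarith)) (by linarith)
  have h6 : 0 ≤ t ^ 2 * (h - 1) ^ 2 := by positivity
  have h7 : 0 ≤ t ^ 3 := by positivity
  nlinarith

theorem tsum_hh_sq_le (ω : G →* ℂ) {σ : ℝ} (hσ : 1 < σ) :
    (∑' m, tw σ (hh S c ω) m) ^ 2 ≤ Real.exp (4 * ∑' n : ℕ, 1 / (n : ℝ) ^ 2) *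
      (‖∑' m, tw σ (cmc S c (1 : G →* ℂ)) m‖ * ‖∑' m, tw σ (cmc S c ω) m‖) := by
  have hsz : Summable fun n : ℕ => 1 / (n : ℝ) ^ 2 := hasSum_zeta_two.summable
  have t1 := (EulerProduct.eulerProduct_completely_multiplicative
    (summable_norm_tw hσ (norm_hh_le (S := S) (c := c) ω))).pow 2
  have t2 := (EulerProduct.eulerProduct_completely_multiplicative
    (summable_norm_tw hσ (norm_cmc_le (S := S) (c := c) (1 : G →* ℂ)))).norm
  have t3 := (EulerProduct.eulerProduct_completely_multiplicative
    (summable_norm_tw hσ (norm_cmc_le (S := S) (c := c) ω))).norm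
  refine le_of_tendsto_of_tendsto' t1 ((t2.mul t3).const_mul _) fun n => ?_
  rw [← Finset.prod_pow, norm_prod, norm_prod, ← Finset.prod_mul_distrib]
  have h1 : ∏ p ∈ n.primesBelow, (1 + 4 * ((p : ℝ) ^ (-σ)) ^ 2) ≤
      Real.exp (4 * ∑' n : ℕ, 1 / (n : ℝ) ^ 2) := by
    refine (Finset.prod_le_prod (fun p _ => by positivity) (g := fun p : ℕ => Real.exp (4 * (1 / (p : ℝ) ^ 2)))
      fun p hp => ?_).trans ?_
    · have hp1 : (1 : ℝ) ≤ p := by exact_mod_cast (Nat.prime_of_mem_primesBelow hp).one_le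
      have : (p : ℝ) ^ (-σ) ≤ (p : ℝ)⁻¹ := by
        rw [← Real.rpow_neg_one]
        exact Real.rpow_le_rpow_of_exponent_le hp1 (by linarith)
      have h2 : ((p : ℝ) ^ (-σ)) ^ 2 ≤ 1 / (p : ℝ) ^ 2 := by
        rw [one_div, ← inv_pow]
        exact pow_le_pow_left₀ (by positivity) this 2
      have := Real.add_one_le_exp (4 * (1 / (p : ℝ) ^ 2))
      linarith
    · rw [← Real.exp_sum, Real.exp_le_exp, ← Finset.mul_sum]
      refine mul_le_mul_of_nonneg_left ?_ (by norm_num)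
      exact hsz.sum_le_tsum _ fun n _ => by positivity
  refine le_trans ?_ (mul_le_mul_of_nonneg_right h1 (Finset.prod_nonneg fun p _ => by positivity))
  rw [← Finset.prod_mul_distrib]
  refine Finset.prod_le_prod (fun p _ => by positivity) fun p hp => ?_
  have hp := Nat.prime_of_mem_primesBelow hp
  have hp2 : (2 : ℝ) ≤ p := by exact_mod_cast hp.two_le
  have ht : (p : ℝ) ^ (-σ) ≤ 1 / 2 := by
    calc (p : ℝ) ^ (-σ) ≤ (p : ℝ) ^ (-1 : ℝ) :=
          Real.rpow_le_rpow_of_exponent_le (by linarith) (by linarith)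
      _ = (p : ℝ)⁻¹ := Real.rpow_neg_one _
      _ ≤ 2⁻¹ := by gcongr
      _ = 1 / 2 := by norm_num
  have ht0 : 0 ≤ (p : ℝ) ^ (-σ) := by positivity
  rw [tw_apply, tw_apply, tw_apply]
  set t := (p : ℝ) ^ (-σ)
  by_cases hS : S p
  · have hA := allP_prime hp |>.2 hS
    rw [hA.cmc_eq, hA.cmc_eq, hh, hA.cm_eq, pext_prime _ hp, pext_prime _ hp]
    have := euler_factor_le (norm_char_eq ω (c p)) ht0 ht rfl
    simp only [MonoidHom.one_apply, one_mul]
    have e : ‖(1 - (t : ℂ))⁻¹‖ = (1 - t)⁻¹ := by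
      rw [← Complex.ofReal_one, ← Complex.ofReal_sub, norm_inv, Complex.norm_real,
        Real.norm_of_nonneg (by linarith)]
    rw [← e] at this
    exact this
  · have hA : ¬ AllP S p := fun h => hS (allP_prime hp |>.1 h)
    rw [cmc_eq_zero _ hA, cmc_eq_zero _ hA, hh, cm_eq_zero _ hA]
    simp only [zero_mul, sub_zero, inv_one, one_pow, norm_one, mul_one]
    nlinarith [sq_nonneg t]

end HalfDensity
end Bernays

namespace Bernays
open ArithmeticFunction ArithmeticFunction.Moebius ArithmeticFunction.zeta

section Rankin

variable {G : Type*} [CommGroup G] [Finite G] {S : ℕ → Prop} {c : ℕ → G}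

theorem sum_div_le_tsum {h : ℕ →*₀ ℝ} (h0 : ∀ m, 0 ≤ h m) (h1 : ∀ m, h m ≤ 1) {x : ℝ}
    (hx : Real.exp 1 ≤ x) :
    ∑ m ∈ Finset.Ioc 0 ⌊x⌋₊, h m / m ≤ Real.exp 1 * ∑' m, tw (1 + (Real.log x)⁻¹) h m := by
  have hx0 : 0 < x := (Real.exp_pos 1).trans_le hx
  have hL : 1 ≤ Real.log x := by rwa [Real.le_log_iff_exp_le hx0]
  have hL' : 0 < (Real.log x)⁻¹ := by positivity
  have hs := summable_norm_tw (σ := 1 + (Real.log x)⁻¹) (by linarith)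
    (f := h) (fun m => by rw [Real.norm_of_nonneg (h0 m)]; exact h1 m)
  have hn : ∀ m, 0 ≤ tw (1 + (Real.log x)⁻¹) h m := fun m => by
    rw [tw_apply]
    exact mul_nonneg (h0 m) (by simp; positivity)
  refine le_trans ?_ (mul_le_mul_of_nonneg_left (hs.of_norm.sum_le_tsum (Finset.Ioc 0 ⌊x⌋₊)
    fun m _ => hn m) (Real.exp_pos 1).le)
  rw [Finset.mul_sum]
  refine Finset.sum_le_sum fun m hm => ?_
  obtain ⟨hm0, hmx⟩ := le_of_mem_Ioc_floor hm
  rw [tw_apply]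
  change h m / m ≤ Real.exp 1 * (h m * (m : ℝ) ^ (-(1 + (Real.log x)⁻¹)))
  have e : (m : ℝ) ^ (-(1 + (Real.log x)⁻¹)) = (m : ℝ)⁻¹ * Real.exp (-(Real.log m / Real.log x)) := by
    rw [neg_add, Real.rpow_add hm0, Real.rpow_neg_one, Real.rpow_def_of_pos hm0]
    congr 2; ring
  rw [e, show Real.exp 1 * (h m * ((m : ℝ)⁻¹ * Real.exp (-(Real.log m / Real.log x)))) =
    h m / m * Real.exp (1 + -(Real.log m / Real.log x)) by rw [Real.exp_add]; ring]
  refine le_mul_of_one_le_right (div_nonneg (h0 m) hm0.le) (Real.one_le_exp ?_)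
  have : Real.log m / Real.log x ≤ 1 := by
    rw [div_le_one (by linarith)]
    exact Real.log_le_log hm0 hmx
  linarith

theorem exists_hh_bounds {K C : ℝ} (hK : 0 < K)
    (hT : ∀ (g : G) (x : ℝ), 0 < x → |((prs S c g x).ncard : ℝ) - K * x| ≤ C * x ^ (2 / 3 : ℝ)) :
    ∃ B : ℝ, 0 < B ∧ ∀ x : ℝ, Real.exp 1 ≤ x →
      ∑ m ∈ Finset.Ioc 0 ⌊x⌋₊, hh S c 1 m * (x / m) ^ (3 / 4 : ℝ) ≤ B * (x / Real.log x ^ (1 / 2 : ℝ)) ∧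
      ∀ ω : G →* ℂ, ω ≠ 1 →
        ∑ m ∈ Finset.Ioc 0 ⌊x⌋₊, hh S c ω m ≤ B * (x / Real.log x ^ (3 / 4 : ℝ)) := by
  obtain ⟨A, hA, hF⟩ := exists_norm_tsum_sq_le hK hT
  obtain ⟨D, hD, hW⟩ := exists_log_mul_sum_le
  set E := Real.exp (4 * ∑' n : ℕ, 1 / (n : ℝ) ^ 2) with hE
  have hE0 : 0 < E := Real.exp_pos _
  set M := √(E * A) with hM
  have hM2 : M ^ 2 = E * A := Real.sq_sqrt (by positivity)
  have hM0 : 0 < M := Real.sqrt_pos.2 (by positivity)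
  refine ⟨D * (Real.exp 1 * M), by positivity, fun x hx => ?_⟩
  have hx0 : 0 < x := (Real.exp_pos 1).trans_le hx
  have hx1 : 1 ≤ x := (Real.one_le_exp zero_le_one).trans hx
  have hL : 1 ≤ Real.log x := by rwa [Real.le_log_iff_exp_le hx0]
  set L := Real.log x with hLd
  have hL0 : 0 < L := by linarith
  have hLi : 0 < L⁻¹ := by positivity
  have hLi1 : L⁻¹ ≤ 1 := inv_le_one_of_one_le₀ hL
  set q := L ^ (1 / 4 : ℝ) with hq
  have hq0 : 0 < q := by positivity
  have q4 : q ^ 4 = L := by rw [hq, ← Real.rpow_natCast, ← Real.rpow_mul hL0.le]; norm_num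
  have q2 : L ^ (1 / 2 : ℝ) = q ^ 2 := by
    rw [hq, ← Real.rpow_natCast, ← Real.rpow_mul hL0.le]; norm_num
  have q3 : L ^ (3 / 4 : ℝ) = q ^ 3 := by
    rw [hq, ← Real.rpow_natCast, ← Real.rpow_mul hL0.le]; norm_num
  have hFx : ∀ ω : G →* ℂ, ‖∑' m, tw (1 + L⁻¹) (cmc S c ω) m‖ ^ 2 ≤ A * L ∧
      (ω ≠ 1 → ‖∑' m, tw (1 + L⁻¹) (cmc S c ω) m‖ ^ 2 ≤ A) := fun ω => by
    have := hF ω (1 + L⁻¹) (by linarith) (by linarith)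
    rwa [add_sub_cancel_left, inv_inv] at this
  have hH0 : ∀ ω : G →* ℂ, 0 ≤ ∑' m, tw (1 + L⁻¹) (hh S c ω) m := fun ω => tsum_nonneg fun m => by
    rw [tw_apply]
    exact mul_nonneg (hh_mem ω m).1 (by simp; positivity)
  have hH : ∀ ω : G →* ℂ, (∑' m, tw (1 + L⁻¹) (hh S c ω) m) ^ 2 ≤
      E * (‖∑' m, tw (1 + L⁻¹) (cmc S c (1 : G →* ℂ)) m‖ * ‖∑' m, tw (1 + L⁻¹) (cmc S c ω) m‖) :=
    fun ω => tsum_hh_sq_le ω (by linarith)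
  have hS1 : ∀ ω : G →* ℂ, ∑ m ∈ Finset.Ioc 0 ⌊x⌋₊, hh S c ω m / m ≤
      Real.exp 1 * ∑' m, tw (1 + L⁻¹) (hh S c ω) m := fun ω =>
    sum_div_le_tsum (fun m => (hh_mem ω m).1) (fun m => (hh_mem ω m).2) hx
  have hS2 : ∀ ω : G →* ℂ, L * ∑ m ∈ Finset.Ioc 0 ⌊x⌋₊, hh S c ω m * (x / m) ^ (3 / 4 : ℝ) ≤
      D * x * ∑ m ∈ Finset.Ioc 0 ⌊x⌋₊, hh S c ω m / m := fun ω =>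
    hW _ (fun m => (hh_mem ω m).1) (fun m => (hh_mem ω m).2) x hx1
  have fin : ∀ (ω : G →* ℂ) (V : ℝ), ∑' m, tw (1 + L⁻¹) (hh S c ω) m ≤ M * V →
      ∑ m ∈ Finset.Ioc 0 ⌊x⌋₊, hh S c ω m * (x / m) ^ (3 / 4 : ℝ) ≤
        D * (Real.exp 1 * M) * (x * V / L) := fun ω V hV => by
    have h1 := (hS2 ω).trans (mul_le_mul_of_nonneg_left ((hS1 ω).trans
      (mul_le_mul_of_nonneg_left hV (Real.exp_pos 1).le)) (by positivity))
    rw [mul_comm L, ← le_div_iff₀ hL0] at h1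
    refine h1.trans_eq ?_
    ring
  constructor
  · have h1 : ∑' m, tw (1 + L⁻¹) (hh S c 1) m ≤ M * q ^ 2 := by
      refine abs_le_of_sq_le_sq' ?_ (by positivity) |>.2
      refine (hH 1).trans ?_
      rw [mul_pow, hM2, ← pow_two, ← pow_mul, q4, mul_assoc]
      exact mul_le_mul_of_nonneg_left (hFx 1).1 hE0.le
    refine (fin 1 _ h1).trans_eq ?_
    rw [q2, ← q4]
    field_simp
  · intro ω hω
    have h1 : ∑' m, tw (1 + L⁻¹) (hh S c ω) m ≤ M * q := by
      refine abs_le_of_sq_le_sq' ?_ (by positivity) |>.2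
      refine (hH ω).trans ?_
      rw [mul_pow, hM2, mul_assoc]
      refine mul_le_mul_of_nonneg_left ?_ hE0.le
      refine abs_le_of_sq_le_sq' ?_ (by positivity) |>.2
      rw [mul_pow, mul_pow, ← pow_mul, q4]
      calc _ ≤ (A * L) * A := mul_le_mul (hFx 1).1 ((hFx ω).2 hω) (by positivity) (by positivity)
        _ = _ := by ring
    refine le_trans (Finset.sum_le_sum fun m hm => ?_) ((fin ω _ h1).trans_eq ?_)
    · obtain ⟨hm0, hmx⟩ := le_of_mem_Ioc_floor hm
      refine le_mul_of_one_le_right (hh_mem ω m).1 (Real.one_le_rpow ?_ (by norm_num))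
      rwa [one_le_div hm0]
    · rw [q3, ← q4]
      field_simp

end Rankin
end Bernays

namespace Bernays
open ArithmeticFunction ArithmeticFunction.Moebius ArithmeticFunction.zeta

section Derivation

theorem pmul_log_mul (f g : ArithmeticFunction ℝ) :
    (f * g).pmul log = f.pmul log * g + f * g.pmul log := by
  ext m
  simp only [pmul_apply, ArithmeticFunction.mul_apply, ArithmeticFunction.add_apply, Finset.sum_mul]
  rw [← Finset.sum_add_distrib]
  refine Finset.sum_congr rfl fun x hx => ?_
  obtain ⟨h1, h2⟩ := Nat.mem_divisorsAntidiagonal.1 hx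
  have hx1 : (x.1 : ℝ) ≠ 0 := by
    have : x.1 ≠ 0 := by rintro h; rw [h, zero_mul] at h1; exact h2 h1.symm
    exact_mod_cast this
  have hx2 : (x.2 : ℝ) ≠ 0 := by
    have : x.2 ≠ 0 := by rintro h; rw [h, mul_zero] at h1; exact h2 h1.symm
    exact_mod_cast this
  rw [log_apply, log_apply, log_apply, ← h1, Nat.cast_mul, Real.log_mul hx1 hx2]
  ring

theorem minv_mul_sq (β : ℕ →*₀ ℝ) : minv β * (af β * af β) = af β := by
  rw [← mul_assoc, minv_mul, one_mul]

theorem minv_mul_pmul_log (β : ℕ →*₀ ℝ) :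
    minv β * (af β * af β).pmul log = 2 • (af β).pmul log := by
  rw [pmul_log_mul, mul_add, ← mul_assoc, mul_comm (_ * _) (af β), ← mul_assoc, mul_comm (af β),
    minv_mul, one_mul, ← mul_assoc, minv_mul, one_mul, two_smul]

end Derivation

section RealChar

variable {G : Type*} [CommGroup G] [Finite G] {S : ℕ → Prop} {c : ℕ → G}

theorem real_char_inv (ε : G →* ℝ) : ε.comp invMonoidHom = ε := by
  ext g
  have h := norm_char_eq ε g
  have h1 : ε g * ε g = 1 := by
    rw [← abs_mul_abs_self, ← Real.norm_eq_abs, h, one_mul]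
  have h2 : ε g⁻¹ * ε g = 1 := by rw [← map_mul, inv_mul_cancel, map_one]
  have h3 : ε g ≠ 0 := by intro h; rw [h] at h1; simp at h1
  exact mul_right_cancel₀ h3 (h2.trans h1.symm)

theorem cconv_real (ε : G →* ℝ) : cconv S c ε = af (cmc S c ε) * af (cmc S c ε) := by
  rw [cconv, real_char_inv]

theorem abs_cmc_eq (ε : G →* ℝ) (m : ℕ) : |cmc S c ε m| = hh S c 1 m := by
  by_cases hm : AllP S m
  · rw [hm.cmc_eq, ← Real.norm_eq_abs, norm_char_eq, hh, hm.cm_eq]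
    simp [pext]
  · rw [cmc_eq_zero _ hm, hh, cm_eq_zero _ hm, abs_zero]

theorem abs_minv_cmc_le (ε : G →* ℝ) (m : ℕ) : |minv (cmc S c ε) m| ≤ hh S c 1 m := by
  rw [minv, pmul_apply, abs_mul, af_apply, abs_cmc_eq]
  refine mul_le_of_le_one_right (hh_mem 1 m).1 ?_
  rw [intCoe_apply]
  exact_mod_cast abs_moebius_le_one

theorem abs_sum_minv_mul_le (ε : G →* ℝ) {E : ℝ → ℝ} {D : ℝ}
    (hE : ∀ y : ℝ, 1 ≤ y → |E y| ≤ D * y ^ (3 / 4 : ℝ)) (x : ℝ) :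
    |∑ d ∈ Finset.Ioc 0 ⌊x⌋₊, minv (cmc S c ε) d * E (x / d)| ≤
      D * ∑ m ∈ Finset.Ioc 0 ⌊x⌋₊, hh S c 1 m * (x / m) ^ (3 / 4 : ℝ) := by
  refine (Finset.abs_sum_le_sum_abs _ _).trans ?_
  rw [Finset.mul_sum]
  refine Finset.sum_le_sum fun d hd => ?_
  obtain ⟨hd0, hdx⟩ := le_of_mem_Ioc_floor hd
  rw [abs_mul]
  have h1 := hE (x / d) (by rwa [one_le_div hd0])
  calc _ ≤ hh S c 1 d * (D * (x / d) ^ (3 / 4 : ℝ)) :=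
        mul_le_mul (abs_minv_cmc_le ε d) h1 (abs_nonneg _) (hh_mem 1 d).1
    _ = _ := by ring

theorem abs_sum_mul_log_div_le (ε : G →* ℝ) (x : ℝ) :
    |∑ d ∈ Finset.Ioc 0 ⌊x⌋₊, cmc S c ε d * Real.log (x / d)| ≤
      2 * ∑ m ∈ Finset.Ioc 0 ⌊x⌋₊, hh S c 1 m * (x / m) ^ (3 / 4 : ℝ) := by
  refine (Finset.abs_sum_le_sum_abs _ _).trans ?_
  rw [Finset.mul_sum]
  refine Finset.sum_le_sum fun d hd => ?_
  obtain ⟨hd0, hdx⟩ := le_of_mem_Ioc_floor hd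
  have hx1 : 1 ≤ x / d := by rwa [one_le_div hd0]
  rw [abs_mul, abs_cmc_eq, abs_of_nonneg (Real.log_nonneg hx1)]
  have h1 := Real.log_le_rpow_div (x := x / d) (by linarith) (ε := 3 / 4) (by norm_num)
  have h2 : 0 ≤ (x / d) ^ (3 / 4 : ℝ) := by positivity
  have := mul_le_mul_of_nonneg_left (h1.trans (by linarith : _ ≤ 2 * (x / d) ^ (3 / 4 : ℝ)))
    (hh_mem (S := S) (c := c) 1 d).1
  linarith

theorem log_mul_sum_eq (ε : G →* ℝ) {x : ℝ} (hx : 0 < x) :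
    Real.log x * ∑ d ∈ Finset.Ioc 0 ⌊x⌋₊, cmc S c ε d =
      ∑ d ∈ Finset.Ioc 0 ⌊x⌋₊, cmc S c ε d * Real.log (x / d) +
      ∑ d ∈ Finset.Ioc 0 ⌊x⌋₊, cmc S c ε d * Real.log d := by
  rw [Finset.mul_sum, ← Finset.sum_add_distrib]
  refine Finset.sum_congr rfl fun d hd => ?_
  obtain ⟨hd0, -⟩ := le_of_mem_Ioc_floor hd
  rw [Real.log_div hx.ne' hd0.ne']; ring

theorem two_mul_sum_log (ε : G →* ℝ) (x : ℝ) :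
    2 * ∑ d ∈ Finset.Ioc 0 ⌊x⌋₊, cmc S c ε d * Real.log d =
      ∑ d ∈ Finset.Ioc 0 ⌊x⌋₊, minv (cmc S c ε) d *
        ∑ k ∈ Finset.Ioc 0 ⌊x / d⌋₊, cconv S c ε k * Real.log k := by
  have h := sum_conv (minv (cmc S c ε)) ((cconv S c ε).pmul log) (fun _ => 1) ⌊x⌋₊
  rw [cconv_real, minv_mul_pmul_log] at h
  simp only [mul_one, natCast_floor_div, pmul_apply, log_apply] at h
  rw [cconv_real, ← h, Finset.mul_sum]
  refine Finset.sum_congr rfl fun d _ => ?_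
  rw [two_smul, ArithmeticFunction.add_apply, pmul_apply, log_apply, af_apply]; ring

theorem exists_char_sum_le {K C : ℝ} (hK : 0 < K)
    (hT : ∀ (g : G) (x : ℝ), 0 < x → |((prs S c g x).ncard : ℝ) - K * x| ≤ C * x ^ (2 / 3 : ℝ)) :
    ∃ B : ℝ, 0 < B ∧ ∀ ε : G →* ℝ, ε ≠ 1 → ∀ x : ℝ, Real.exp 1 ≤ x →
      |∑ m ∈ Finset.Ioc 0 ⌊x⌋₊, cmc S c ε m| ≤ B * (x / Real.log x ^ (3 / 2 : ℝ)) := by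
  classical
  have := Fintype.ofFinite G
  obtain ⟨B, hB, hY⟩ := exists_hh_bounds hK hT
  have hC : 0 ≤ C := by
    have := hT 1 1 one_pos
    rw [Real.one_rpow] at this
    linarith [abs_nonneg (((prs S c 1 1).ncard : ℝ) - K * 1)]
  set D : ℝ := 24 * (Nat.card G * C) with hD
  have hD0 : 0 ≤ D := by positivity
  refine ⟨(2 + D) * B, by positivity, fun ε hε x hx => ?_⟩
  have hx0 : 0 < x := (Real.exp_pos 1).trans_le hx
  have hL : 1 ≤ Real.log x := by rwa [Real.le_log_iff_exp_le hx0]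
  have h1 : ∀ N : ℕ, 1 ≤ N → |∑ k ∈ Finset.Ioc 0 N, cconv S c ε k| ≤
      Nat.card G * C * (N : ℝ) ^ (2 / 3 : ℝ) := fun N hN => by
    have := norm_sum_cconv_sub_le hT ε N hN
    rwa [sum_hom_units, if_neg hε, Nat.cast_zero, zero_mul, sub_zero] at this
  have h2 := abs_sum_minv_mul_le (S := S) (c := c) ε
    (E := fun y => ∑ k ∈ Finset.Ioc 0 ⌊y⌋₊, cconv S c ε k * Real.log k)
    (fun y hy => abs_sum_mul_log_le_real h1 hy) x
  rw [← two_mul_sum_log, abs_mul, abs_two] at h2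
  have h3 := abs_sum_mul_log_div_le (S := S) (c := c) ε x
  have h4 := abs_add_le (∑ d ∈ Finset.Ioc 0 ⌊x⌋₊, cmc S c ε d * Real.log (x / d))
      (∑ d ∈ Finset.Ioc 0 ⌊x⌋₊, cmc S c ε d * Real.log d)
  rw [← log_mul_sum_eq ε hx0, abs_mul, abs_of_nonneg (by linarith)] at h4
  have h5 := (hY x hx).1
  set Y := ∑ m ∈ Finset.Ioc 0 ⌊x⌋₊, hh S c 1 m * (x / m) ^ (3 / 4 : ℝ)
  have hY0 : 0 ≤ Y := Finset.sum_nonneg fun m hm => mul_nonneg (hh_mem 1 m).1 (by positivity)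
  have hDY : 0 ≤ D * Y := by positivity
  have h6 : Real.log x * |∑ m ∈ Finset.Ioc 0 ⌊x⌋₊, cmc S c ε m| ≤ (2 + D) * Y := by linarith
  have h7 := h6.trans (mul_le_mul_of_nonneg_left h5 (by linarith))
  rw [mul_comm (Real.log x), ← le_div_iff₀ (by linarith)] at h7
  refine h7.trans_eq ?_
  rw [show (3 / 2 : ℝ) = 1 / 2 + 1 by norm_num, Real.rpow_add (by linarith), Real.rpow_one]
  field_simp

theorem exists_unit_sum_relation {K C : ℝ} (hK : 0 < K)
    (hT : ∀ (g : G) (x : ℝ), 0 < x → |((prs S c g x).ncard : ℝ) - K * x| ≤ C * x ^ (2 / 3 : ℝ)) :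
    ∃ B : ℝ, 0 < B ∧ ∀ x : ℝ, Real.exp 1 ≤ x →
      ∑ m ∈ Finset.Ioc 0 ⌊x⌋₊, cmc S c (1 : G →* ℝ) m ≤ B * (x / Real.log x ^ (1 / 2 : ℝ)) ∧
      |2 * Real.log x * ∑ m ∈ Finset.Ioc 0 ⌊x⌋₊, cmc S c (1 : G →* ℝ) m -
        x * ∑ m ∈ Finset.Ioc 0 ⌊x⌋₊, cmc S c (1 : G →* ℝ) m / m| ≤
        B * (x / Real.log x ^ (1 / 2 : ℝ)) := by
  classical
  have := Fintype.ofFinite G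
  obtain ⟨B, hB, hY⟩ := exists_hh_bounds hK hT
  have h1 : ∀ N : ℕ, 1 ≤ N → |∑ k ∈ Finset.Ioc 0 N, cconv S c (1 : G →* ℝ) k - (Nat.card G * K) * N| ≤
      Nat.card G * C * (N : ℝ) ^ (2 / 3 : ℝ) := fun N hN => by
    have := norm_sum_cconv_sub_le hT (1 : G →* ℝ) N hN
    rw [sum_hom_units, if_pos rfl, ← Nat.card_eq_fintype_card] at this
    rw [mul_assoc]
    exact this
  have hn : (0 : ℝ) < Nat.card G := by exact_mod_cast Nat.card_pos
  obtain ⟨l, D, hE⟩ := exists_weighted_bound (by positivity) h1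
  have hD : 0 ≤ D := by
    have := hE 1 le_rfl
    rw [Real.one_rpow, mul_one] at this
    exact (abs_nonneg _).trans this
  have hhc : ∀ m, hh S c 1 m = cmc S c (1 : G →* ℝ) m := fun m => by
    rw [← abs_cmc_eq 1, abs_of_nonneg]
    by_cases hm : AllP S m
    · rw [hm.cmc_eq]; simp
    · rw [cmc_eq_zero _ hm]
  refine ⟨(D + |l| + 4 + 1) * B, by positivity, fun x hx => ?_⟩
  have hx0 : 0 < x := (Real.exp_pos 1).trans_le hx
  have hx1 : 1 ≤ x := (Real.one_le_exp zero_le_one).trans hx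
  have hL : 1 ≤ Real.log x := by rwa [Real.le_log_iff_exp_le hx0]
  have h2 := abs_sum_minv_mul_le (S := S) (c := c) (1 : G →* ℝ)
    (E := fun y => ∑ k ∈ Finset.Ioc 0 ⌊y⌋₊, cconv S c (1 : G →* ℝ) k * (Real.log k - y / k + l)) hE x
  have e1 : ∑ d ∈ Finset.Ioc 0 ⌊x⌋₊, minv (cmc S c (1 : G →* ℝ)) d *
      ∑ k ∈ Finset.Ioc 0 ⌊x / d⌋₊, cconv S c (1 : G →* ℝ) k * (Real.log k - x / d / k + l) =
      2 * ∑ d ∈ Finset.Ioc 0 ⌊x⌋₊, cmc S c (1 : G →* ℝ) d * Real.log d -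
      x * ∑ m ∈ Finset.Ioc 0 ⌊x⌋₊, cmc S c (1 : G →* ℝ) m / m +
      l * ∑ m ∈ Finset.Ioc 0 ⌊x⌋₊, cmc S c (1 : G →* ℝ) m := by
    have a1 := sum_conv (minv (cmc S c (1 : G →* ℝ))) (cconv S c (1 : G →* ℝ))
      (fun m => l - x / m) ⌊x⌋₊
    rw [cconv_real, minv_mul_sq, ← cconv_real] at a1
    have a2 : l * ∑ m ∈ Finset.Ioc 0 ⌊x⌋₊, cmc S c (1 : G →* ℝ) m -
        x * ∑ m ∈ Finset.Ioc 0 ⌊x⌋₊, cmc S c (1 : G →* ℝ) m / m =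
        ∑ m ∈ Finset.Ioc 0 ⌊x⌋₊, af (cmc S c (1 : G →* ℝ)) m * (l - x / m) := by
      rw [Finset.mul_sum, Finset.mul_sum, ← Finset.sum_sub_distrib]
      refine Finset.sum_congr rfl fun m _ => ?_
      rw [af_apply]; ring
    rw [two_mul_sum_log, sub_add_eq_add_sub, add_sub_assoc, a2, a1, ← Finset.sum_add_distrib]
    refine Finset.sum_congr rfl fun d _ => ?_
    rw [natCast_floor_div, ← mul_add, ← Finset.sum_add_distrib]
    congr 1
    refine Finset.sum_congr rfl fun k _ => ?_
    push_cast
    rw [← div_div]; ring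
  rw [e1] at h2
  have h3 := abs_sum_mul_log_div_le (S := S) (c := c) (1 : G →* ℝ) x
  have h4 := log_mul_sum_eq (S := S) (c := c) (1 : G →* ℝ) hx0
  have h5 := (hY x hx).1
  have h6 : ∑ m ∈ Finset.Ioc 0 ⌊x⌋₊, cmc S c (1 : G →* ℝ) m ≤
      ∑ m ∈ Finset.Ioc 0 ⌊x⌋₊, hh S c 1 m * (x / m) ^ (3 / 4 : ℝ) := by
    refine Finset.sum_le_sum fun m hm => ?_
    obtain ⟨hm0, hmx⟩ := le_of_mem_Ioc_floor hm
    rw [← hhc]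
    refine le_mul_of_one_le_right (hh_mem 1 m).1 (Real.one_le_rpow ?_ (by norm_num))
    rwa [one_le_div hm0]
  have h7 : 0 ≤ ∑ m ∈ Finset.Ioc 0 ⌊x⌋₊, cmc S c (1 : G →* ℝ) m :=
    Finset.sum_nonneg fun m _ => by rw [← hhc]; exact (hh_mem 1 m).1
  set Y := ∑ m ∈ Finset.Ioc 0 ⌊x⌋₊, hh S c 1 m * (x / m) ^ (3 / 4 : ℝ)
  have hY0 : 0 ≤ Y := h7.trans h6
  set Q := x / Real.log x ^ (1 / 2 : ℝ)
  have hl0 := abs_nonneg l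
  have h8 : (D + |l| + 4 + 1) * Y ≤ (D + |l| + 4 + 1) * B * Q := by
    rw [mul_assoc]; exact mul_le_mul_of_nonneg_left h5 (by positivity)
  have hDY : 0 ≤ D * Y := by positivity
  have hlY : 0 ≤ |l| * Y := by positivity
  set T := ∑ m ∈ Finset.Ioc 0 ⌊x⌋₊, cmc S c (1 : G →* ℝ) m
  have hlT : |l * T| ≤ |l| * Y := by
    rw [abs_mul, abs_of_nonneg h7]; gcongr
  refine ⟨by linarith, ?_⟩
  rw [abs_le] at h2 h3 hlT ⊢
  constructor <;> nlinarith [h2.1, h2.2, h3.1, h3.2, hlT.1, hlT.2]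

end RealChar
end Bernays

namespace Bernays
open ArithmeticFunction ArithmeticFunction.Moebius ArithmeticFunction.zeta

section Endgame

theorem one_le_log_of_three_le {N : ℕ} (hN : 3 ≤ N) : 1 ≤ Real.log N := by
  rw [Real.le_log_iff_exp_le (by positivity)]
  have h : (3 : ℝ) ≤ N := by exact_mod_cast hN
  linarith [Real.exp_one_lt_d9]

theorem growth_step {B n r r' V V' s : ℝ} (hn : 1 ≤ n) (hr : 1 ≤ r) (hr' : r ≤ r')
    (hB : 0 < B) (h1 : (n + 1)⁻¹ ≤ r' ^ 2 - r ^ 2) (h2 : r' ^ 2 - r ^ 2 ≤ n⁻¹) (hrn : r ^ 2 ≤ n)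
    (hV : |V| ≤ 4 * B * r) (hs : |2 * r ^ 2 * s - V| ≤ 2 * B / r) (hV' : V' = V + s / (n + 1)) :
    |V' / r' - V / r| ≤ 5 * B / (n * r ^ 4) := by
  have hr0 : 0 < r := by linarith
  have hr0' : 0 < r' := by linarith
  have hn0 : 0 < n := by linarith
  set e := s - V / (2 * r ^ 2) with he
  have he1 : |e| ≤ B / r ^ 3 := by
    have : e = (2 * r ^ 2 * s - V) / (2 * r ^ 2) := by rw [he]; field_simp
    rw [this, abs_div, abs_of_pos (by positivity : 0 < 2 * r ^ 2), div_le_iff₀ (by positivity)]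
    refine hs.trans_eq ?_
    field_simp
  set d := 1 / (2 * r ^ 2 * (n + 1)) with hd
  have hd0 : 0 < d := by positivity
  have hnum : |(1 + d) ^ 2 * r ^ 2 - r' ^ 2| ≤ 1 / n ^ 2 := by
    have e1 : (1 + d) ^ 2 * r ^ 2 - r' ^ 2 =
        (n + 1)⁻¹ + 1 / (4 * r ^ 2 * (n + 1) ^ 2) - (r' ^ 2 - r ^ 2) := by
      rw [hd]; field_simp; ring
    have e2 : 1 / (4 * r ^ 2 * (n + 1) ^ 2) ≤ 1 / n ^ 2 := by
      apply one_div_le_one_div_of_le (by positivity)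
      nlinarith [one_le_pow₀ hr (n := 2), sq_nonneg (n + 1)]
    have e3 : 0 < 1 / (4 * r ^ 2 * (n + 1) ^ 2) := by positivity
    have e4 : n⁻¹ - (n + 1)⁻¹ ≤ 1 / n ^ 2 := by
      rw [show n⁻¹ - (n + 1)⁻¹ = 1 / (n * (n + 1)) by field_simp; ring]
      apply one_div_le_one_div_of_le (by positivity); nlinarith
    rw [e1, abs_le]
    constructor <;> linarith
  have hbr : |(1 + d) / r' - 1 / r| ≤ 1 / (n ^ 2 * r ^ 3) := by
    have e1 : (1 + d) / r' - 1 / r =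
        ((1 + d) ^ 2 * r ^ 2 - r' ^ 2) / (((1 + d) * r + r') * (r * r')) := by
      field_simp; ring
    rw [e1, abs_div, abs_of_pos (by positivity : 0 < ((1 + d) * r + r') * (r * r')),
      div_le_iff₀ (by positivity)]
    refine hnum.trans ?_
    rw [show 1 / (n ^ 2 * r ^ 3) * (((1 + d) * r + r') * (r * r')) =
      1 / n ^ 2 * ((((1 + d) * r + r') * (r * r')) / r ^ 3) by field_simp]
    refine le_mul_of_one_le_right (by positivity) ?_
    rw [one_le_div (by positivity)]
    have : r * (r * r) ≤ ((1 + d) * r + r') * (r * r') := by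
      apply mul_le_mul _ (mul_le_mul_of_nonneg_left hr' hr0.le) (by positivity) (by positivity)
      nlinarith
    nlinarith
  have hmain : V' / r' - V / r = V * ((1 + d) / r' - 1 / r) + e / ((n + 1) * r') := by
    rw [hV', he, hd]; field_simp; ring
  rw [hmain]
  refine (abs_add_le _ _).trans ?_
  have p1 : |V * ((1 + d) / r' - 1 / r)| ≤ 4 * B / (n * r ^ 4) := by
    rw [abs_mul]
    refine (mul_le_mul hV hbr (abs_nonneg _) (by positivity)).trans ?_
    rw [show 4 * B * r * (1 / (n ^ 2 * r ^ 3)) = 4 * B / (n * r ^ 4) * (r ^ 2 / n) by field_simp]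
    exact mul_le_of_le_one_right (by positivity) ((div_le_one hn0).2 hrn)
  have p2 : |e / ((n + 1) * r')| ≤ B / (n * r ^ 4) := by
    rw [abs_div, abs_of_pos (by positivity : 0 < (n + 1) * r')]
    rw [show B / (n * r ^ 4) = B / r ^ 3 / (n * r) by field_simp]
    exact div_le_div₀ (by positivity) he1 (by positivity) (by nlinarith)
  calc _ ≤ 4 * B / (n * r ^ 4) + B / (n * r ^ 4) := add_le_add p1 p2
    _ = _ := by ring

theorem exists_sqrt_asymptotic {a : ℕ → ℝ} {B : ℝ} (hB : 0 < B) (ha : ∀ m, 0 ≤ a m)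
    (h : ∀ x : ℝ, Real.exp 1 ≤ x →
      ∑ m ∈ Finset.Ioc 0 ⌊x⌋₊, a m ≤ B * (x / Real.log x ^ (1 / 2 : ℝ)) ∧
      |2 * Real.log x * ∑ m ∈ Finset.Ioc 0 ⌊x⌋₊, a m - x * ∑ m ∈ Finset.Ioc 0 ⌊x⌋₊, a m / m| ≤
        B * (x / Real.log x ^ (1 / 2 : ℝ))) :
    ∃ κ : ℝ, ∀ N : ℕ, 3 ≤ N →
      |∑ m ∈ Finset.Ioc 0 N, a m / m - κ * √(Real.log N)| ≤ 21 * B / √(Real.log N) ∧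
      |∑ m ∈ Finset.Ioc 0 N, a m - κ / 2 * (N / √(Real.log N))| ≤ 11 * B * (N / √(Real.log N) ^ 3) := by
  set S : ℕ → ℝ := fun N => ∑ m ∈ Finset.Ioc 0 N, a m with hS
  set V : ℕ → ℝ := fun N => ∑ m ∈ Finset.Ioc 0 N, a m * (m : ℝ)⁻¹ - S N * (N : ℝ)⁻¹ with hVd
  have hS0 : ∀ N, 0 ≤ S N := fun N => Finset.sum_nonneg fun m _ => ha m
  have facts : ∀ N : ℕ, 3 ≤ N → (1 : ℝ) ≤ √(Real.log N) ∧ S N / N ≤ B / √(Real.log N) ∧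
      |2 * √(Real.log N) ^ 2 * (S N / N) - V N| ≤ 2 * B / √(Real.log N) := by
    intro N hN
    have hl := one_le_log_of_three_le hN
    have hN0 : (0 : ℝ) < N := by exact_mod_cast (by omega : 0 < N)
    obtain ⟨p1, p2⟩ := h N (by rwa [← Real.le_log_iff_exp_le hN0])
    rw [Nat.floor_natCast, ← Real.sqrt_eq_rpow] at p1 p2
    have hr : 1 ≤ √(Real.log N) := Real.one_le_sqrt.2 hl
    have hr0 : 0 < √(Real.log N) := by linarith
    have q1 : S N / N ≤ B / √(Real.log N) := by
      rw [div_le_iff₀ hN0]; refine p1.trans_eq ?_; field_simp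
    refine ⟨hr, q1, ?_⟩
    rw [Real.sq_sqrt (by linarith)]
    have q2 : |2 * Real.log N * (S N / N) - ∑ m ∈ Finset.Ioc 0 N, a m * (m : ℝ)⁻¹| ≤
        B / √(Real.log N) := by
      have : 2 * Real.log N * (S N / N) - ∑ m ∈ Finset.Ioc 0 N, a m * (m : ℝ)⁻¹ =
          (2 * Real.log N * S N - N * ∑ m ∈ Finset.Ioc 0 N, a m / m) / N := by
        simp only [div_eq_mul_inv]; field_simp
      rw [this, abs_div, abs_of_pos hN0, div_le_iff₀ hN0]
      refine p2.trans_eq ?_; field_simp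
    have q3 : 0 ≤ S N / N := div_nonneg (hS0 N) hN0.le
    have e : 2 * B / √(Real.log N) = B / √(Real.log N) + B / √(Real.log N) := by ring
    have e' : V N = ∑ m ∈ Finset.Ioc 0 N, a m * (m : ℝ)⁻¹ - S N / N := by simp [hVd, div_eq_mul_inv]
    rw [e, e']
    rw [abs_le] at q2 ⊢
    constructor <;> linarith [q2.1, q2.2]
  have hVb : ∀ N : ℕ, 3 ≤ N → |V N| ≤ 4 * B * √(Real.log N) := by
    intro N hN
    obtain ⟨f1, f2, f3⟩ := facts N hN
    set r := √(Real.log N)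
    have hr0 : 0 < r := by linarith
    have q3 : 0 ≤ S N / N := div_nonneg (hS0 N) (by positivity)
    have g1 : 2 * r ^ 2 * (S N / N) ≤ 2 * B * r := by
      calc _ ≤ 2 * r ^ 2 * (B / r) := by gcongr
        _ = _ := by field_simp
    have g2 : 2 * B / r ≤ 2 * B * r := by
      rw [div_le_iff₀ hr0]; nlinarith [mul_pos hB hr0]
    have g3 : 0 ≤ 2 * r ^ 2 * (S N / N) := by positivity
    rw [abs_le] at f3 ⊢
    constructor <;> linarith [f3.1, f3.2]
  have hstep : ∀ N : ℕ, 3 ≤ N →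
      |V (N + 1) / √(Real.log ((N + 1 : ℕ) : ℝ)) - V N / √(Real.log N)| ≤
        20 * B / Real.log N - 20 * B / Real.log ((N + 1 : ℕ) : ℝ) := by
    intro N hN
    obtain ⟨f1, f2, f3⟩ := facts N hN
    have hl := one_le_log_of_three_le hN
    obtain ⟨i1, i2⟩ := inv_succ_le_log_sub (N := N) (by omega)
    have hn1 : (3 : ℝ) ≤ N := by exact_mod_cast hN
    have hl' : Real.log N ≤ Real.log ((N + 1 : ℕ) : ℝ) :=
      Real.log_le_log (by linarith) (by push_cast; linarith)
    have key := growth_step (B := B) (n := N) (r := √(Real.log N))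
      (r' := √(Real.log ((N + 1 : ℕ) : ℝ))) (V := V N) (V' := V (N + 1)) (s := S N / N) (by linarith) f1
      (Real.sqrt_le_sqrt hl') hB (by rwa [Real.sq_sqrt (by linarith), Real.sq_sqrt (by linarith)])
      (by rwa [Real.sq_sqrt (by linarith), Real.sq_sqrt (by linarith)])
      (by rw [Real.sq_sqrt (by linarith)]; exact (Real.log_le_sub_one_of_pos (by linarith)).trans (by linarith))
      (hVb N hN) f3 (by
        simp only [hVd, hS, sum_Ioc_succ]
        push_cast
        field_simp
        ring)
    refine key.trans ?_
    rw [show √(Real.log N) ^ 4 = Real.log N ^ 2 by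
      rw [show (4 : ℕ) = 2 * 2 from rfl, pow_mul, Real.sq_sqrt (by linarith)]]
    set l := Real.log N
    set l' := Real.log ((N + 1 : ℕ) : ℝ)
    have h2 : l' ≤ 2 * l := by
      have : (N : ℝ)⁻¹ ≤ 1 := inv_le_one_of_one_le₀ (by linarith)
      linarith
    have e : 20 * B / l - 20 * B / l' = 20 * B * (l' - l) / (l * l') := by
      have : l ≠ 0 := by linarith
      have : l' ≠ 0 := by linarith
      field_simp
    have hlp : 0 < l := by linarith
    have hlp' : 0 < l' := by linarith
    rw [e, div_le_div_iff₀ (by positivity) (by positivity)]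
    have k1 : 1 ≤ (l' - l) * (2 * N) := by
      have := mul_le_mul_of_nonneg_right i1 (by positivity : (0 : ℝ) ≤ 2 * N)
      refine le_trans ?_ this
      rw [inv_mul_eq_div, one_le_div (by positivity)]; linarith
    calc 5 * B * (l * l') ≤ 5 * B * (l * (2 * l)) * 1 := by rw [mul_one]; gcongr
      _ ≤ 5 * B * (l * (2 * l)) * ((l' - l) * (2 * N)) := by gcongr
      _ = _ := by ring
  obtain ⟨κ, hκ⟩ := exists_limit_of_succ (u := fun N : ℕ => V N / √(Real.log N))
    (v := fun N : ℕ => 20 * B / Real.log N) hstep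
    (fun N => div_nonneg (by positivity) (Real.log_natCast_nonneg N))
    (tendsto_const_nhds.div_atTop (Real.tendsto_log_atTop.comp tendsto_natCast_atTop_atTop))
  refine ⟨κ, fun N hN => ?_⟩
  obtain ⟨f1, f2, f3⟩ := facts N hN
  have hk := hκ N hN
  have hl := one_le_log_of_three_le hN
  have hN0 : (0 : ℝ) < N := by exact_mod_cast (by omega : 0 < N)
  have hq3 : 0 ≤ S N / N := div_nonneg (hS0 N) hN0.le
  rw [← Real.sq_sqrt (by linarith : 0 ≤ Real.log N)] at hk
  simp only [Real.sqrt_sq (Real.sqrt_nonneg _)] at hk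
  set r := √(Real.log N)
  have hr0 : 0 < r := by linarith
  have hV1 : |V N - κ * r| ≤ 20 * B / r := by
    have : V N - κ * r = (V N / r - κ) * r := by field_simp
    rw [this, abs_mul, abs_of_pos hr0, ← le_div_iff₀ hr0]
    refine hk.trans_eq ?_
    field_simp
  constructor
  · have e' : ∑ m ∈ Finset.Ioc 0 N, a m / m = V N + S N / N := by simp [hVd, div_eq_mul_inv]
    have e2 : 21 * B / r = 20 * B / r + B / r := by ring
    rw [e', e2]
    rw [abs_le] at hV1 ⊢
    constructor <;> linarith [hV1.1, hV1.2]
  · have e : S N - κ / 2 * (N / r) = N * ((2 * r ^ 2 * (S N / N) - V N) + (V N - κ * r)) / (2 * r ^ 2) := by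
      field_simp; ring
    change |S N - κ / 2 * (N / r)| ≤ _
    rw [e, abs_div, abs_mul, abs_of_pos hN0, abs_of_pos (by positivity : 0 < 2 * r ^ 2),
      div_le_iff₀ (by positivity)]
    calc (N : ℝ) * |2 * r ^ 2 * (S N / N) - V N + (V N - κ * r)|
        ≤ N * (2 * B / r + 20 * B / r) := by gcongr; exact (abs_add_le _ _).trans (add_le_add f3 hV1)
      _ = _ := by field_simp; ring

end Endgame
end Bernays

namespace Bernays
open ArithmeticFunction ArithmeticFunction.Moebius ArithmeticFunction.zeta

section Leading

variable {G : Type*} [CommGroup G] [Finite G] {S : ℕ → Prop} {c : ℕ → G}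

theorem cmc_one_nonneg (m : ℕ) : 0 ≤ cmc S c (1 : G →* ℝ) m := by
  by_cases h : AllP S m
  · rw [h.cmc_eq]; simp
  · rw [cmc_eq_zero _ h]

theorem sum_cconv_one_div_le (N : ℕ) :
    ∑ m ∈ Finset.Ioc 0 N, cconv S c (1 : G →* ℝ) m / m ≤
      (∑ m ∈ Finset.Ioc 0 N, cmc S c (1 : G →* ℝ) m / m) ^ 2 := by
  have h := sum_conv (af (cmc S c (1 : G →* ℝ))) (af (cmc S c (1 : G →* ℝ))) (fun m => (m : ℝ)⁻¹) N
  rw [cconv_real]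
  simp only [div_eq_mul_inv]
  rw [h, pow_two, Finset.sum_mul]
  refine Finset.sum_le_sum fun d _ => ?_
  rw [af_apply, mul_assoc]
  refine mul_le_mul_of_nonneg_left ?_ (cmc_one_nonneg d)
  rw [Finset.mul_sum]
  refine (Finset.sum_le_sum_of_subset_of_nonneg
    (Finset.Ioc_subset_Ioc_right (Nat.div_le_self N d)) fun k _ _ => ?_).trans_eq ?_
  · exact mul_nonneg (cmc_one_nonneg k) (by positivity)
  · refine Finset.sum_congr rfl fun k _ => ?_
    rw [af_apply]
    push_cast
    rw [mul_inv]; ring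

theorem exists_log_le_sum_sq {K C : ℝ}
    (hT : ∀ (g : G) (x : ℝ), 0 < x → |((prs S c g x).ncard : ℝ) - K * x| ≤ C * x ^ (2 / 3 : ℝ)) :
    ∃ M : ℝ, ∀ N : ℕ, 1 ≤ N → Nat.card G * K * Real.log N - M ≤
      (∑ m ∈ Finset.Ioc 0 N, cmc S c (1 : G →* ℝ) m / m) ^ 2 := by
  classical
  have := Fintype.ofFinite G
  have h1 : ∀ N : ℕ, 1 ≤ N →
      |∑ k ∈ Finset.Ioc 0 N, (cconv S c (1 : G →* ℝ) k - Nat.card G * K)| ≤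
      Nat.card G * C * (N : ℝ) ^ (2 / 3 : ℝ) := fun N hN => by
    have := norm_sum_cconv_sub_le hT (1 : G →* ℝ) N hN
    rw [sum_hom_units, if_pos rfl, ← Nat.card_eq_fintype_card] at this
    rw [Finset.sum_sub_distrib, Finset.sum_const, Nat.card_Ioc, nsmul_eq_mul, Nat.sub_zero,
      mul_comm (N : ℝ), mul_assoc]
    exact this
  have hC : 0 ≤ C := by
    have := hT 1 1 one_pos
    rw [Real.one_rpow] at this
    linarith [abs_nonneg (((prs S c 1 1).ncard : ℝ) - K * 1)]
  obtain ⟨c₀, hc⟩ := exists_sum_div_limit h1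
  obtain ⟨γ, hγ⟩ := exists_harmonic_limit
  refine ⟨|c₀| + 4 * (Nat.card G * C) + |Nat.card G * K| * (|γ| + 1), fun N hN => ?_⟩
  refine le_trans ?_ (sum_cconv_one_div_le N)
  have e : ∑ m ∈ Finset.Ioc 0 N, cconv S c (1 : G →* ℝ) m / m =
      (∑ m ∈ Finset.Ioc 0 N, (cconv S c (1 : G →* ℝ) m - Nat.card G * K) / m - c₀) + c₀ +
      Nat.card G * K * (∑ m ∈ Finset.Ioc 0 N, (m : ℝ)⁻¹ - Real.log N - γ) +
      Nat.card G * K * γ + Nat.card G * K * Real.log N := by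
    have : ∑ m ∈ Finset.Ioc 0 N, cconv S c (1 : G →* ℝ) m / m =
      ∑ m ∈ Finset.Ioc 0 N, (cconv S c (1 : G →* ℝ) m - Nat.card G * K) / m +
        Nat.card G * K * ∑ m ∈ Finset.Ioc 0 N, (m : ℝ)⁻¹ := by
      rw [Finset.mul_sum, ← Finset.sum_add_distrib]
      exact Finset.sum_congr rfl fun k _ => by ring
    rw [this]; ring
  rw [e]
  have hN1 : (1 : ℝ) ≤ N := by exact_mod_cast hN
  have a1 := (abs_le.1 ((hc N hN).trans (mul_le_of_le_one_right (by positivity)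
    (Real.rpow_le_one_of_one_le_of_nonpos hN1 (by norm_num))))).1
  have a2 : |Nat.card G * K * (∑ m ∈ Finset.Ioc 0 N, (m : ℝ)⁻¹ - Real.log N - γ)| ≤
      |Nat.card G * K| * 1 := by
    rw [abs_mul]
    exact mul_le_mul_of_nonneg_left ((hγ N hN).trans (inv_le_one_of_one_le₀ hN1)) (abs_nonneg _)
  have a3 := (abs_le.1 a2).1
  have a4 := neg_abs_le c₀
  have a5 := neg_abs_le (Nat.card G * K * γ)
  rw [abs_mul] at a5
  linarith

theorem div_sqrt_log_sub_le {x : ℝ} (hx : 3 ≤ x) :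
    |(⌊x⌋₊ : ℝ) / √(Real.log ⌊x⌋₊) - x / √(Real.log x)| ≤ x / Real.log x ^ (3 / 4 : ℝ) ∧
      (⌊x⌋₊ : ℝ) / √(Real.log ⌊x⌋₊) ^ 3 ≤ 2 * (x / Real.log x ^ (3 / 4 : ℝ)) := by
  set N := ⌊x⌋₊
  have hN : 3 ≤ N := Nat.le_floor (by exact_mod_cast hx)
  have hl := one_le_log_of_three_le hN
  have hNx : (N : ℝ) ≤ x := Nat.floor_le (by linarith)
  have hxN : x < N + 1 := Nat.lt_floor_add_one x
  have hN0 : (3 : ℝ) ≤ N := by exact_mod_cast hN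
  have hL : Real.log N ≤ Real.log x := Real.log_le_log (by linarith) hNx
  have hL2 : Real.log x - Real.log N ≤ (N : ℝ)⁻¹ := by
    refine le_trans ?_ (inv_succ_le_log_sub (N := N) (by omega)).2
    gcongr
    push_cast; exact hxN.le
  have hLx : Real.log x ≤ x := (Real.log_le_sub_one_of_pos (by linarith)).trans (by linarith)
  have hL1 : 1 ≤ Real.log x := hl.trans hL
  have h34 : Real.log x ^ (3 / 4 : ℝ) ≤ Real.log x := by
    conv_rhs => rw [← Real.rpow_one (Real.log x)]
    exact Real.rpow_le_rpow_of_exponent_le hL1 (by norm_num)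
  have hpos : 0 < Real.log x ^ (3 / 4 : ℝ) := Real.rpow_pos_of_pos (by linarith) _
  have hinv : (N : ℝ)⁻¹ ≤ 1 := inv_le_one_of_one_le₀ (by linarith)
  set l := Real.log N
  set L := Real.log x
  have hr : 1 ≤ √l := Real.one_le_sqrt.2 hl
  have hrR : √l ≤ √L := Real.sqrt_le_sqrt hL
  have hR : 1 ≤ √L := hr.trans hrR
  constructor
  · refine le_trans ?_ ((one_le_div hpos).2 (h34.trans hLx))
    have e : (N : ℝ) / √l - x / √L = N * (√L - √l) / (√l * √L) - (x - N) / √L := by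
      have : √l ≠ 0 := by linarith
      have : √L ≠ 0 := by linarith
      field_simp; ring
    have h1 : √L - √l ≤ (N : ℝ)⁻¹ := by
      have : (√L - √l) * (√L + √l) = L - l := by
        rw [← Real.sq_sqrt (by linarith : 0 ≤ L), ← Real.sq_sqrt (by linarith : 0 ≤ l)]
        simp only [Real.sqrt_sq (Real.sqrt_nonneg _)]
        ring
      nlinarith
    have h2 : N * (√L - √l) ≤ 1 := by
      calc _ ≤ (N : ℝ) * (N : ℝ)⁻¹ := by gcongr
        _ = 1 := mul_inv_cancel₀ (by linarith)
    have h3 : N * (√L - √l) / (√l * √L) ≤ 1 := by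
      rw [div_le_one (by positivity)]; nlinarith
    have h4 : (x - N) / √L ≤ 1 := by
      rw [div_le_one (by positivity)]; linarith
    have h5 : 0 ≤ N * (√L - √l) / (√l * √L) :=
      div_nonneg (mul_nonneg (by linarith) (by linarith)) (by positivity)
    have h6 : 0 ≤ (x - N) / √L := div_nonneg (by linarith) (by positivity)
    rw [e, abs_le]; constructor <;> linarith
  · rw [← mul_div_assoc, div_le_div_iff₀ (by positivity) hpos]
    have h1 : L ≤ 2 * √l ^ 3 := by
      have : √l ^ 2 = l := Real.sq_sqrt (by linarith)
      have : √l ^ 3 = l * √l := by rw [pow_succ, this]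
      nlinarith
    calc (N : ℝ) * L ^ (3 / 4 : ℝ) ≤ x * (2 * √l ^ 3) :=
          mul_le_mul hNx (h34.trans h1) hpos.le (by linarith)
      _ = _ := by ring

theorem exists_unit_asymptotic {K C : ℝ} (hK : 0 < K)
    (hT : ∀ (g : G) (x : ℝ), 0 < x → |((prs S c g x).ncard : ℝ) - K * x| ≤ C * x ^ (2 / 3 : ℝ)) :
    ∃ κ : ℝ, 0 < κ ∧ ∃ B : ℝ, 0 < B ∧ ∀ x : ℝ, 3 ≤ x →
      |∑ m ∈ Finset.Ioc 0 ⌊x⌋₊, cmc S c (1 : G →* ℝ) m - κ * (x / √(Real.log x))| ≤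
        B * (x / Real.log x ^ (3 / 4 : ℝ)) := by
  obtain ⟨B, hB, h⟩ := exists_unit_sum_relation hK hT
  obtain ⟨κ, hκ⟩ := exists_sqrt_asymptotic hB cmc_one_nonneg h
  obtain ⟨M, hM⟩ := exists_log_le_sum_sq hT
  have hn : (0 : ℝ) < Nat.card G := by exact_mod_cast Nat.card_pos
  have hκ0 : 0 < κ := by
    by_contra hneg
    push Not at hneg
    have ht : Tendsto (fun N : ℕ => Nat.card G * K * Real.log N - M) atTop atTop :=
      tendsto_atTop_add_const_right _ _ ((Real.tendsto_log_atTop.comp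
        tendsto_natCast_atTop_atTop).const_mul_atTop (mul_pos hn hK))
    obtain ⟨N, hN, hN3⟩ := ((ht.eventually_gt_atTop ((21 * B) ^ 2)).and
      (eventually_ge_atTop 3)).exists
    have h1 := hM N (by omega)
    have hr : 1 ≤ √(Real.log N) := Real.one_le_sqrt.2 (one_le_log_of_three_le hN3)
    have h2 := (abs_le.1 (hκ N hN3).1).2
    have h3 : 21 * B / √(Real.log N) ≤ 21 * B := div_le_self (by positivity) hr
    have h4 : κ * √(Real.log N) ≤ 0 := mul_nonpos_of_nonpos_of_nonneg hneg (by linarith)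
    have h5 : 0 ≤ ∑ m ∈ Finset.Ioc 0 N, cmc S c (1 : G →* ℝ) m / m :=
      Finset.sum_nonneg fun m _ => div_nonneg (cmc_one_nonneg m) (by positivity)
    have h6 : (∑ m ∈ Finset.Ioc 0 N, cmc S c (1 : G →* ℝ) m / m) ^ 2 ≤ (21 * B) ^ 2 :=
      pow_le_pow_left₀ h5 (by linarith) 2
    linarith
  refine ⟨κ / 2, by positivity, 22 * B + κ / 2, by positivity, fun x hx => ?_⟩
  obtain ⟨p1, p2⟩ := div_sqrt_log_sub_le hx
  have hN : 3 ≤ ⌊x⌋₊ := Nat.le_floor (by exact_mod_cast hx)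
  have q := (hκ _ hN).2
  set N := ⌊x⌋₊
  have e : ∑ m ∈ Finset.Ioc 0 N, cmc S c (1 : G →* ℝ) m - κ / 2 * (x / √(Real.log x)) =
      (∑ m ∈ Finset.Ioc 0 N, cmc S c (1 : G →* ℝ) m - κ / 2 * (N / √(Real.log N))) +
        κ / 2 * (N / √(Real.log N) - x / √(Real.log x)) := by ring
  rw [e]
  refine (abs_add_le _ _).trans ?_
  rw [abs_mul, abs_of_pos (by positivity : 0 < κ / 2)]
  calc _ ≤ 11 * B * (2 * (x / Real.log x ^ (3 / 4 : ℝ))) + κ / 2 * (x / Real.log x ^ (3 / 4 : ℝ)) :=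
        add_le_add (q.trans (mul_le_mul_of_nonneg_left p2 (by positivity)))
          (mul_le_mul_of_nonneg_left p1 (by positivity))
    _ = _ := by ring

end Leading
end Bernays

namespace Bernays

section Characters

variable {G : Type*} [CommGroup G] [Finite G]

theorem exists_complex_characters (G : Type*) [CommGroup G] [Finite G] [DecidableEq G] :
    ∃ X : Finset (G →* ℂ), 1 ∈ X ∧
      ∀ g, ∑ χ ∈ X, χ g = if g = 1 then (Nat.card G : ℂ) else 0 := by
  classical
  have := Fintype.ofFinite (Additive G)
  let chr : AddChar (Additive G) ℂ → (G →* ℂ) := fun ψ =>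
    { toFun := fun g => ψ (Additive.ofMul g)
      map_one' := by rw [ofMul_one, AddChar.map_zero_eq_one]
      map_mul' := fun x y => by rw [ofMul_mul, AddChar.map_add_eq_mul] }
  have hinj : Function.Injective chr := fun ψ φ h => by
    ext x
    exact DFunLike.congr_fun h (Additive.toMul x)
  refine ⟨Finset.univ.image chr, Finset.mem_image.2 ⟨1, Finset.mem_univ _, ?_⟩, fun g => ?_⟩
  · ext g; rfl
  · rw [Finset.sum_image fun _ _ _ _ h => hinj h]
    have h := AddChar.sum_apply_eq_ite (Additive.ofMul g)
    rw [← Nat.card_eq_fintype_card] at h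
    simp only [ofMul_eq_zero] at h
    exact h

/-- The subgroup of squares. -/
def sqs (G : Type*) [CommGroup G] : Subgroup G := (powMonoidHom 2).range

theorem sq_mem_sqs (g : G) : g ^ 2 ∈ sqs G := ⟨g, rfl⟩

theorem exists_real_characters (G : Type*) [CommGroup G] [Finite G] [DecidableEq (G ⧸ sqs G)] :
    ∃ X : Finset (G →* ℝ), 1 ∈ X ∧
      ∀ g : G, ∑ ε ∈ X, ε g = if (g : G ⧸ sqs G) = 1 then (Nat.card (G ⧸ sqs G) : ℝ) else 0 := by
  classical
  obtain ⟨X, hX1, hX⟩ := exists_complex_characters (G ⧸ sqs G)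
  have hsq : ∀ (χ : G ⧸ sqs G →* ℂ) (q : G ⧸ sqs G), χ q = 1 ∨ χ q = -1 := fun χ q => by
    rw [← sq_eq_one_iff, ← map_pow]
    obtain ⟨g, rfl⟩ := QuotientGroup.mk_surjective q
    rw [← QuotientGroup.mk_pow, (QuotientGroup.eq_one_iff _).2 (sq_mem_sqs g), map_one]
  have hre : ∀ (χ : G ⧸ sqs G →* ℂ) (q : G ⧸ sqs G), ((χ q).re : ℂ) = χ q := fun χ q => by
    rcases hsq χ q with h | h <;> simp [h]
  let r : (G ⧸ sqs G →* ℂ) → (G →* ℝ) := fun χ =>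
    { toFun := fun g => (χ g).re
      map_one' := by simp
      map_mul' := fun x y => by
        have : ((χ ((x * y : G) : G ⧸ sqs G)).re : ℂ) = ((χ x).re * (χ y).re : ℝ) := by
          rw [Complex.ofReal_mul, hre, hre, hre, QuotientGroup.mk_mul, map_mul]
        exact_mod_cast this }
  have hr : ∀ χ g, r χ g = (χ (g : G ⧸ sqs G)).re := fun _ _ => rfl
  have hinj : Function.Injective r := fun χ φ h => by
    ext g
    change χ (g : G ⧸ sqs G) = φ (g : G ⧸ sqs G)
    rw [← hre, ← hre φ, ← hr, ← hr, h]
  refine ⟨X.image r, Finset.mem_image.2 ⟨1, hX1, ?_⟩, fun g => ?_⟩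
  · ext g; simp [hr]
  · rw [Finset.sum_image fun _ _ _ _ h => hinj h]
    have h := congrArg Complex.re (hX (g : G ⧸ sqs G))
    rw [Complex.re_sum] at h
    simp only [hr, h]
    split_ifs <;> simp

variable {S : ℕ → Prop} {c : ℕ → G}

open Classical in
/-- The number of `S`-integers up to `N` whose class modulo squares lies in `A`. -/
noncomputable def cosetCount (S : ℕ → Prop) (c : ℕ → G) (A : Set (G ⧸ sqs G)) (N : ℕ) : ℕ :=
  ((Finset.Ioc 0 N).filter fun m => AllP S m ∧ ((pext c m : G) : G ⧸ sqs G) ∈ A).card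

theorem cosetCount_eq_sum (A : Set (G ⧸ sqs G)) (N : ℕ) :
    cosetCount S c A N = ∑ q ∈ (Set.toFinite A).toFinset, cosetCount S c {q} N := by
  classical
  unfold cosetCount
  rw [← Finset.card_biUnion]
  · congr 1
    ext m
    simp only [Finset.mem_filter, Finset.mem_biUnion, Set.Finite.mem_toFinset,
      Set.mem_singleton_iff]
    constructor
    · rintro ⟨h1, h2, h3⟩; exact ⟨_, h3, h1, h2, rfl⟩
    · rintro ⟨q, hq, h1, h2, h3⟩; exact ⟨h1, h2, h3 ▸ hq⟩
  · intro q _ q' _ hne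
    rw [Function.onFun, Finset.disjoint_left]
    intro m h1 h2
    simp only [Finset.mem_filter, Set.mem_singleton_iff] at h1 h2
    exact hne (h1.2.2.symm.trans h2.2.2)

theorem exists_single_coset {K C : ℝ} (hK : 0 < K)
    (hT : ∀ (g : G) (x : ℝ), 0 < x → |((prs S c g x).ncard : ℝ) - K * x| ≤ C * x ^ (2 / 3 : ℝ)) :
    ∃ κ : ℝ, 0 < κ ∧ ∃ B : ℝ, 0 < B ∧ ∀ (q : G ⧸ sqs G) (x : ℝ), 3 ≤ x →
      |(cosetCount S c {q} ⌊x⌋₊ : ℝ) - κ * (x / √(Real.log x))| ≤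
        B * (x / Real.log x ^ (3 / 4 : ℝ)) := by
  classical
  obtain ⟨X, hX1, hX⟩ := exists_real_characters G
  obtain ⟨κ, hκ, B₁, hB₁, h1⟩ := exists_unit_asymptotic hK hT
  obtain ⟨B₂, hB₂, h2⟩ := exists_char_sum_le hK hT
  set n : ℝ := (Nat.card (G ⧸ sqs G) : ℝ) with hn
  have hn0 : 0 < n := by rw [hn]; exact_mod_cast Nat.card_pos
  refine ⟨κ / n, by positivity, (B₁ + X.card * B₂) / n, by positivity, fun q x hx => ?_⟩
  obtain ⟨e, rfl⟩ := QuotientGroup.mk_surjective q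
  set N := ⌊x⌋₊
  have hcount : n * (cosetCount S c {(e : G ⧸ sqs G)} N : ℝ) =
      ∑ ε ∈ X, ε e⁻¹ * ∑ m ∈ Finset.Ioc 0 N, cmc S c ε m := by
    simp_rw [Finset.mul_sum]
    rw [Finset.sum_comm, cosetCount, Finset.card_filter, Nat.cast_sum, Finset.mul_sum]
    refine Finset.sum_congr rfl fun m _ => ?_
    by_cases hm : AllP S m
    · simp only [hm.cmc_eq, ← map_mul, hX, hm, true_and, Set.mem_singleton_iff]
      simp only [QuotientGroup.mk_mul, QuotientGroup.mk_inv, inv_mul_eq_one]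
      by_cases h : (e : G ⧸ sqs G) = (pext c m : G)
      · rw [if_pos h.symm, if_pos h]; simp [hn]
      · rw [if_neg (fun h' => h h'.symm), if_neg h]; simp
    · simp [cmc_eq_zero _ hm, hm]
  rw [← Finset.add_sum_erase _ _ hX1] at hcount
  simp only [MonoidHom.one_apply, one_mul] at hcount
  have hxe : Real.exp 1 ≤ x := by linarith [Real.exp_one_lt_d9]
  have hL : 1 ≤ Real.log x := by rwa [Real.le_log_iff_exp_le (by linarith)]
  have hrest : |∑ ε ∈ X.erase 1, ε e⁻¹ * ∑ m ∈ Finset.Ioc 0 N, cmc S c ε m| ≤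
      X.card * (B₂ * (x / Real.log x ^ (3 / 4 : ℝ))) := by
    refine (Finset.abs_sum_le_sum_abs _ _).trans ?_
    refine (Finset.sum_le_card_nsmul _ _ (B₂ * (x / Real.log x ^ (3 / 4 : ℝ))) fun ε hε => ?_).trans ?_
    · rw [abs_mul, ← Real.norm_eq_abs (ε e⁻¹), norm_char_eq, one_mul]
      refine (h2 ε (Finset.ne_of_mem_erase hε) x hxe).trans ?_
      gcongr <;> norm_num [hL]
    · rw [nsmul_eq_mul]
      gcongr
      exact Finset.erase_subset _ _
  have e1 : (cosetCount S c {(e : G ⧸ sqs G)} N : ℝ) - κ / n * (x / √(Real.log x)) =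
      (n * (cosetCount S c {(e : G ⧸ sqs G)} N : ℝ) - κ * (x / √(Real.log x))) / n := by
    field_simp
  rw [e1, abs_div, abs_of_pos hn0, div_le_iff₀ hn0, hcount]
  have e2 : (B₁ + X.card * B₂) / n * (x / Real.log x ^ (3 / 4 : ℝ)) * n =
    B₁ * (x / Real.log x ^ (3 / 4 : ℝ)) + X.card * (B₂ * (x / Real.log x ^ (3 / 4 : ℝ))) := by
    field_simp
  rw [e2, add_sub_right_comm]
  exact (abs_add_le _ _).trans (add_le_add (h1 x hx) hrest)

theorem exists_coset_asymptotic {K C : ℝ} (hK : 0 < K)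
    (hT : ∀ (g : G) (x : ℝ), 0 < x → |((prs S c g x).ncard : ℝ) - K * x| ≤ C * x ^ (2 / 3 : ℝ)) :
    ∃ κ : ℝ, 0 < κ ∧ ∃ B : ℝ, 0 < B ∧ ∀ (A : Set (G ⧸ sqs G)) (x : ℝ), 3 ≤ x →
      |(cosetCount S c A ⌊x⌋₊ : ℝ) - A.ncard * κ * (x / √(Real.log x))| ≤
        B * (x / Real.log x ^ (3 / 4 : ℝ)) := by
  obtain ⟨κ, hκ, B, hB, h⟩ := exists_single_coset hK hT
  have hn : (0 : ℝ) < Nat.card (G ⧸ sqs G) := by exact_mod_cast Nat.card_pos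
  refine ⟨κ, hκ, Nat.card (G ⧸ sqs G) * B, by positivity, fun A x hx => ?_⟩
  have hL : 0 ≤ Real.log x := Real.log_nonneg (by linarith)
  rw [cosetCount_eq_sum, Set.ncard_eq_toFinset_card A, Nat.cast_sum, mul_assoc, ← nsmul_eq_mul,
    ← Finset.sum_const, ← Finset.sum_sub_distrib]
  refine (Finset.abs_sum_le_sum_abs _ _).trans ((Finset.sum_le_card_nsmul _ _ _
    fun q _ => h q x hx).trans ?_)
  rw [nsmul_eq_mul, mul_assoc, ← Set.ncard_eq_toFinset_card A]
  gcongr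
  exact Set.ncard_le_card A

end Characters
end Bernays

namespace Bernays

section Exceptional

variable {G : Type*} [CommGroup G] [Finite G] {S : ℕ → Prop} {c : ℕ → G}

theorem AllP.exists_weights [Fintype G] {s : ℕ} (hs : AllP S s) :
    ∃ w : G → ℂ, (∀ g, w g ≠ 0 → ∃ d, d ∣ s ∧ pext c d ^ 2 = g) ∧
      ∀ χ : G →* ℂ, ∑ g, w g * χ g = pext (fun p => (1 + χ (c p) ^ 2) / 2) s := by
  classical
  refine AllP.induction (P := fun s _ => ∃ w : G → ℂ, (∀ g, w g ≠ 0 → ∃ d, d ∣ s ∧ pext c d ^ 2 = g) ∧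
      ∀ χ : G →* ℂ, ∑ g, w g * χ g = pext (fun p => (1 + χ (c p) ^ 2) / 2) s) ?_ ?_ hs
  · refine ⟨fun g => if g = 1 then 1 else 0, fun g hg => ⟨1, dvd_rfl, ?_⟩, fun χ => ?_⟩
    · rw [ite_ne_right_iff] at hg
      rw [pext_one, one_pow, hg.1]
    · simp [pext_one]
  · rintro p a hp - ha ⟨w, h1, h2⟩
    refine ⟨fun g => (w g + w (g * (c p ^ 2)⁻¹)) / 2, fun g hg => ?_, fun χ => ?_⟩
    · by_cases hw : w g = 0
      · have hw' : w (g * (c p ^ 2)⁻¹) ≠ 0 := by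
          intro h; apply hg; simp [hw, h]
        obtain ⟨d, hd, e⟩ := h1 _ hw'
        refine ⟨p * d, mul_dvd_mul_left p hd, ?_⟩
        rw [pext_mul c hp.ne_zero (ne_zero_of_dvd_ne_zero ha.1 hd), pext_prime c hp, mul_pow, e, mul_comm,
          inv_mul_cancel_right]
      · obtain ⟨d, hd, e⟩ := h1 g hw
        exact ⟨d, hd.mul_left p, e⟩
    · rw [pext_mul _ hp.ne_zero ha.1, pext_prime _ hp, ← h2 χ]
      have e : ∑ g, w (g * (c p ^ 2)⁻¹) * χ g = χ (c p) ^ 2 * ∑ g, w g * χ g := by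
        rw [← Equiv.sum_comp (Equiv.mulRight (c p ^ 2)), Finset.mul_sum]
        refine Finset.sum_congr rfl fun g _ => ?_
        simp only [Equiv.coe_mulRight, mul_inv_cancel_right, map_mul, map_pow]
        ring
      calc ∑ g, (w g + w (g * (c p ^ 2)⁻¹)) / 2 * χ g
          = (∑ g, w g * χ g + ∑ g, w (g * (c p ^ 2)⁻¹) * χ g) / 2 := by
            rw [← Finset.sum_add_distrib, Finset.sum_div]
            exact Finset.sum_congr rfl fun g _ => by ring
        _ = _ := by rw [e]; ring

theorem AllP.hh_eq_normSq {s : ℕ} (hs : AllP S s) (χ : G →* ℂ) :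
    hh S c (χ ^ 2) s = Complex.normSq (pext (fun p => (1 + χ (c p) ^ 2) / 2) s) := by
  have hφ := map_pext (Complex.normSq : ℂ →* ℝ) (fun p => (1 + χ (c p) ^ 2) / 2) s
  simp only [MonoidHom.coe_coe] at hφ
  rw [hh, hs.cm_eq, hφ]
  refine pext_congr fun p _ _ => ?_
  have h : Complex.normSq (χ (c p) ^ 2) = 1 := by
    rw [Complex.normSq_eq_norm_sq, norm_pow, norm_char_eq, one_pow, one_pow]
  rw [Complex.normSq_div, Complex.normSq_add, h, one_mul, Complex.conj_re, Complex.normSq_one,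
    MonoidHom.pow_apply, show Complex.normSq 2 = 4 by norm_num]
  ring

/-- If the squares of the classes of the divisors of `s` miss some square, then some nontrivial
squared character is large at `s`. -/
theorem AllP.exists_char_of_missing {X : Finset (G →* ℂ)} (hX1 : 1 ∈ X)
    (hX : ∀ g, ∑ χ ∈ X, χ g = open Classical in if g = 1 then (Nat.card G : ℂ) else 0)
    {s : ℕ} (hs : AllP S s) {h : G} (hh' : h ∈ sqs G) (hmiss : ∀ d, d ∣ s → pext c d ^ 2 ≠ h) :
    ∃ χ ∈ X, χ ^ 2 ≠ 1 ∧ 1 / (X.card : ℝ) ^ 2 ≤ hh S c (χ ^ 2) s := by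
  classical
  have := Fintype.ofFinite G
  obtain ⟨w, hw, hF⟩ := hs.exists_weights (c := c)
  have hwh : w h = 0 := by
    by_contra hne
    obtain ⟨d, hd, e⟩ := hw h hne
    exact hmiss d hd e
  have hinv : ∑ χ ∈ X, χ h⁻¹ * ∑ g, w g * χ g = 0 := by
    simp_rw [Finset.mul_sum]
    rw [Finset.sum_comm]
    refine Finset.sum_eq_zero fun g _ => ?_
    have : ∑ χ ∈ X, χ h⁻¹ * (w g * χ g) = w g * ∑ χ ∈ X, χ (h⁻¹ * g) := by
      rw [Finset.mul_sum]; exact Finset.sum_congr rfl fun χ _ => by rw [map_mul]; ring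
    rw [this, hX]
    split_ifs with hg
    · rw [inv_mul_eq_one] at hg; rw [← hg, hwh, zero_mul]
    · rw [mul_zero]
  simp_rw [hF] at hinv
  by_contra hcon
  push Not at hcon
  have hc0 : (0 : ℝ) < X.card := by exact_mod_cast Finset.card_pos.2 ⟨1, hX1⟩
  have hsmall : ∀ χ ∈ X, χ ^ 2 ≠ 1 →
      ‖χ h⁻¹ * pext (fun p => (1 + χ (c p) ^ 2) / 2) s‖ < 1 / X.card := by
    intro χ hχ hne
    have h1 := hcon χ hχ hne
    rw [hs.hh_eq_normSq, Complex.normSq_eq_norm_sq, ← one_div_pow] at h1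
    rw [norm_mul, norm_char_eq, one_mul]
    exact lt_of_pow_lt_pow_left₀ 2 (by positivity) h1
  rw [← Finset.sum_filter_add_sum_filter_not X (fun χ => χ ^ 2 = 1)] at hinv
  have hone : ∀ χ ∈ X.filter (fun χ => χ ^ 2 = 1),
      χ h⁻¹ * pext (fun p => (1 + χ (c p) ^ 2) / 2) s = 1 := by
    intro χ hχ
    have h2 : ∀ g, χ g ^ 2 = 1 := fun g => DFunLike.congr_fun (Finset.mem_filter.1 hχ).2 g
    obtain ⟨y, rfl⟩ := hh'
    have e1 : χ ((powMonoidHom 2 : G →* G) y)⁻¹ = 1 := by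
      rw [powMonoidHom_apply, ← inv_pow, map_pow, h2]
    rw [e1, one_mul]
    simp only [h2]
    norm_num [pext]
  rw [Finset.sum_congr rfl hone, Finset.sum_const, nsmul_eq_mul, mul_one] at hinv
  have h3 : ((X.filter (fun χ => χ ^ 2 = 1)).card : ℝ) =
      ‖∑ χ ∈ X.filter (fun χ => ¬ χ ^ 2 = 1), χ h⁻¹ * pext (fun p => (1 + χ (c p) ^ 2) / 2) s‖ := by
    rw [← norm_neg, ← eq_neg_of_add_eq_zero_left hinv]; simp
  have hmem : (1 : G →* ℂ) ∈ X.filter (fun χ => χ ^ 2 = 1) :=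
    Finset.mem_filter.2 ⟨hX1, one_pow 2⟩
  have h4 : (1 : ℝ) ≤ (X.filter (fun χ => χ ^ 2 = 1)).card := by
    exact_mod_cast Finset.card_pos.2 ⟨1, hmem⟩
  have h5 : (X.filter (fun χ => ¬ χ ^ 2 = 1)).card < X.card := by
    apply Finset.card_lt_card
    rw [Finset.filter_ssubset]
    exact ⟨1, hX1, by simp⟩
  have h6 : ‖∑ χ ∈ X.filter (fun χ => ¬ χ ^ 2 = 1),
      χ h⁻¹ * pext (fun p => (1 + χ (c p) ^ 2) / 2) s‖ ≤
      (X.filter (fun χ => ¬ χ ^ 2 = 1)).card • (1 / (X.card : ℝ)) := by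
    refine (norm_sum_le _ _).trans (Finset.sum_le_card_nsmul _ _ _ fun χ hχ => ?_)
    obtain ⟨hx, hne⟩ := Finset.mem_filter.1 hχ
    exact (hsmall χ hx hne).le
  rw [← h3, nsmul_eq_mul, mul_one_div] at h6
  have h7 : ((X.filter (fun χ => ¬ χ ^ 2 = 1)).card : ℝ) / X.card < 1 := by
    rw [div_lt_one hc0]; exact_mod_cast h5
  linarith

open Classical in
/-- The number of `S`-integers up to `N` whose divisors do not realise all squares. -/
noncomputable def missCount (S : ℕ → Prop) (c : ℕ → G) (N : ℕ) : ℕ :=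
  ((Finset.Ioc 0 N).filter fun s => AllP S s ∧ ∃ h ∈ sqs G, ∀ d, d ∣ s → pext c d ^ 2 ≠ h).card

theorem exists_missCount_le {K C : ℝ} (hK : 0 < K)
    (hT : ∀ (g : G) (x : ℝ), 0 < x → |((prs S c g x).ncard : ℝ) - K * x| ≤ C * x ^ (2 / 3 : ℝ)) :
    ∃ B : ℝ, 0 < B ∧ ∀ x : ℝ, 3 ≤ x →
      (missCount S c ⌊x⌋₊ : ℝ) ≤ B * (x / Real.log x ^ (3 / 4 : ℝ)) := by
  classical
  obtain ⟨X, hX1, hX⟩ := exists_complex_characters G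
  obtain ⟨B, hB, h⟩ := exists_hh_bounds hK hT
  have hc0 : (0 : ℝ) < X.card := by exact_mod_cast Finset.card_pos.2 ⟨1, hX1⟩
  refine ⟨X.card ^ 2 * (X.card * B), by positivity, fun x hx => ?_⟩
  have hxe : Real.exp 1 ≤ x := by linarith [Real.exp_one_lt_d9]
  have hL : 0 ≤ Real.log x := Real.log_nonneg (by linarith)
  have hterm : ∀ s ∈ (Finset.Ioc 0 ⌊x⌋₊).filter
      (fun s => AllP S s ∧ ∃ h ∈ sqs G, ∀ d, d ∣ s → pext c d ^ 2 ≠ h),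
      1 / (X.card : ℝ) ^ 2 ≤ ∑ χ ∈ X.filter (fun χ => ¬ χ ^ 2 = 1), hh S c (χ ^ 2) s := by
    intro s hs
    obtain ⟨-, hs, g, hg, hm⟩ := Finset.mem_filter.1 hs
    obtain ⟨χ, hχ, hne, hle⟩ := hs.exists_char_of_missing hX1 (by convert hX) hg hm
    refine hle.trans (Finset.single_le_sum (f := fun χ : G →* ℂ => hh S c (χ ^ 2) s)
      (fun χ _ => (hh_mem _ _).1) (Finset.mem_filter.2 ⟨hχ, hne⟩))
  have h1 := Finset.card_nsmul_le_sum _ _ _ hterm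
  rw [nsmul_eq_mul, mul_one_div, div_le_iff₀ (by positivity)] at h1
  have h2 : ∑ s ∈ (Finset.Ioc 0 ⌊x⌋₊).filter
      (fun s => AllP S s ∧ ∃ h ∈ sqs G, ∀ d, d ∣ s → pext c d ^ 2 ≠ h),
      ∑ χ ∈ X.filter (fun χ => ¬ χ ^ 2 = 1), hh S c (χ ^ 2) s ≤
      X.card * (B * (x / Real.log x ^ (3 / 4 : ℝ))) := by
    refine (Finset.sum_le_sum_of_subset_of_nonneg (Finset.filter_subset _ _) fun s _ _ =>
      Finset.sum_nonneg fun χ _ => (hh_mem _ _).1).trans ?_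
    rw [Finset.sum_comm]
    refine (Finset.sum_le_card_nsmul _ _ (B * (x / Real.log x ^ (3 / 4 : ℝ))) fun χ hχ =>
      (h x hxe).2 _ (Finset.mem_filter.1 hχ).2).trans ?_
    rw [nsmul_eq_mul]
    gcongr
    exact Finset.filter_subset _ _
  calc _ ≤ _ := h1
    _ ≤ X.card * (B * (x / Real.log x ^ (3 / 4 : ℝ))) * X.card ^ 2 := by gcongr
    _ = _ := by ring

end Exceptional
end Bernays

namespace Bernays

section Combination

variable {G : Type*} [CommGroup G] [Finite G] {S : ℕ → Prop} {c : ℕ → G}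

/-- `rep` is governed by the class invariants: a product of an `S`-free `k` and an `S`-integer `s`
satisfies `rep` iff the class `h` is realised. -/
def Governs (S : ℕ → Prop) (c : ℕ → G) (Cl : ℕ → Set G) (h : G) (rep : ℕ → Prop) : Prop :=
  ∀ k s, AllP (fun p => ¬ S p) k → AllP S s →
    (rep (k * s) ↔ ∃ d, d ∣ s ∧ ∃ e ∈ Cl k, h = pext c s * (pext c d ^ 2)⁻¹ * e)

open Classical in
/-- The number of `S`-integers `s` up to `N` with `rep (k * s)`. -/
noncomputable def fibreCount (S : ℕ → Prop) (rep : ℕ → Prop) (k N : ℕ) : ℕ :=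
  ((Finset.Ioc 0 N).filter fun s => AllP S s ∧ rep (k * s)).card

/-- The classes modulo squares occurring in `Cl k`. -/
noncomputable def classNum (Cl : ℕ → Set G) (k : ℕ) : ℕ :=
  ((fun e : G => (e : G ⧸ sqs G)) '' Cl k).ncard

theorem fibreCount_le (rep : ℕ → Prop) (k N : ℕ) : fibreCount S rep k N ≤ N := by
  classical
  refine (Finset.card_filter_le _ _).trans ?_
  simp

theorem classNum_le (Cl : ℕ → Set G) (k : ℕ) : classNum Cl k ≤ Nat.card (G ⧸ sqs G) :=
  Set.ncard_le_card _

theorem ncard_coset_image (h : G) (Cl : ℕ → Set G) (k : ℕ) :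
    {q : G ⧸ sqs G | ∃ e ∈ Cl k, q = ((h * e⁻¹ : G) : G ⧸ sqs G)}.ncard = classNum Cl k := by
  have hinj : Function.Injective (fun q : G ⧸ sqs G => (h : G ⧸ sqs G) * q⁻¹) := fun a b hab => by
    simpa using hab
  rw [classNum, ← Set.ncard_image_of_injective ((fun e : G => (e : G ⧸ sqs G)) '' Cl k) hinj]
  congr 1
  ext q
  constructor
  · rintro ⟨e, he, rfl⟩
    exact ⟨_, ⟨e, he, rfl⟩, rfl⟩
  · rintro ⟨_, ⟨e, he, rfl⟩, rfl⟩
    exact ⟨e, he, rfl⟩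

theorem Governs.cosetCount_bounds {Cl : ℕ → Set G} {h : G} {rep : ℕ → Prop}
    (hrep : Governs S c Cl h rep) {k : ℕ} (hk : AllP (fun p => ¬ S p) k) (N : ℕ) :
    fibreCount S rep k N ≤
        cosetCount S c {q | ∃ e ∈ Cl k, q = ((h * e⁻¹ : G) : G ⧸ sqs G)} N ∧
      cosetCount S c {q | ∃ e ∈ Cl k, q = ((h * e⁻¹ : G) : G ⧸ sqs G)} N ≤
        fibreCount S rep k N + missCount S c N := by
  classical
  unfold fibreCount cosetCount missCount
  constructor
  · refine Finset.card_le_card fun s hs => ?_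
    obtain ⟨h0, hs, hr⟩ := Finset.mem_filter.1 hs
    obtain ⟨d, -, e, he, hh'⟩ := (hrep k s hk hs).1 hr
    refine Finset.mem_filter.2 ⟨h0, hs, e, he, ?_⟩
    rw [hh', QuotientGroup.eq]
    refine ⟨(pext c d)⁻¹, ?_⟩
    rw [powMonoidHom_apply]
    group
  · refine le_trans (Finset.card_le_card fun s hs => ?_) (Finset.card_union_le _ _)
    obtain ⟨h0, hs, e, he, hh'⟩ := Finset.mem_filter.1 hs
    rw [Finset.mem_union, Finset.mem_filter, Finset.mem_filter]
    by_cases hm : ∃ h ∈ sqs G, ∀ d, d ∣ s → pext c d ^ 2 ≠ h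
    · exact Or.inr ⟨h0, hs, hm⟩
    · push Not at hm
      refine Or.inl ⟨h0, hs, (hrep k s hk hs).2 ?_⟩
      rw [eq_comm, QuotientGroup.eq] at hh'
      obtain ⟨d, hd, hd'⟩ := hm _ hh'
      refine ⟨d, hd, e, he, ?_⟩
      rw [hd']
      simp

theorem exists_fibre_asymptotic {K C : ℝ} (hK : 0 < K)
    (hT : ∀ (g : G) (x : ℝ), 0 < x → |((prs S c g x).ncard : ℝ) - K * x| ≤ C * x ^ (2 / 3 : ℝ)) :
    ∃ κ : ℝ, 0 < κ ∧ ∃ B : ℝ, 0 < B ∧ ∀ (Cl : ℕ → Set G) (h : G) (rep : ℕ → Prop),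
      Governs S c Cl h rep → ∀ k, AllP (fun p => ¬ S p) k → ∀ y : ℝ, 3 ≤ y →
      |(fibreCount S rep k ⌊y⌋₊ : ℝ) - classNum Cl k * κ * (y / √(Real.log y))| ≤
        B * (y / Real.log y ^ (3 / 4 : ℝ)) := by
  obtain ⟨κ, hκ, B₁, hB₁, h1⟩ := exists_coset_asymptotic hK hT
  obtain ⟨B₂, hB₂, h2⟩ := exists_missCount_le hK hT
  refine ⟨κ, hκ, B₁ + B₂, by positivity, fun Cl h rep hrep k hk y hy => ?_⟩
  obtain ⟨b1, b2⟩ := hrep.cosetCount_bounds hk ⌊y⌋₊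
  have a1 := abs_le.1 (h1 {q | ∃ e ∈ Cl k, q = ((h * e⁻¹ : G) : G ⧸ sqs G)} y hy)
  rw [ncard_coset_image] at a1
  have a2 := h2 y hy
  have b1' := (Nat.cast_le (α := ℝ)).2 b1
  have b2' := (Nat.cast_le (α := ℝ)).2 b2
  push_cast at b2'
  have : (0 : ℝ) ≤ missCount S c ⌊y⌋₊ := Nat.cast_nonneg _
  rw [abs_le]
  constructor <;> linarith [a1.1, a1.2]

end Combination

section Scaling

set_option maxHeartbeats 400000 in
theorem scaled_term_bound {f : ℕ → ℝ} {α A B : ℝ} (hα : 0 ≤ α) (hαA : α ≤ A) (hB : 0 < B)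
    (hf0 : ∀ N, 0 ≤ f N) (hfN : ∀ N, f N ≤ N)
    (h : ∀ y : ℝ, 3 ≤ y → |f ⌊y⌋₊ - α * (y / √(Real.log y))| ≤ B * (y / Real.log y ^ (3 / 4 : ℝ)))
    {k : ℕ} (hk : 1 ≤ k) {x : ℝ} (hx : 9 ≤ x) :
    |f ⌊x / k⌋₊ - α / k * (x / √(Real.log x))| ≤
      (8 * A + 2 * B + 6) * (x / Real.log x ^ (3 / 4 : ℝ)) * (k : ℝ) ^ (-(2 / 3) : ℝ) := by
  have hk1 : (1 : ℝ) ≤ k := by exact_mod_cast hk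
  have hk0 : (0 : ℝ) < k := by linarith
  have hx0 : 0 < x := by linarith
  have hA : 0 ≤ A := hα.trans hαA
  set z : ℝ := (k : ℝ) ^ (1 / 3 : ℝ) with hz
  have hz1 : 1 ≤ z := Real.one_le_rpow hk1 (by norm_num)
  have hkz : (k : ℝ) ^ (-(2 / 3) : ℝ) = z / k := by
    rw [hz, ← Real.rpow_sub_one hk0.ne']; norm_num
  have hlog : Real.log k ≤ 3 * z := by
    have : Real.log z = 1 / 3 * Real.log k := Real.log_rpow hk0 _
    linarith [Real.log_le_sub_one_of_pos (by linarith : 0 < z)]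
  have hlogk : 0 ≤ Real.log k := Real.log_nonneg hk1
  have hL1 : 1 ≤ Real.log x := by
    rw [Real.le_log_iff_exp_le hx0]; linarith [Real.exp_one_lt_d9]
  set L := Real.log x with hL
  have h34 : L ^ (3 / 4 : ℝ) ≤ L := by
    conv_rhs => rw [← Real.rpow_one L]
    exact Real.rpow_le_rpow_of_exponent_le hL1 (by norm_num)
  have hpos : 0 < L ^ (3 / 4 : ℝ) := Real.rpow_pos_of_pos (by linarith) _
  have hR : 1 ≤ √L := Real.one_le_sqrt.2 hL1
  rw [hkz]
  by_cases hkx : (k : ℝ) ^ 2 ≤ x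
  · set y := x / k with hy
    have hy3 : 3 ≤ y := by
      rw [hy, le_div_iff₀ hk0]
      nlinarith
    have hly : Real.log y = L - Real.log k := Real.log_div hx0.ne' hk0.ne'
    have hkL : 2 * Real.log k ≤ L := by
      have := Real.log_le_log (by positivity) hkx
      rwa [Real.log_pow, Nat.cast_ofNat] at this
    have hl1 : 1 ≤ Real.log y := by
      rw [Real.le_log_iff_exp_le (by linarith)]; linarith [Real.exp_one_lt_d9]
    set l := Real.log y with hl
    have hr : 1 ≤ √l := Real.one_le_sqrt.2 hl1
    have hrR : √l ≤ √L := Real.sqrt_le_sqrt (by linarith)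
    have hl34 : L ^ (3 / 4 : ℝ) ≤ 2 * l ^ (3 / 4 : ℝ) := by
      have h2 : (2 : ℝ) ^ (3 / 4 : ℝ) ≤ 2 := by
        conv_rhs => rw [← Real.rpow_one 2]
        exact Real.rpow_le_rpow_of_exponent_le (by norm_num) (by norm_num)
      calc L ^ (3 / 4 : ℝ) ≤ (2 * l) ^ (3 / 4 : ℝ) :=
            Real.rpow_le_rpow (by linarith) (by linarith) (by norm_num)
        _ = 2 ^ (3 / 4 : ℝ) * l ^ (3 / 4 : ℝ) := Real.mul_rpow (by norm_num) (by linarith)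
        _ ≤ _ := by gcongr
    have hlpos : 0 < l ^ (3 / 4 : ℝ) := Real.rpow_pos_of_pos (by linarith) _
    have t1 : |f ⌊y⌋₊ - α * (y / √l)| ≤ 2 * B * (y / L ^ (3 / 4 : ℝ)) := by
      refine (h y hy3).trans ?_
      rw [mul_comm 2 B, mul_assoc]
      gcongr
      rw [← mul_div_assoc, div_le_div_iff₀ hlpos hpos]
      nlinarith
    have t2 : |α * (y / √l) - α / k * (x / √L)| ≤ A * (y * Real.log k / L ^ (3 / 4 : ℝ)) := by
      have e : α * (y / √l) - α / k * (x / √L) = α * (y * (√L - √l) / (√l * √L)) := by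
        rw [hy]
        have : √l ≠ 0 := by linarith
        have : √L ≠ 0 := by linarith
        field_simp
      have h0 : 0 ≤ y * (√L - √l) / (√l * √L) :=
        div_nonneg (mul_nonneg (by linarith) (by linarith)) (by positivity)
      rw [e, abs_mul, abs_of_nonneg hα, abs_of_nonneg h0]
      refine mul_le_mul hαA ?_ h0 hA
      have h1 : (√L - √l) * √L ≤ Real.log k := by
        have : (√L - √l) * (√L + √l) = L - l := by
          rw [← Real.sq_sqrt (by linarith : 0 ≤ L), ← Real.sq_sqrt (by linarith : 0 ≤ l)]
          simp only [Real.sqrt_sq (Real.sqrt_nonneg _)]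
          ring
        nlinarith
      have h2 : (√L - √l) / (√l * √L) ≤ Real.log k / L ^ (3 / 4 : ℝ) := by
        calc (√L - √l) / (√l * √L) ≤ (√L - √l) / (1 * √L) := by
              have : 0 ≤ √L - √l := by linarith
              gcongr
          _ = (√L - √l) * √L / L := by
              nth_rw 5 [← Real.sq_sqrt (by linarith : 0 ≤ L)]
              field_simp
          _ ≤ Real.log k / L := by gcongr
          _ ≤ _ := by gcongr
      rw [mul_div_assoc, mul_div_assoc]
      gcongr
    have e : f ⌊y⌋₊ - α / k * (x / √L) =
        (f ⌊y⌋₊ - α * (y / √l)) + (α * (y / √l) - α / k * (x / √L)) := by ring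
    rw [e]
    refine (abs_add_le _ _).trans ((add_le_add t1 t2).trans ?_)
    have e2 : 2 * B * (y / L ^ (3 / 4 : ℝ)) + A * (y * Real.log k / L ^ (3 / 4 : ℝ)) =
        (2 * B + A * Real.log k) * (y / L ^ (3 / 4 : ℝ)) := by ring
    have e3 : (8 * A + 2 * B + 6) * (x / L ^ (3 / 4 : ℝ)) * (z / k) =
      (8 * A + 2 * B + 6) * z * (y / L ^ (3 / 4 : ℝ)) := by rw [hy]; field_simp
    rw [e2, e3]
    have hy0 : 0 ≤ y := by linarith
    gcongr
    calc 2 * B + A * Real.log k ≤ 2 * (B * z) + A * (3 * z) := by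
          gcongr; exact le_mul_of_one_le_right hB.le hz1
      _ ≤ 2 * (B * z) + A * (3 * z) + (5 * (A * z) + 6 * z) := le_add_of_nonneg_right (by positivity)
      _ = _ := by ring
  · push Not at hkx
    have hLz : L ^ (3 / 4 : ℝ) ≤ 6 * z := by
      have := Real.log_le_log hx0 hkx.le
      rw [Real.log_pow, Nat.cast_ofNat] at this
      linarith
    have hy0 : 0 ≤ x / k := by positivity
    have b1 : f ⌊x / k⌋₊ ≤ x / k := (hfN _).trans (Nat.floor_le hy0)
    have b2 : α / k * (x / √L) ≤ A * (x / k) := by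
      rw [div_mul_div_comm, ← div_div, mul_div_assoc]
      refine (div_le_self (by positivity) hR).trans ?_
      gcongr
    have b3 : 0 ≤ α / k * (x / √L) := by positivity
    have hfk := hf0 ⌊x / k⌋₊
    have b4 : |f ⌊x / k⌋₊ - α / k * (x / √L)| ≤ (1 + A) * (x / k) := by
      rw [abs_le]
      constructor <;> nlinarith [mul_nonneg hA hy0]
    refine b4.trans ?_
    have e3 : (8 * A + 2 * B + 6) * (x / L ^ (3 / 4 : ℝ)) * (z / k) =
      (8 * A + 2 * B + 6) * z / L ^ (3 / 4 : ℝ) * (x / k) := by field_simp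
    rw [e3]
    gcongr
    rw [le_div_iff₀ hpos]
    calc (1 + A) * L ^ (3 / 4 : ℝ) ≤ (1 + A) * (6 * z) := by gcongr
      _ ≤ (1 + A) * (6 * z) + (2 * (A * z) + 2 * (B * z)) := le_add_of_nonneg_right (by positivity)
      _ = _ := by ring

end Scaling
end Bernays

namespace Bernays

section Total

variable {G : Type*} [CommGroup G] [Finite G] {S : ℕ → Prop} {c : ℕ → G}

open Classical in
theorem ncard_rep_eq_sum (S rep : ℕ → Prop) {x : ℝ} (hx : 0 ≤ x) :
    {n : ℕ | 0 < n ∧ (n : ℝ) ≤ x ∧ rep n}.ncard =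
      ∑ k ∈ Finset.Ioc 0 ⌊x⌋₊, if AllP (fun p => ¬ S p) k then fibreCount S rep k ⌊x / k⌋₊ else 0 := by
  set N := ⌊x⌋₊ with hN
  rw [← Finset.sum_filter]
  simp_rw [fibreCount]
  have himg : ∀ k ∈ (Finset.Ioc 0 N).filter (fun k => AllP (fun p => ¬ S p) k),
      ((Finset.Ioc 0 ⌊x / k⌋₊).filter fun s => AllP S s ∧ rep (k * s)).card =
      (((Finset.Ioc 0 ⌊x / k⌋₊).filter fun s => AllP S s ∧ rep (k * s)).image (k * ·)).card := by
    intro k hk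
    have hk0 := (Finset.mem_filter.1 hk).2.1
    exact (Finset.card_image_of_injective _ (mul_right_injective₀ hk0)).symm
  rw [Finset.sum_congr rfl himg, ← Finset.card_biUnion, ← Set.ncard_coe_finset]
  · congr 1
    ext n
    simp only [Set.mem_ofPred_eq, Finset.coe_biUnion, Set.mem_iUnion, Finset.mem_coe,
      Finset.mem_filter, Finset.mem_image, Finset.mem_Ioc, ← natCast_floor_div]
    constructor
    · rintro ⟨h0, hnx, hr⟩
      obtain ⟨s, k, rfl, hs, hk⟩ := exists_allP_mul S h0.ne'
      have hs0 := Nat.pos_of_ne_zero hs.1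
      have hk0 := Nat.pos_of_ne_zero hk.1
      have hle : s * k ≤ N := Nat.le_floor hnx
      refine ⟨k, ⟨⟨hk0, (Nat.le_mul_of_pos_left k hs0).trans hle⟩, hk⟩, s, ⟨⟨hs0, ?_⟩, hs, ?_⟩,
        mul_comm k s⟩
      · rwa [Nat.le_div_iff_mul_le hk0]
      · rwa [mul_comm]
    · rintro ⟨k, ⟨⟨hk0, -⟩, -⟩, s, ⟨⟨hs0, hsN⟩, -, hr⟩, rfl⟩
      refine ⟨Nat.mul_pos hk0 hs0, ?_, hr⟩
      rw [Nat.le_div_iff_mul_le hk0, mul_comm] at hsN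
      exact (Nat.cast_le.2 hsN).trans (Nat.floor_le hx)
  · intro k hk k' hk' hne
    rw [Function.onFun, Finset.disjoint_left]
    intro n h1 h2
    obtain ⟨s, hs, rfl⟩ := Finset.mem_image.1 h1
    obtain ⟨s', hs', e⟩ := Finset.mem_image.1 h2
    simp only [Finset.coe_filter, Set.mem_ofPred_eq, Finset.mem_filter] at hk hk' hs hs'
    refine hne (AllP.mul_inj (S := S) (T := fun p => ¬ S p) (fun p h h' => h' h) hs.2.1 hk.2 hs'.2.1
      hk'.2 ?_).2
    rw [mul_comm s, mul_comm s', e]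

theorem exists_represented_asymptotic {K C : ℝ} (hK : 0 < K)
    (hT : ∀ (g : G) (x : ℝ), 0 < x → |((prs S c g x).ncard : ℝ) - K * x| ≤ C * x ^ (2 / 3 : ℝ))
    {Cl : ℕ → Set G} (hCl : (Cl 1).Nonempty)
    (hsum : Summable ({k : ℕ | AllP (fun p => ¬ S p) k ∧ (Cl k).Nonempty}.indicator
      fun k : ℕ => (k : ℝ) ^ (-(2 / 3) : ℝ))) :
    ∃ M : ℝ, 0 < M ∧ ∃ B : ℝ, ∀ (h : G) (rep : ℕ → Prop), Governs S c Cl h rep →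
      ∀ x : ℝ, 9 ≤ x →
      |({n : ℕ | 0 < n ∧ (n : ℝ) ≤ x ∧ rep n}.ncard : ℝ) - M * (x / √(Real.log x))| ≤
        B * (x / Real.log x ^ (3 / 4 : ℝ)) := by
  classical
  obtain ⟨κ, hκ, B, hB, hfib⟩ := exists_fibre_asymptotic hK hT
  set A : ℝ := Nat.card (G ⧸ sqs G) * κ with hA
  set P : Set ℕ := {k : ℕ | AllP (fun p => ¬ S p) k ∧ (Cl k).Nonempty} with hP
  set a : ℕ → ℝ := P.indicator fun k => classNum Cl k * κ / k with ha
  have ha0 : ∀ k, 0 ≤ a k := fun k => Set.indicator_nonneg (fun k _ => by positivity) k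
  have hcn : ∀ k, (classNum Cl k : ℝ) * κ ≤ A := fun k => by
    rw [hA]; gcongr; exact classNum_le Cl k
  have ha_sum : Summable a := by
    refine Summable.of_nonneg_of_le ha0 (fun k => ?_) (hsum.mul_left A)
    rw [ha]
    by_cases hk : k ∈ P
    · rw [Set.indicator_of_mem hk, Set.indicator_of_mem hk, div_eq_mul_inv]
      have hk1 : (1 : ℝ) ≤ k := by exact_mod_cast Nat.pos_of_ne_zero hk.1.1
      refine mul_le_mul (hcn k) ?_ (by positivity) (by positivity)
      rw [← Real.rpow_neg_one]
      exact Real.rpow_le_rpow_of_exponent_le hk1 (by norm_num)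
    · rw [Set.indicator_of_notMem hk, Set.indicator_of_notMem hk, mul_zero]
  have ha1 : 0 < a 1 := by
    rw [ha, Set.indicator_of_mem (show 1 ∈ P from ⟨allP_one _, hCl⟩)]
    have : 0 < classNum Cl 1 := (Set.ncard_pos (Set.toFinite _)).2 (hCl.image _)
    positivity
  refine ⟨∑' k, a k, ha_sum.tsum_pos ha0 1 ha1, (8 * A + 2 * B + 6) *
    ∑' k, P.indicator (fun k : ℕ => (k : ℝ) ^ (-(2 / 3) : ℝ)) k, fun h rep hrep x hx => ?_⟩
  set g : ℕ → ℝ := fun k => if AllP (fun p => ¬ S p) k then (fibreCount S rep k ⌊x / k⌋₊ : ℝ) else 0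
    with hg
  have hgsum : HasSum g (({n : ℕ | 0 < n ∧ (n : ℝ) ≤ x ∧ rep n}.ncard : ℝ)) := by
    rw [ncard_rep_eq_sum S rep (by linarith : 0 ≤ x), Nat.cast_sum]
    have : ∀ k, ((if AllP (fun p => ¬ S p) k then fibreCount S rep k ⌊x / k⌋₊ else 0 : ℕ) : ℝ) = g k :=
      fun k => by rw [hg]; push_cast; rfl
    simp_rw [this]
    refine hasSum_sum_of_ne_finset_zero fun k hk => ?_
    rw [hg]
    simp only
    split_ifs with hkS
    · have hk0 := Nat.pos_of_ne_zero hkS.1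
      have : ⌊x⌋₊ < k := by
        by_contra hle
        exact hk (Finset.mem_Ioc.2 ⟨hk0, not_lt.1 hle⟩)
      rw [← natCast_floor_div, Nat.div_eq_of_lt this, Nat.cast_eq_zero]
      exact Nat.le_zero.1 (fibreCount_le rep k 0)
    · rfl
  have hdiff := hgsum.sub (ha_sum.hasSum.mul_right (x / √(Real.log x)))
  have hbd := (hsum.mul_left ((8 * A + 2 * B + 6) * (x / Real.log x ^ (3 / 4 : ℝ)))).hasSum
  have key := hdiff.norm_le_of_bounded hbd fun k => ?_
  · rw [Real.norm_eq_abs, tsum_mul_left] at key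
    refine key.trans_eq ?_
    ring
  · rw [Real.norm_eq_abs]
    by_cases hkS : AllP (fun p => ¬ S p) k
    · by_cases hne : (Cl k).Nonempty
      · have hkP : k ∈ P := ⟨hkS, hne⟩
        rw [ha, Set.indicator_of_mem hkP, Set.indicator_of_mem hkP, hg]
        simp only [if_pos hkS]
        exact scaled_term_bound (f := fun N => (fibreCount S rep k N : ℝ)) (by positivity) (hcn k) hB
          (fun N => Nat.cast_nonneg _) (fun N => by exact_mod_cast fibreCount_le rep k N)
          (fun y hy => hfib Cl h rep hrep k hkS y hy) (Nat.pos_of_ne_zero hkS.1) hx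
      · have hkP : k ∉ P := fun h => hne h.2
        have h0 : fibreCount S rep k ⌊x / k⌋₊ = 0 := by
          rw [fibreCount, Finset.card_eq_zero, Finset.filter_eq_empty_iff]
          rintro s - ⟨hs, hr⟩
          obtain ⟨d, -, e, he, -⟩ := (hrep k s hkS hs).1 hr
          exact hne ⟨e, he⟩
        rw [ha, Set.indicator_of_notMem hkP, Set.indicator_of_notMem hkP, hg]
        simp [h0]
    · have hkP : k ∉ P := fun h => hkS h.1
      rw [ha, Set.indicator_of_notMem hkP, Set.indicator_of_notMem hkP, hg]
      simp [hkS]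

/-- Numbers that are a square times one of finitely many values are sparse. -/
theorem summable_indicator_square_multiples {P : Set ℕ} {D : ℕ} (hD : D ≠ 0)
    (h : ∀ k ∈ P, k ≠ 0 ∧ ∃ r m : ℕ, k = r * m ^ 2 ∧ r ∣ D) :
    Summable (P.indicator fun k : ℕ => (k : ℝ) ^ (-(2 / 3) : ℝ)) := by
  have h' : ∀ k : P, ∃ z : D.divisors × ℕ, (k : ℕ) = z.1 * z.2 ^ 2 := by
    rintro ⟨k, hk⟩
    obtain ⟨-, r, m, e, hr⟩ := h k hk
    exact ⟨(⟨r, Nat.mem_divisors.2 ⟨hr, hD⟩⟩, m), e⟩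
  choose z hz using h'
  have hinj : Function.Injective z := fun k k' e => by
    apply Subtype.ext; rw [hz, hz, e]
  have hs : Summable fun w : D.divisors × ℕ => (w.2 : ℝ) ^ (-(4 / 3) : ℝ) := by
    have h1 : Summable fun m : ℕ => (m : ℝ) ^ (-(4 / 3) : ℝ) :=
      Real.summable_nat_rpow.2 (by norm_num)
    refine (summable_prod_of_nonneg fun w => ?_).2 ⟨fun _ => h1, Summable.of_finite⟩
    exact Real.rpow_nonneg (Nat.cast_nonneg _) _
  rw [← summable_subtype_iff_indicator]
  refine Summable.of_nonneg_of_le (fun k => ?_) (fun k => ?_) (hs.comp_injective hinj)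
  · exact Real.rpow_nonneg (Nat.cast_nonneg _) _
  · obtain ⟨hk0, -⟩ := h k k.2
    have hk := hz k
    set r : ℕ := ((z k).1 : ℕ) with hr
    set m := (z k).2 with hm
    rw [hk] at hk0
    have hr0 : (1 : ℝ) ≤ r := by exact_mod_cast Nat.pos_of_ne_zero (left_ne_zero_of_mul hk0)
    have hm0 : (0 : ℝ) < m := by
      have : m ≠ 0 := by rintro h; rw [h] at hk0; simp at hk0
      exact_mod_cast Nat.pos_of_ne_zero this
    simp only [Function.comp_apply, ← hm, hk]
    push_cast
    rw [Real.mul_rpow (by linarith) (by positivity), ← Real.rpow_natCast (m : ℝ) 2,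
      ← Real.rpow_mul hm0.le]
    norm_num
    refine mul_le_of_le_one_left (by positivity) ?_
    exact Real.rpow_le_one_of_one_le_of_nonpos hr0 (by norm_num)

end Total
end Bernays

namespace Bernays

theorem exists_combination_eq_one {a b c : ℤ} (h : Int.gcd (Int.gcd a b) c = 1) :
    ∃ x y z : ℤ, x * a + y * b + z * c = 1 := by
  have h1 := Int.gcd_eq_gcd_ab (Int.gcd a b) c
  have h2 := Int.gcd_eq_gcd_ab a b
  rw [h, Nat.cast_one] at h1
  exact ⟨Int.gcdA a b * Int.gcdA (Int.gcd a b) c, Int.gcdB a b * Int.gcdA (Int.gcd a b) c,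
    Int.gcdB (Int.gcd a b) c, by linear_combination -h1 - Int.gcdA (Int.gcd a b) c * h2⟩

section Form

variable (t n : ℤ) [hD : Fact (t ^ 2 - 4 * n < 0)]

theorem exists_governs {a b c : ℤ} (ha : 0 < a) (hprim : Int.gcd (Int.gcd a b) c = 1)
    (hdisc : b ^ 2 - 4 * a * c = t ^ 2 - 4 * n) :
    ∃ h : HS t n, Governs (IsS t n) (cH t n) (ClS t n) h
      fun m => ∃ u v : ℤ, (m : ℤ) = a * u ^ 2 + b * u * v + c * v ^ 2 := by
  have hneg := hD.out
  obtain ⟨s, rfl⟩ := Int.eq_ofNat_of_zero_le ha.le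
  have hs0 : s ≠ 0 := by rintro rfl; simp at ha
  have hpar : ∃ r : ℤ, b = t - 2 * r := by
    have h2 : Even (t ^ 2 - b ^ 2) := ⟨2 * (n - s * c), by linarith⟩
    have h3 : Even (t - b) := by
      have := (Int.even_sub.1 h2)
      rw [Int.even_pow' two_ne_zero, Int.even_pow' two_ne_zero] at this
      exact Int.even_sub.2 this
    obtain ⟨r, hr⟩ := h3
    exact ⟨r, by linarith⟩
  obtain ⟨r, rfl⟩ := hpar
  have hc : r ^ 2 - t * r + n = s * c := by linarith
  have hg := exists_combination_eq_one hprim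
  have hI := isN_Kid_of_primitive hc hg
  have hmem : (cls (Kid (t := t) (n := n) s r))⁻¹ ∈ HS t n := by
    have hN : (t ^ 2 - 4 * n).natAbs ≠ 0 := Int.natAbs_ne_zero.2 hneg.ne
    obtain ⟨u, v, hu, hco⟩ := exists_coprime_value hg hN
    have hpos : 0 < (s : ℤ) * u ^ 2 + (t - 2 * r) * u * v + c * v ^ 2 := by
      have h4 : 4 * (s : ℤ) * (s * u ^ 2 + (t - 2 * r) * u * v + c * v ^ 2) =
          (2 * s * u + (t - 2 * r) * v) ^ 2 + (4 * n - t ^ 2) * v ^ 2 := by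
        linear_combination (-v ^ 2) * hdisc
      have h5 : 0 < (2 * s * u + (t - 2 * r) * v) ^ 2 + (4 * n - t ^ 2) * v ^ 2 := by
        by_cases hv : v = 0
        · subst hv
          have : 0 < (2 * s * u) ^ 2 := by positivity
          simpa using this
        · have : 0 < (4 * n - t ^ 2) * v ^ 2 := mul_pos (by linarith) (by positivity)
          have := sq_nonneg (2 * s * u + (t - 2 * r) * v)
          linarith
      rw [← h4] at h5
      exact pos_of_mul_pos_right h5 (by positivity)
    obtain ⟨m, hm⟩ := Int.eq_ofNat_of_zero_le hpos.le
    have hm0 : m ≠ 0 := by rintro rfl; rw [hm] at hpos; simp at hpos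
    obtain ⟨B, hB, hBc⟩ := (represents_iff hs0 hm0 hc hI).1 ⟨u, v, hm.symm⟩
    rw [← hBc]
    refine hB.cls_mem_HS hm0 ?_
    rw [hm] at hco
    rw [Int.natCast_natAbs] at hco
    exact (IsCoprime.abs_right_iff _ _).1 hco
  refine ⟨⟨_, hmem⟩, fun k s' hk hs' => ?_⟩
  rw [← exists_isN_iff hs' hk.1]
  exact represents_iff hs0 (mul_ne_zero hk.1 hs'.1) hc hI

theorem summable_ClS : Summable ({k : ℕ | AllP (fun p => ¬ IsS t n p) k ∧
    (ClS t n k).Nonempty}.indicator fun k : ℕ => (k : ℝ) ^ (-(2 / 3) : ℝ)) := by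
  refine summable_indicator_square_multiples (D := (t ^ 2 - 4 * n).natAbs)
    (Int.natAbs_ne_zero.2 hD.out.ne) ?_
  rintro k ⟨hk, _, B, hB, -⟩
  obtain ⟨r, m, h1, h2⟩ := hB.exists_squarefree hk
  exact ⟨hk.1, r, m, h1, Int.natCast_dvd.1 h2⟩

theorem exists_Bcount_asymptotic : ∃ M : ℝ, 0 < M ∧ ∀ a b c : ℤ, 0 < a →
    Int.gcd (Int.gcd a b) c = 1 → b ^ 2 - 4 * a * c = t ^ 2 - 4 * n →
    (fun x : ℝ => (Bcount a b c x : ℝ) - M * x / Real.sqrt (Real.log x)) =O[atTop]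
      fun x : ℝ => x / Real.log x ^ ((1 : ℝ) / 2 + 1 / 4) := by
  obtain ⟨K, hK, C, hT⟩ := exists_prs_count t n
  obtain ⟨M, hM, B, h⟩ := exists_represented_asymptotic hK hT ⟨1, one_mem_ClS⟩ (summable_ClS t n)
  refine ⟨M, hM, fun a b c ha hprim hdisc => ?_⟩
  obtain ⟨g, hg⟩ := exists_governs t n ha hprim hdisc
  refine IsBigO.of_bound B ?_
  filter_upwards [eventually_ge_atTop (9 : ℝ)] with x hx
  have hlog : 0 ≤ Real.log x := Real.log_nonneg (by linarith)
  have hx0 : 0 ≤ x := by linarith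
  rw [Real.norm_eq_abs, Real.norm_eq_abs, abs_of_nonneg (a := x / _) (by positivity),
    show (1 : ℝ) / 2 + 1 / 4 = 3 / 4 by norm_num, mul_div_assoc]
  exact h g _ hg x hx

end Form

end Bernays

/-- Bernays' theorem: `B_f(x) = C·x/√(log x) + O(x/(log x)^{1/2+δ})` with `C > 0`
depending only on the discriminant. -/
theorem stmt19 (a b c : ℤ) (ha : 0 < a) (hprim : Int.gcd (Int.gcd a b) c = 1)
    (hD : b ^ 2 - 4 * a * c < 0) :
    ∃ C δ : ℝ, 0 < C ∧ 0 < δ ∧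
      ((fun x : ℝ => (Bcount a b c x : ℝ) - C * x / Real.sqrt (Real.log x)) =O[atTop]
        fun x : ℝ => x / Real.log x ^ ((1 : ℝ) / 2 + δ)) ∧
      ∀ a' b' c' : ℤ, 0 < a' → Int.gcd (Int.gcd a' b') c' = 1 →
        b' ^ 2 - 4 * a' * c' = b ^ 2 - 4 * a * c →
        ((fun x : ℝ => (Bcount a' b' c' x : ℝ) - C * x / Real.sqrt (Real.log x)) =O[atTop]
          fun x : ℝ => x / Real.log x ^ ((1 : ℝ) / 2 + δ)) := by
  have e : b ^ 2 - 4 * a * c = b ^ 2 - 4 * (a * c) := by ring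
  have : Fact (b ^ 2 - 4 * (a * c) < 0) := ⟨e ▸ hD⟩
  obtain ⟨M, hM, h⟩ := Bernays.exists_Bcount_asymptotic b (a * c)
  exact ⟨M, 1 / 4, hM, by norm_num, h a b c ha hprim e,
    fun a' b' c' ha' hp' hd' => h a' b' c' ha' hp' (hd'.trans e)⟩
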